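/- Let k and ℓ be number fields, let a, b ∈ k and c, d ∈ ℓ be nonzero, set K = k_{a,b} and L = ℓ_{c,d}, and let α be a Witt equivalence from K to L. Then for every u ∈ Kˣ, the square class of u in Kˣ/Kˣ² equals the square class of an element of kˣ if and only if α(ū) equals the square class of an element of ℓˣ. In particular, α restricts to a group isomorphism between the image of kˣ/kˣ² in Kˣ/Kˣ² and the image of ℓˣ/ℓˣ² in Lˣ/Lˣ². -/

import Mathlib

open MvPolynomial

noncomputable section

/-- The defining polynomial `a·x² + b·y² − 1` of the affine conic. -/
def conicPoly (k : Type*) [Field k] (a b : k) : MvPolynomial (Fin 2) k :=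
  C a * X 0 ^ 2 + C b * X 1 ^ 2 - 1

/-- The coordinate ring `k[x,y]/(a·x² + b·y² − 1)` of the affine conic. -/
abbrev ConicRing (k : Type*) [Field k] (a b : k) : Type _ :=
  MvPolynomial (Fin 2) k ⧸ Ideal.span {conicPoly k a b}

/-- `K` (together with the embedding `ι : k →+* K`) is a model of the function field
`k_{a,b}`, i.e. the quotient field of `k[x,y]/(a·x² + b·y² − 1)`. -/
def IsConicFunctionField (k : Type*) [Field k] (a b : k)
    (K : Type*) [Field K] (ι : k →+* K) : Prop :=
  ∃ f : ConicRing k a b →+* K,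
    Function.Injective f ∧
    f.comp (algebraMap k (ConicRing k a b)) = ι ∧
    ∀ z : K, ∃ p q : ConicRing k a b, f q ≠ 0 ∧ z = f p / f q

/-- The subgroup of squares in `Kˣ`. -/
def sqSubgroup (K : Type*) [Field K] : Subgroup Kˣ :=
  MonoidHom.range (powMonoidHom 2 : Kˣ →* Kˣ)

/-- The square class group `Kˣ/Kˣ²`. -/
abbrev SqClass (K : Type*) [Field K] := Kˣ ⧸ sqSubgroup K

/-- The square class of a unit. -/
def sqCl {K : Type*} [Field K] (u : Kˣ) : SqClass K := QuotientGroup.mk u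

/-- `α : Kˣ/Kˣ² → Lˣ/Lˣ²` is a Witt equivalence: it sends `-1` to `-1` and preserves
binary value sets. -/
structure IsWittEquiv {K L : Type*} [Field K] [Field L]
    (α : SqClass K ≃* SqClass L) : Prop where
  map_neg_one : α (sqCl (-1)) = sqCl (-1)
  represents : ∀ (a b c : Kˣ) (a' b' c' : Lˣ),
    α (sqCl a) = sqCl a' → α (sqCl b) = sqCl b' → α (sqCl c) = sqCl c' →
    ((∃ x y : K, (c : K) = (a : K) * x ^ 2 + (b : K) * y ^ 2) ↔
      (∃ x y : L, (c' : L) = (a' : L) * x ^ 2 + (b' : L) * y ^ 2))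

/-- Two fields are Witt equivalent if there is a Witt equivalence between them. -/
def WittEquivalent (K L : Type*) [Field K] [Field L] : Prop :=
  ∃ α : SqClass K ≃* SqClass L, IsWittEquiv α

/-- An ordering of a field `F`. -/
structure IsOrdering {F : Type*} [Field F] (P : Set F) : Prop where
  add_mem : ∀ x ∈ P, ∀ y ∈ P, x + y ∈ P
  mul_mem : ∀ x ∈ P, ∀ y ∈ P, x * y ∈ P
  total : ∀ x : F, x ∈ P ∨ -x ∈ P
  antisymm : ∀ x : F, x ∈ P → -x ∈ P → x = 0

/-- A set of nonzero elements closed under multiplication and containing all nonzero squares,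
i.e. a subgroup of the multiplicative group containing the squares. -/
structure IsSqGroup {E : Type*} [Field E] (T : Set E) : Prop where
  zero_notMem : (0 : E) ∉ T
  sq_mem : ∀ x : E, x ≠ 0 → x ^ 2 ∈ T
  mul_mem : ∀ {x y : E}, x ∈ T → y ∈ T → x * y ∈ T

namespace IsSqGroup

variable {E : Type*} [Field E] {T : Set E}

theorem ne_zero (hT : IsSqGroup T) {x : E} (hx : x ∈ T) : x ≠ 0 := by
  rintro rfl
  exact hT.zero_notMem hx

theorem one_mem (hT : IsSqGroup T) : (1 : E) ∈ T := by
  simpa using hT.sq_mem 1 one_ne_zero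

theorem mul_sq_mem (hT : IsSqGroup T) {x z : E} (hx : x ∈ T) (hz : z ≠ 0) : x * z ^ 2 ∈ T :=
  hT.mul_mem hx (hT.sq_mem z hz)

theorem of_mul_sq_mem (hT : IsSqGroup T) {x z : E} (hx : x * z ^ 2 ∈ T) : x ∈ T := by
  have h0 := hT.ne_zero hx
  have hz : z ≠ 0 := by rintro rfl; simp at h0
  have := hT.mul_sq_mem hx (inv_ne_zero hz)
  have e : x * z ^ 2 * z⁻¹ ^ 2 = x := by field_simp
  rwa [e] at this

/-- Membership transfers along equality up to a nonzero square, written without division. -/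
theorem congr (hT : IsSqGroup T) {x y z w : E} (hx : x ∈ T) (hz : z ≠ 0)
    (h : y * w ^ 2 = x * z ^ 2) : y ∈ T :=
  hT.of_mul_sq_mem (z := w) (h ▸ hT.mul_sq_mem hx hz)

theorem inv_mem (hT : IsSqGroup T) {x : E} (hx : x ∈ T) : x⁻¹ ∈ T := by
  have h0 := hT.ne_zero hx
  exact hT.congr (w := x) (z := 1) hx one_ne_zero (by field_simp)

theorem of_mul_left (hT : IsSqGroup T) {x y : E} (hx : x ∈ T) (hxy : x * y ∈ T) : y ∈ T := by
  have h0 := hT.ne_zero hx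
  have := hT.mul_mem (hT.inv_mem hx) hxy
  rwa [inv_mul_cancel_left₀ h0] at this

theorem of_mul_right (hT : IsSqGroup T) {x y : E} (hy : y ∈ T) (hxy : x * y ∈ T) : x ∈ T :=
  hT.of_mul_left hy (by rwa [mul_comm])

/-- The subgroup `T ∪ -T`. -/
theorem pm (hT : IsSqGroup T) : IsSqGroup {x : E | x ∈ T ∨ -x ∈ T} where
  zero_notMem := by
    simp [hT.zero_notMem]
  sq_mem x hx := Or.inl (hT.sq_mem x hx)
  mul_mem := by
    rintro x y (hx | hx) (hy | hy)
    · exact Or.inl (hT.mul_mem hx hy)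
    · exact Or.inr (by simpa using hT.mul_mem hx hy)
    · exact Or.inr (by simpa using hT.mul_mem hx hy)
    · exact Or.inl (by simpa using hT.mul_mem hx hy)

/-- The subgroup `H ∪ pH`. -/
theorem adjoin {H : Set E} (hH : IsSqGroup H) (p : E) :
    IsSqGroup {x : E | x ∈ H ∨ x * p ∈ H} where
  zero_notMem := by
    simp [hH.zero_notMem]
  sq_mem x hx := Or.inl (hH.sq_mem x hx)
  mul_mem := by
    rintro x y (hx | hx) (hy | hy)
    · exact Or.inl (hH.mul_mem hx hy)
    · exact Or.inr (by simpa [mul_assoc] using hH.mul_mem hx hy)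
    · exact Or.inr (by simpa [mul_assoc, mul_left_comm, mul_comm] using hH.mul_mem hx hy)
    · exact Or.inl (hH.congr (w := p) (z := 1) (hH.mul_mem hx hy) one_ne_zero (by ring))

end IsSqGroup

/-- Every element outside `H` is `T`-rigid. -/
def RigidOutside {E : Type*} [Field E] (T H : Set E) : Prop :=
  ∀ x : E, x ≠ 0 → x ∉ H → 1 + x ∈ T ∨ x * (1 + x) ∈ T

/-- The hypotheses of the construction of a valuation from rigid elements. -/
structure RigidPair {E : Type*} [Field E] (T H : Set E) : Prop where
  grpT : IsSqGroup T
  grpH : IsSqGroup H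
  sub : T ⊆ H
  neg_one_mem : (-1 : E) ∈ H
  rigid : RigidOutside T H

/-- The elements outside `H` which will be non-units of the valuation ring. -/
def smallSet {E : Type*} [Field E] (T H : Set E) : Set E :=
  {x | x ≠ 0 ∧ x ∉ H ∧ 1 - x ∈ T}

namespace RigidPair

variable {E : Type*} [Field E] {T H : Set E}

theorem neg_notMem (h : RigidPair T H) {x : E} (hx : x ∉ H) : -x ∉ H := fun hn =>
  hx (by simpa using h.grpH.mul_mem h.neg_one_mem hn)

theorem mul_notMem (h : RigidPair T H) {x y : E} (hx : x ∈ H) (hy : y ∉ H) : x * y ∉ H :=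
  fun hn => hy (h.grpH.of_mul_left hx hn)

theorem inv_notMem (h : RigidPair T H) {x : E} (hx : x ∉ H) : x⁻¹ ∉ H := fun hn =>
  hx (by simpa using h.grpH.inv_mem hn)

theorem rigid_sub (h : RigidPair T H) {x : E} (h0 : x ≠ 0) (hx : x ∉ H) :
    1 - x ∈ T ∨ -x * (1 - x) ∈ T := by
  simpa [sub_eq_add_neg] using h.rigid (-x) (neg_ne_zero.2 h0) (h.neg_notMem hx)

theorem rigid_add (h : RigidPair T H) {x s t : E} (h0 : x ≠ 0) (hx : x ∉ H) (hs : s ∈ T)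
    (ht : t ∈ T) : s + x * t ∈ T ∨ x * (s + x * t) ∈ T := by
  have hs0 := h.grpT.ne_zero hs
  have ht0 := h.grpT.ne_zero ht
  have hq : t / s ∈ T := by
    rw [div_eq_mul_inv]
    exact h.grpT.mul_mem ht (h.grpT.inv_mem hs)
  have hn : x * (t / s) ∉ H := by
    rw [mul_comm]
    exact h.mul_notMem (h.sub hq) hx
  rcases h.rigid _ (mul_ne_zero h0 (div_ne_zero ht0 hs0)) hn with h1 | h1
  · left
    have := h.grpT.mul_mem hs h1
    rwa [show s * (1 + x * (t / s)) = s + x * t by field_simp] at this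
  · right
    refine h.grpT.congr (w := 1) (z := s) (h.grpT.mul_mem (h.grpT.mul_mem h1 ht) ?_) hs0
      (x := x * (t / s) * (1 + x * (t / s)) * t * t⁻¹ ^ 2) ?_
    · exact h.grpT.sq_mem _ (inv_ne_zero ht0)
    · field_simp

theorem small_or_inv (h : RigidPair T H) {x : E} (h0 : x ≠ 0) (hx : x ∉ H) :
    x ∈ smallSet T H ∨ x⁻¹ ∈ smallSet T H := by
  rcases h.rigid_sub h0 hx with h1 | h1
  · exact Or.inl ⟨h0, hx, h1⟩
  · refine Or.inr ⟨inv_ne_zero h0, h.inv_notMem hx, ?_⟩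
    exact h.grpT.congr (w := x) (z := 1) h1 one_ne_zero (by field_simp; ring)

theorem small_not_inv (h : RigidPair T H) {x : E} (hx : x ∈ smallSet T H) :
    x⁻¹ ∉ smallSet T H := by
  rintro ⟨-, -, h2⟩
  obtain ⟨h0, hH, h1⟩ := hx
  have h3 : -x ∈ T := h.grpT.of_mul_right h1
    (h.grpT.congr (w := 1) (z := x) h2 h0 (by field_simp; ring))
  exact h.neg_notMem hH (h.sub h3)

theorem inv_small_of_not (h : RigidPair T H) {x : E} (h0 : x ≠ 0) (hx : x ∉ H)
    (hn : x ∉ smallSet T H) : x⁻¹ ∈ smallSet T H :=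
  (h.small_or_inv h0 hx).resolve_left hn

theorem one_sub_mul_mem (h : RigidPair T H) {x y : E} (hx : x ∈ smallSet T H)
    (hy : y ∈ smallSet T H) (hxy : x * y ∉ T) : 1 - x * y ∈ T := by
  have h1 := h.rigid_add hx.1 hx.2.1 hx.2.2 hy.2.2
  have h2 := h.rigid_add hy.1 hy.2.1 hy.2.2 hx.2.2
  rw [show 1 - x + x * (1 - y) = 1 - x * y by ring] at h1
  rw [show 1 - y + y * (1 - x) = 1 - x * y by ring] at h2
  rcases h1 with h1 | h1
  · exact h1
  rcases h2 with h2 | h2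
  · exact h2
  refine absurd (h.grpT.of_mul_sq_mem (z := 1 - x * y) ?_) hxy
  have := h.grpT.mul_mem h1 h2
  rwa [show x * (1 - x * y) * (y * (1 - x * y)) = x * y * (1 - x * y) ^ 2 by ring] at this

theorem incomparable_aux (h : RigidPair T H) {a x y : E} (ha : a ∈ H) (hx : x ∈ smallSet T H)
    (hy : y ∈ smallSet T H) (hax : a * x ∉ smallSet T H) (hay : a⁻¹ * y ∉ smallSet T H) :
    a * x * y ∈ T ∨ -(a * x * y) ∈ T := by
  have ha0 := h.grpH.ne_zero ha
  have hx0 := hx.1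
  have hy0 := hy.1
  have hb := h.inv_small_of_not (mul_ne_zero ha0 hx0) (h.mul_notMem ha hx.2.1) hax
  have hd := h.inv_small_of_not (mul_ne_zero (inv_ne_zero ha0) hy0)
    (h.mul_notMem (h.grpH.inv_mem ha) hy.2.1) hay
  by_contra! hcon
  have h1 := h.one_sub_mul_mem hy hb fun hm =>
    hcon.1 (h.grpT.congr (w := 1) (z := a * x) hm (mul_ne_zero ha0 hx0) (by field_simp))
  have h2 := h.one_sub_mul_mem hx hd fun hm =>
    hcon.1 (h.grpT.congr (w := 1) (z := y) hm hy0 (by field_simp))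
  refine hcon.2 (h.grpT.of_mul_right h2 ?_)
  exact h.grpT.congr (w := 1) (z := a * x) h1 (mul_ne_zero ha0 hx0) (by field_simp; ring)

theorem incomparable_prod (h : RigidPair T H) {a x y : E} (ha : a ∈ H) (hx : x ∈ smallSet T H)
    (hy : y ∈ smallSet T H) (hax : a * x ∉ smallSet T H) (hay : a⁻¹ * y ∉ smallSet T H) :
    x * y ∈ {t | t ∈ T ∨ -t ∈ T} := by
  have ha0 := h.grpH.ne_zero ha
  have hx0 := hx.1
  have hb := h.inv_small_of_not (mul_ne_zero ha0 hx0) (h.mul_notMem ha hx.2.1) hax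
  have hab : a * (a * x)⁻¹ ∉ smallSet T H := by
    rw [show a * (a * x)⁻¹ = x⁻¹ by field_simp]
    exact h.small_not_inv hx
  have := h.incomparable_aux ha hb hy hab hay
  exact h.grpT.pm.congr (w := 1) (z := x) this hx0 (by field_simp)

theorem incomparable (h : RigidPair T H) {a x y : E} (ha : a ∈ H) (hx : x ∈ smallSet T H)
    (hy : y ∈ smallSet T H) (hax : a * x ∉ smallSet T H) (hay : a⁻¹ * y ∉ smallSet T H) :
    a ∈ T ∨ -a ∈ T := by
  have h1 := h.incomparable_aux ha hx hy hax hay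
  have h2 := h.incomparable_prod ha hx hy hax hay
  refine h.grpT.pm.of_mul_right h2 ?_
  rw [← mul_assoc]
  exact h1

theorem one_sub_mul_notMem (h : RigidPair T H) {x y : E} (hx : x ∈ smallSet T H)
    (hy : y ∈ smallSet T H) (hn : (1 - x) * y ∉ smallSet T H) : -(x * y) ∈ T := by
  have hu := hx.2.2
  have hu0 := h.grpT.ne_zero hu
  have hy0 := hy.1
  have h1 : -((1 - x) * y) * (1 - (1 - x) * y) ∈ T :=
    (h.rigid_sub (mul_ne_zero hu0 hy0) (h.mul_notMem (h.sub hu) hy.2.1)).resolve_left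
      fun hm => hn ⟨mul_ne_zero hu0 hy0, h.mul_notMem (h.sub hu) hy.2.1, hm⟩
  have h2 : -y * (1 - (1 - x) * y) ∈ T := by
    refine h.grpT.of_mul_left hu ?_
    convert h1 using 1
    ring
  have h3 : -(1 - (1 - x) * y) / y ∈ T :=
    h.grpT.congr (w := y) (z := 1) h2 one_ne_zero (by field_simp)
  have h4 : -y * (-(1 - (1 - x) * y) / y + x * 1) ∈ T := by
    convert hy.2.2 using 1
    field_simp
    ring
  rcases h.rigid_add hx.1 hx.2.1 h3 h.grpT.one_mem with h5 | h5
  · exact absurd (h.sub (h.grpT.of_mul_right h5 h4)) (h.neg_notMem hy.2.1)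
  · have h6 := h.grpT.mul_mem h4 h5
    set w := -(1 - (1 - x) * y) / y + x * 1
    refine h.grpT.of_mul_sq_mem (z := w) ?_
    convert h6 using 1
    ring

/-- Any two elements of `H` are comparable with respect to their action on the small elements. -/
def Comparable (T H : Set E) : Prop :=
  ∀ a ∈ H, (∀ x ∈ smallSet T H, a * x ∈ smallSet T H) ∨
    (∀ x ∈ smallSet T H, a⁻¹ * x ∈ smallSet T H)

/-- `1 - x` preserves small elements for small `x`. -/
def Preadditive (T H : Set E) : Prop :=
  ∀ x ∈ smallSet T H, ∀ y ∈ smallSet T H, (1 - x) * y ∈ smallSet T H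

theorem neg_small (h : RigidPair T H) (hc : Comparable T H) {x : E} (hx : x ∈ smallSet T H) :
    -x ∈ smallSet T H := by
  rcases hc (-1) h.neg_one_mem with h1 | h1
  · simpa using h1 x hx
  · simpa [inv_neg] using h1 x hx

/-- The elements of the valuation ring attached to a rigid pair. -/
def ringSet (T H : Set E) : Set E :=
  {x | x = 0 ∨ x ∈ smallSet T H ∨ (x ∈ H ∧ ∀ y ∈ smallSet T H, x * y ∈ smallSet T H)}

theorem small_mul_small (h : RigidPair T H) (hc : Comparable T H) {x y : E}
    (hx : x ∈ smallSet T H) (hy : y ∈ smallSet T H) : x * y ∈ ringSet T H := by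
  have hx0 := hx.1
  have hy0 := hy.1
  by_cases hH : x * y ∈ H
  · right; right
    refine ⟨hH, ?_⟩
    rcases hc _ hH with h1 | h1
    · exact h1
    · exfalso
      have := h1 x hx
      rw [show (x * y)⁻¹ * x = y⁻¹ by field_simp] at this
      exact h.small_not_inv hy this
  · right; left
    exact ⟨mul_ne_zero hx.1 hy.1, hH, h.one_sub_mul_mem hx hy fun ht => hH (h.sub ht)⟩

theorem mul_mem_ringSet (h : RigidPair T H) (hc : Comparable T H) {x y : E}
    (hx : x ∈ ringSet T H) (hy : y ∈ ringSet T H) : x * y ∈ ringSet T H := by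
  rcases hx with rfl | hx | ⟨hx, hx'⟩
  · simp [ringSet]
  · rcases hy with rfl | hy | ⟨hy, hy'⟩
    · simp [ringSet]
    · exact h.small_mul_small hc hx hy
    · right; left
      rw [mul_comm]
      exact hy' x hx
  · rcases hy with rfl | hy | ⟨hy, hy'⟩
    · simp [ringSet]
    · exact Or.inr (Or.inl (hx' y hy))
    · right; right
      refine ⟨h.grpH.mul_mem hx hy, fun z hz => ?_⟩
      rw [mul_assoc]
      exact hx' _ (hy' z hz)

theorem one_mem_ringSet (h : RigidPair T H) : (1 : E) ∈ ringSet T H :=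
  Or.inr (Or.inr ⟨h.grpH.one_mem, fun y hy => by simpa using hy⟩)

theorem neg_mem_ringSet (h : RigidPair T H) (hc : Comparable T H) {x : E}
    (hx : x ∈ ringSet T H) : -x ∈ ringSet T H := by
  rcases hx with rfl | hx | ⟨hx, hx'⟩
  · simp [ringSet]
  · exact Or.inr (Or.inl (h.neg_small hc hx))
  · right; right
    refine ⟨by simpa using h.grpH.mul_mem h.neg_one_mem hx, fun y hy => ?_⟩
    simpa using h.neg_small hc (hx' y hy)

theorem mem_or_inv_ringSet (h : RigidPair T H) (hc : Comparable T H) (x : E) :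
    x ∈ ringSet T H ∨ x⁻¹ ∈ ringSet T H := by
  by_cases h0 : x = 0
  · simp [ringSet, h0]
  by_cases hH : x ∈ H
  · rcases hc x hH with h1 | h1
    · exact Or.inl (Or.inr (Or.inr ⟨hH, h1⟩))
    · exact Or.inr (Or.inr (Or.inr ⟨h.grpH.inv_mem hH, h1⟩))
  · rcases h.small_or_inv h0 hH with h1 | h1
    · exact Or.inl (Or.inr (Or.inl h1))
    · exact Or.inr (Or.inr (Or.inl h1))

/-- For small `y`, the inverse of `1 - y` is `1 - y'` with `y'` small. -/
theorem small_div_one_sub (h : RigidPair T H) (hc : Comparable T H) {y : E}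
    (hy : y ∈ smallSet T H) : -y / (1 - y) ∈ smallSet T H := by
  have hu := hy.2.2
  have hu0 := h.grpT.ne_zero hu
  have hn := h.neg_small hc hy
  refine ⟨div_ne_zero hn.1 hu0, fun hm => ?_, ?_⟩
  · exact hn.2.1 (h.grpH.congr (w := 1) (z := 1 - y) (x := -y / (1 - y) * (1 - y)⁻¹)
      (h.grpH.mul_mem hm (h.grpH.inv_mem (h.sub hu))) hu0 (by field_simp))
  · have := h.grpT.inv_mem hu
    rwa [show 1 - -y / (1 - y) = (1 - y)⁻¹ by field_simp; ring]

theorem one_sub_mem_ringSet (h : RigidPair T H) (hc : Comparable T H) (hp : Preadditive T H)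
    {x : E} (hx : x ∈ ringSet T H) : 1 - x ∈ ringSet T H := by
  rcases hx with rfl | hx | ⟨hx, hx'⟩
  · simpa using h.one_mem_ringSet
  · exact Or.inr (Or.inr ⟨h.sub hx.2.2, hp x hx⟩)
  · by_cases h0 : 1 - x = 0
    · simp [ringSet, h0]
    have hx0 := h.grpH.ne_zero hx
    by_cases hH : 1 - x ∈ H
    · right; right
      refine ⟨hH, fun y hy => ⟨mul_ne_zero h0 hy.1, h.mul_notMem hH hy.2.1, ?_⟩⟩
      have hu0 := h.grpT.ne_zero hy.2.2
      have h1 := h.small_div_one_sub hc hy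
      have h2 := hx' _ h1
      rw [show 1 - (1 - x) * y = (1 - y) * (1 - x * (-y / (1 - y))) by field_simp; ring]
      exact h.grpT.mul_mem hy.2.2 h2.2.2
    · by_contra hcon
      have hns : 1 - x ∉ smallSet T H := fun hs => hcon (Or.inr (Or.inl hs))
      have hr := h.inv_small_of_not h0 hH hns
      have hxr := hx' _ hr
      have h3 : 1 - (1 - x)⁻¹ = -(x * (1 - x)⁻¹) := by field_simp; ring
      have h4 := hr.2.2
      rw [h3] at h4
      exact h.neg_notMem hxr.2.1 (h.sub h4)

theorem add_mem_ringSet (h : RigidPair T H) (hc : Comparable T H) (hp : Preadditive T H)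
    {x y : E} (hx : x ∈ ringSet T H) (hy : y ∈ ringSet T H) : x + y ∈ ringSet T H := by
  by_cases hx0 : x = 0
  · simpa [hx0] using hy
  by_cases hy0 : y = 0
  · simpa [hy0] using hx
  rcases h.mem_or_inv_ringSet hc (y / x) with h1 | h1
  · have := h.mul_mem_ringSet hc hx
      (h.one_sub_mem_ringSet hc hp (h.neg_mem_ringSet hc h1))
    rwa [show x * (1 - -(y / x)) = x + y by field_simp; ring] at this
  · have := h.mul_mem_ringSet hc hy
      (h.one_sub_mem_ringSet hc hp (h.neg_mem_ringSet hc h1))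
    rwa [show y * (1 - -(y / x)⁻¹) = x + y by field_simp; ring] at this

/-- The valuation ring attached to a rigid pair. -/
def valRing (h : RigidPair T H) (hc : Comparable T H) (hp : Preadditive T H) :
    ValuationSubring E where
  carrier := ringSet T H
  mul_mem' := h.mul_mem_ringSet hc
  one_mem' := h.one_mem_ringSet
  add_mem' := h.add_mem_ringSet hc hp
  zero_mem' := Or.inl rfl
  neg_mem' := h.neg_mem_ringSet hc
  mem_or_inv_mem' := h.mem_or_inv_ringSet hc

theorem one_sub_mem_of_nonunit (h : RigidPair T H) (hc : Comparable T H) (hp : Preadditive T H)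
    {x : E} (hx : x ∈ ringSet T H) (hn : x⁻¹ ∉ ringSet T H) : 1 - x ∈ T := by
  rcases hx with rfl | hx | ⟨hx, hx'⟩
  · simpa using h.grpT.one_mem
  · exact hx.2.2
  · have hx0 := h.grpH.ne_zero hx
    obtain ⟨y, hy, hxy⟩ : ∃ y ∈ smallSet T H, x⁻¹ * y ∉ smallSet T H := by
      by_contra! hcon
      exact hn (Or.inr (Or.inr ⟨h.grpH.inv_mem hx, hcon⟩))
    have hy0 := hy.1
    have hr := h.inv_small_of_not (mul_ne_zero (inv_ne_zero hx0) hy0)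
      (h.mul_notMem (h.grpH.inv_mem hx) hy.2.1) hxy
    set r := (x⁻¹ * y)⁻¹ with hrdef
    have hry : x = r * y := by rw [hrdef]; field_simp
    rw [hry]
    by_cases ht : r * y ∈ T
    · have hu0 := h.grpT.ne_zero hr.2.2
      have h1 := hp y hy _ (h.small_div_one_sub hc hr)
      rw [show 1 - r * y = (1 - r) * (1 - (1 - y) * (-r / (1 - r))) by field_simp; ring]
      exact h.grpT.mul_mem hr.2.2 h1.2.2
    · exact h.one_sub_mul_mem hr hy ht

/-- The valuation ring attached to a rigid pair with comparability properties. -/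
theorem exists_valuationSubring (h : RigidPair T H) (hc : Comparable T H)
    (hp : Preadditive T H) : ∃ O : ValuationSubring E,
      (∀ x ∈ smallSet T H, x ∈ O ∧ x⁻¹ ∉ O) ∧ (∀ x, x ∈ O → x⁻¹ ∈ O → x ≠ 0 → x ∈ H) ∧
      (∀ x, x ∈ O → x⁻¹ ∉ O → 1 + x ∈ T) := by
  have hinv : ∀ x ∈ smallSet T H, x⁻¹ ∉ ringSet T H := by
    rintro x hx (h1 | h1 | h1)
    · exact hx.1 (inv_eq_zero.1 h1)
    · exact h.small_not_inv hx h1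
    · exact h.inv_notMem hx.2.1 h1.1
  refine ⟨h.valRing hc hp, fun x hx => ⟨Or.inr (Or.inl hx), hinv x hx⟩, ?_, ?_⟩
  · rintro x (h1 | h1 | h1) hi h0
    · exact absurd h1 h0
    · exact absurd hi (hinv x h1)
    · exact h1.1
  · intro x hx hn
    have := h.one_sub_mem_of_nonunit hc hp (h.neg_mem_ringSet hc hx) fun hm => hn (by
      have := h.neg_mem_ringSet hc hm
      rw [inv_neg, neg_neg] at this
      exact this)
    simpa using this

theorem comparable_of_notMem_pm (h : RigidPair T H) {a : E} (ha : a ∈ H)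
    (hT : ¬(a ∈ T ∨ -a ∈ T)) : (∀ x ∈ smallSet T H, a * x ∈ smallSet T H) ∨
    (∀ x ∈ smallSet T H, a⁻¹ * x ∈ smallSet T H) := by
  by_contra! hcon
  obtain ⟨⟨x, hx, hx'⟩, y, hy, hy'⟩ := hcon
  exact hT (h.incomparable ha hx hy hx' hy')

theorem one_sub_mem_of_incomparable (h : RigidPair T H) {a x y g : E} (ha : a ∈ H)
    (hx : x ∈ smallSet T H) (hy : y ∈ smallSet T H) (hax : a * x ∉ smallSet T H)
    (hay : a⁻¹ * y ∉ smallSet T H) (hg : g ∈ H) (hgT : ¬(g ∈ T ∨ -g ∈ T))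
    (hgS : ∀ x ∈ smallSet T H, g * x ∈ smallSet T H) : 1 - g ∈ T := by
  have haT : a ∈ {t | t ∈ T ∨ -t ∈ T} := h.incomparable ha hx hy hax hay
  have ha0 := h.grpH.ne_zero ha
  have hg0 := h.grpH.ne_zero hg
  have hx0 := hx.1
  have h2 : ∀ z ∈ smallSet T H, (a * g) * z ∈ smallSet T H := by
    refine (h.comparable_of_notMem_pm (h.grpH.mul_mem ha hg)
      fun hm => hgT (h.grpT.pm.of_mul_left haT hm)).resolve_right fun hcon => hay ?_
    have := hcon _ (hgS y hy)
    rwa [show (a * g)⁻¹ * (g * y) = a⁻¹ * y by field_simp] at this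
  have h3 := h.inv_small_of_not (mul_ne_zero ha0 hx0) (h.mul_notMem ha hx.2.1) hax
  have h4 := h2 _ h3
  rw [show a * g * (a * x)⁻¹ = x⁻¹ * g by field_simp] at h4
  have h5 := h.one_sub_mul_mem hx h4
  rw [mul_inv_cancel_left₀ hx0] at h5
  exact h5 fun hm => hgT (Or.inl hm)

theorem one_sub_inv_mem (h : RigidPair T H) {g : E} (hg : g ≠ 0) (hi : 1 - g⁻¹ ∈ T) :
    -g * (1 - g) ∈ T :=
  h.grpT.congr (w := 1) (z := g) hi hg (by field_simp; ring)

theorem inv_notMem_pm (h : RigidPair T H) {g : E} (hgT : ¬(g ∈ T ∨ -g ∈ T)) :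
    ¬(g⁻¹ ∈ T ∨ -g⁻¹ ∈ T) := fun hm => hgT (by
  have := h.grpT.pm.inv_mem (x := g⁻¹) hm
  rwa [inv_inv] at this)

theorem comparable_of_nonrigid (h : RigidPair T H) {g : E} (hg : g ∈ H)
    (hgT : ¬(g ∈ T ∨ -g ∈ T)) (h1 : 1 - g ∉ T) (h2 : -g * (1 - g) ∉ T) : Comparable T H := by
  intro a ha
  by_contra! hcon
  obtain ⟨⟨x, hx, hx'⟩, y, hy, hy'⟩ := hcon
  rcases h.comparable_of_notMem_pm hg hgT with h3 | h3
  · exact h1 (h.one_sub_mem_of_incomparable ha hx hy hx' hy' hg hgT h3)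
  · exact h2 (h.one_sub_inv_mem (h.grpH.ne_zero hg)
      (h.one_sub_mem_of_incomparable ha hx hy hx' hy' (h.grpH.inv_mem hg)
        (h.inv_notMem_pm hgT) h3))

theorem one_sub_div_mem (h : RigidPair T H) {x y z : E} (hx : x ∈ smallSet T H)
    (hy : y ∈ smallSet T H) (hn : (1 - x) * y ∉ smallSet T H) (hz : z ∈ smallSet T H)
    (hzx : -(x * z) ∉ T) (hzy : z / y ∉ T) : 1 - z / y ∈ T := by
  have hu0 := h.grpT.ne_zero hx.2.2
  have hy0 := hy.1
  have hc := h.inv_small_of_not (mul_ne_zero hu0 hy.1) (h.mul_notMem (h.sub hx.2.2) hy.2.1) hn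
  have hz' : (1 - x) * z ∈ smallSet T H := by
    by_contra hcon
    exact hzx (h.one_sub_mul_notMem hx hz hcon)
  have h1 := h.one_sub_mul_mem hc hz'
  rw [show ((1 - x) * y)⁻¹ * ((1 - x) * z) = z / y by field_simp] at h1
  exact h1 hzy

theorem preadditive_of_nonrigid (h : RigidPair T H) {g : E} (hg : g ∈ H)
    (hgT : ¬(g ∈ T ∨ -g ∈ T)) (h1 : 1 - g ∉ T) (h2 : -g * (1 - g) ∉ T) : Preadditive T H := by
  have hcomp := h.comparable_of_nonrigid hg hgT h1 h2
  intro x hx y hy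
  by_contra hn
  have hxy := h.one_sub_mul_notMem hx hy hn
  have hxy' : x * y ∈ T := by
    have := h.one_sub_mul_notMem hx (h.neg_small hcomp hy) fun hm => hn (by
      simpa using h.neg_small hcomp hm)
    simpa using this
  have key : ∀ g : E, g ∉ T → g * y ∈ smallSet T H → 1 - g ∈ T := by
    intro g hgT hgy
    have hy0 := hy.1
    have h3 := h.one_sub_div_mem hx hy hn hgy
    rw [show g * y / y = g by field_simp, show -(x * (g * y)) = -(x * y) * g by ring] at h3
    exact h3 (fun hm => hgT (h.grpT.of_mul_left hxy hm)) hgT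
  rcases h.comparable_of_notMem_pm hg hgT with h3 | h3
  · exact h1 (key g (fun hm => hgT (Or.inl hm)) (h3 y hy))
  · exact h2 (h.one_sub_inv_mem (h.grpH.ne_zero hg)
      (key g⁻¹ (fun hm => h.inv_notMem_pm hgT (Or.inl hm)) (h3 y hy)))

/-- The valuation ring attached to a rigid pair with a non-rigid element. -/
theorem exists_valuationSubring_of_nonrigid (h : RigidPair T H) {g : E} (hg : g ∈ H)
    (hgT : g ∉ T) (hgT' : -g ∉ T) (h1 : 1 + g ∉ T) (h2 : g * (1 + g) ∉ T) :
    ∃ O : ValuationSubring E,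
      (∀ x ∈ smallSet T H, x ∈ O ∧ x⁻¹ ∉ O) ∧ (∀ x, x ∈ O → x⁻¹ ∈ O → x ≠ 0 → x ∈ H) ∧
      (∀ x, x ∈ O → x⁻¹ ∉ O → 1 + x ∈ T) := by
  have a1 : -g ∈ H := by simpa using h.grpH.mul_mem h.neg_one_mem hg
  have a2 : ¬(-g ∈ T ∨ - -g ∈ T) := by simp [hgT, hgT']
  have a3 : 1 - -g ∉ T := by simpa using h1
  have a4 : - -g * (1 - -g) ∉ T := by simpa using h2
  exact h.exists_valuationSubring (h.comparable_of_nonrigid a1 a2 a3 a4)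
    (h.preadditive_of_nonrigid a1 a2 a3 a4)

/-- The exceptional elements obstructing comparability when all elements outside `±T` are
rigid. -/
def Exceptional (T H : Set E) (p : E) : Prop :=
  p ∈ smallSet T H ∧ ∀ z ∈ smallSet T H, z * p ∉ H → z / p ∈ smallSet T H

theorem Exceptional.mul_mem (h : RigidPair T H) {p q : E} (hp : Exceptional T H p)
    (hq : Exceptional T H q) : p * q ∈ H := by
  by_contra hn
  have h1 := hp.2 q hq.1 (by rwa [mul_comm])
  have h2 := hq.2 p hp.1 hn
  refine h.small_not_inv h1 ?_
  rwa [inv_div]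

theorem div_notMem (h : RigidPair T H) {z p : E} (hp : p ≠ 0) (hn : z * p ∉ H) :
    z / p ∉ H := fun hm => hn (h.grpH.congr (w := 1) (z := p) hm hp (by field_simp))

theorem div_small (h : RigidPair T H) {z p : E} (hz : z ∈ smallSet T H)
    (hp : p ∈ smallSet T H) (hn : z * p ∉ H) (h1 : 1 - z / p ∈ T) : z / p ∈ smallSet T H :=
  ⟨div_ne_zero hz.1 hp.1, h.div_notMem hp.1 hn, h1⟩

theorem exceptional_of_incomparable (h : RigidPair T {x | x ∈ T ∨ -x ∈ T}) {a x y : E}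
    (ha : a ∈ {x | x ∈ T ∨ -x ∈ T}) (hx : x ∈ smallSet T {x | x ∈ T ∨ -x ∈ T})
    (hy : y ∈ smallSet T {x | x ∈ T ∨ -x ∈ T})
    (hax : a * x ∉ smallSet T {x | x ∈ T ∨ -x ∈ T})
    (hay : a⁻¹ * y ∉ smallSet T {x | x ∈ T ∨ -x ∈ T}) :
    Exceptional T {x | x ∈ T ∨ -x ∈ T} x := by
  set H := {x | x ∈ T ∨ -x ∈ T}
  refine ⟨hx, fun z hz hzx => h.div_small hz hx hzx ?_⟩
  have ha0 := h.grpH.ne_zero ha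
  have hx0 := hx.1
  have hc := h.inv_small_of_not (mul_ne_zero ha0 hx.1) (h.mul_notMem ha hx.2.1) hax
  have haz : a * z ∈ smallSet T H := by
    by_contra hcon
    have h1 := h.incomparable_prod ha hz hy hcon hay
    have h2 := h.incomparable_prod ha hx hy hax hay
    exact hzx (h.grpH.congr (w := y) (z := 1) (h.grpH.mul_mem h1 h2) one_ne_zero (by ring))
  have h1 := h.one_sub_mul_mem hc haz
  rw [show (a * x)⁻¹ * (a * z) = z / x by field_simp] at h1
  exact h1 fun hm => h.div_notMem hx.1 hzx (h.sub hm)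

theorem exceptional_of_not_preadditive (h : RigidPair T {x | x ∈ T ∨ -x ∈ T}) {x y : E}
    (hx : x ∈ smallSet T {x | x ∈ T ∨ -x ∈ T}) (hy : y ∈ smallSet T {x | x ∈ T ∨ -x ∈ T})
    (hn : (1 - x) * y ∉ smallSet T {x | x ∈ T ∨ -x ∈ T}) :
    Exceptional T {x | x ∈ T ∨ -x ∈ T} y := by
  refine ⟨hy, fun z hz hzy => h.div_small hz hy hzy ?_⟩
  refine h.one_sub_div_mem hx hy hn hz (fun hm => ?_)
    (fun hm => h.div_notMem hy.1 hzy (h.sub hm))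
  have hxy := h.one_sub_mul_notMem hx hy hn
  exact hzy (h.grpH.congr (w := x) (z := 1) (h.sub (h.grpT.mul_mem hm hxy)) one_ne_zero
    (by ring))

theorem enlarge (h : RigidPair T H) {H' : Set E} (hH' : IsSqGroup H') (hsub : H ⊆ H') :
    RigidPair T H' where
  grpT := h.grpT
  grpH := hH'
  sub := h.sub.trans hsub
  neg_one_mem := hsub h.neg_one_mem
  rigid x h0 hx := h.rigid x h0 fun hm => hx (hsub hm)

/-- The valuation ring when all elements outside `±T` are rigid. -/
theorem exists_valuationSubring_of_rigid (h : RigidPair T {x | x ∈ T ∨ -x ∈ T}) :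
    ∃ p : E, p ≠ 0 ∧ ∃ O : ValuationSubring E,
      (∀ x, x ≠ 0 → ¬((x ∈ T ∨ -x ∈ T) ∨ (x * p ∈ T ∨ -(x * p) ∈ T)) →
        (x ∈ O ∧ x⁻¹ ∉ O) ∨ (x⁻¹ ∈ O ∧ x ∉ O)) ∧
      (∀ x, x ∈ O → x⁻¹ ∈ O → x ≠ 0 →
        ((x ∈ T ∨ -x ∈ T) ∨ (x * p ∈ T ∨ -(x * p) ∈ T))) ∧
      (∀ x, x ∈ O → x⁻¹ ∉ O → 1 + x ∈ T) := by
  set H := {x | x ∈ T ∨ -x ∈ T} with hH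
  obtain ⟨p, hp0, hp⟩ : ∃ p : E, p ≠ 0 ∧ ∀ q, Exceptional T H q → q * p ∈ H := by
    by_cases hex : ∃ p, Exceptional T H p
    · obtain ⟨p, hp⟩ := hex
      exact ⟨p, hp.1.1, fun q hq => hq.mul_mem h hp⟩
    · exact ⟨1, one_ne_zero, fun q hq => absurd ⟨q, hq⟩ hex⟩
  set H' := {x | x ∈ H ∨ x * p ∈ H} with hH'
  have hsub : H ⊆ H' := fun x hx => Or.inl hx
  have h' : RigidPair T H' := h.enlarge (h.grpH.adjoin p) hsub
  have hs : ∀ x ∈ smallSet T H', x ∈ smallSet T H :=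
    fun x hx => ⟨hx.1, fun hm => hx.2.1 (hsub hm), hx.2.2⟩
  have hs' : ∀ x, x ∉ H' → x ∈ smallSet T H → x ∈ smallSet T H' :=
    fun x hx hm => ⟨hm.1, hx, hm.2.2⟩
  have hcomp : Comparable T H' := by
    intro a ha
    by_contra! hcon
    obtain ⟨⟨x, hx, hx'⟩, y, hy, hy'⟩ := hcon
    have haT := h'.incomparable ha hx hy hx' hy'
    have := exceptional_of_incomparable h haT (hs x hx) (hs y hy)
      (fun hm => hx' (hs' _ (h'.mul_notMem ha hx.2.1) hm))
      (fun hm => hy' (hs' _ (h'.mul_notMem (h'.grpH.inv_mem ha) hy.2.1) hm))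
    exact hx.2.1 (Or.inr (hp x this))
  have hpre : Preadditive T H' := by
    intro x hx y hy
    by_contra hcon
    have := exceptional_of_not_preadditive h (hs x hx) (hs y hy)
      (fun hm => hcon (hs' _ (h'.mul_notMem (h'.sub hx.2.2) hy.2.1) hm))
    exact hy.2.1 (Or.inr (hp y this))
  obtain ⟨O, h1, h2, h3⟩ := h'.exists_valuationSubring hcomp hpre
  refine ⟨p, hp0, O, fun x hx hxH => ?_, h2, h3⟩
  rcases h'.small_or_inv hx hxH with h4 | h4
  · exact Or.inl (h1 x h4)
  · right
    simpa using h1 _ h4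

/-- A rigid pair with `H` proper defines a nontrivial valuation, unless `T` is very large. -/
theorem exists_valuationSubring_or (h : RigidPair T H) {x₀ : E} (hx₀ : x₀ ≠ 0)
    (hx₀H : x₀ ∉ H) : (∃ O : ValuationSubring E, O ≠ ⊤ ∧ ∀ x, x ∈ O → x⁻¹ ∉ O → 1 + x ∈ T) ∨
      ∃ p : E, p ≠ 0 ∧ ∀ x, x ≠ 0 → ((x ∈ T ∨ -x ∈ T) ∨ (x * p ∈ T ∨ -(x * p) ∈ T)) := by
  by_cases hnr : ∃ g ∈ H, g ∉ T ∧ -g ∉ T ∧ 1 + g ∉ T ∧ g * (1 + g) ∉ T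
  · obtain ⟨g, hg, g1, g2, g3, g4⟩ := hnr
    obtain ⟨O, -, h2, h3⟩ := h.exists_valuationSubring_of_nonrigid hg g1 g2 g3 g4
    refine Or.inl ⟨O, ?_, h3⟩
    rintro rfl
    exact hx₀H (h2 x₀ trivial trivial hx₀)
  · push Not at hnr
    have h' : RigidPair T {x | x ∈ T ∨ -x ∈ T} := by
      refine ⟨h.grpT, h.grpT.pm, fun x hx => Or.inl hx, Or.inr (by simpa using h.grpT.one_mem),
        fun x hx0 hx => ?_⟩
      by_cases hxH : x ∈ H
      · by_contra hcon
        rw [not_or] at hcon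
        exact hcon.2 (hnr x hxH (fun hm => hx (Or.inl hm)) (fun hm => hx (Or.inr hm)) hcon.1)
      · exact h.rigid x hx0 hxH
    obtain ⟨p, hp, O, -, h2, h3⟩ := h'.exists_valuationSubring_of_rigid
    by_cases hO : O = ⊤
    · subst hO
      exact Or.inr ⟨p, hp, fun x hx => h2 x trivial trivial hx⟩
    · exact Or.inl ⟨O, hO, h3⟩

end RigidPair

section Valuations

variable {E Γ : Type*} [Field E] [LinearOrderedCommGroupWithZero Γ]

/-- Products of units and nonzero squares. -/
def evenSet (v : Valuation E Γ) : Set E := {x | ∃ u g : E, g ≠ 0 ∧ v u = 1 ∧ x = u * g ^ 2}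

/-- Products of one-units and nonzero squares. -/
def oneSq (v : Valuation E Γ) : Set E :=
  {x | ∃ m g : E, g ≠ 0 ∧ v m < 1 ∧ x = (1 + m) * g ^ 2}

theorem map_one_add_of_lt_one (v : Valuation E Γ) {m : E} (hm : v m < 1) : v (1 + m) = 1 := by
  rw [Valuation.map_one_add_of_lt v hm]

theorem ne_zero_of_map_eq_one (v : Valuation E Γ) {u : E} (hu : v u = 1) : u ≠ 0 := by
  rintro rfl
  simp at hu

theorem isSqGroup_evenSet (v : Valuation E Γ) : IsSqGroup (evenSet v) where
  zero_notMem := by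
    rintro ⟨u, g, hg, hu, h⟩
    exact mul_ne_zero (ne_zero_of_map_eq_one v hu) (pow_ne_zero 2 hg) h.symm
  sq_mem x hx := ⟨1, x, hx, map_one v, by ring⟩
  mul_mem := by
    rintro _ _ ⟨u, g, hg, hu, rfl⟩ ⟨u', g', hg', hu', rfl⟩
    exact ⟨u * u', g * g', mul_ne_zero hg hg', by rw [map_mul, hu, hu', one_mul], by ring⟩

theorem isSqGroup_oneSq (v : Valuation E Γ) : IsSqGroup (oneSq v) where
  zero_notMem := by
    rintro ⟨m, g, hg, hm, h⟩
    exact mul_ne_zero (ne_zero_of_map_eq_one v (map_one_add_of_lt_one v hm))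
      (pow_ne_zero 2 hg) h.symm
  sq_mem x hx := ⟨0, x, hx, by simp, by ring⟩
  mul_mem := by
    rintro _ _ ⟨m, g, hg, hm, rfl⟩ ⟨n, g', hg', hn, rfl⟩
    refine ⟨m + n + m * n, g * g', mul_ne_zero hg hg', ?_, by ring⟩
    refine v.map_add_lt (v.map_add_lt hm hn) ?_
    rw [map_mul]
    exact mul_lt_one_of_lt_of_le hm hn.le

theorem oneSq_subset {v : Valuation E Γ} {T : Set E} (hT : IsSqGroup T)
    (h : ∀ x, v x < 1 → 1 + x ∈ T) : oneSq v ⊆ T := by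
  rintro _ ⟨m, g, hg, hm, rfl⟩
  exact hT.mul_sq_mem (h m hm) hg

theorem evenSet_subset {v : Valuation E Γ} {H : Set E} (hH : IsSqGroup H)
    (h : ∀ x, v x = 1 → x ∈ H) : evenSet v ⊆ H := by
  rintro _ ⟨m, g, hg, hm, rfl⟩
  exact hH.mul_sq_mem (h m hm) hg

theorem mem_evenSet_of_map_eq_one (v : Valuation E Γ) {u : E} (hu : v u = 1) : u ∈ evenSet v :=
  ⟨u, 1, one_ne_zero, hu, by ring⟩

theorem one_add_mem_oneSq (v : Valuation E Γ) {m : E} (hm : v m < 1) : 1 + m ∈ oneSq v :=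
  ⟨m, 1, one_ne_zero, hm, by ring⟩

/-- Elements outside the even elements are rigid. -/
theorem rigidPair_oneSq_evenSet (v : Valuation E Γ) : RigidPair (oneSq v) (evenSet v) where
  grpT := isSqGroup_oneSq v
  grpH := isSqGroup_evenSet v
  sub := oneSq_subset (isSqGroup_evenSet v) fun _ hx =>
    mem_evenSet_of_map_eq_one v (map_one_add_of_lt_one v hx)
  neg_one_mem := mem_evenSet_of_map_eq_one v (by simp)
  rigid x h0 hx := by
    rcases lt_trichotomy (v x) 1 with h | h | h
    · exact Or.inl (one_add_mem_oneSq v h)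
    · exact absurd (mem_evenSet_of_map_eq_one v h) hx
    · right
      refine ⟨x⁻¹, x, h0, ?_, by field_simp; ring⟩
      rw [map_inv₀]
      exact inv_lt_one_of_one_lt₀ h

end Valuations

namespace ValuationSubring

variable {E : Type*} [Field E]

theorem valuation_lt_one_iff_mem_inv_notMem (O : ValuationSubring E) {x : E} (hx : x ≠ 0) :
    O.valuation x < 1 ↔ x ∈ O ∧ x⁻¹ ∉ O := by
  have hv : 0 < O.valuation x := (Valuation.pos_iff _).2 hx
  rw [← O.valuation_le_one_iff, ← O.valuation_le_one_iff, map_inv₀, inv_le_one₀ hv, not_le]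
  exact ⟨fun h => ⟨h.le, h⟩, fun h => h.2⟩

theorem valuation_eq_one_iff_mem_inv_mem (O : ValuationSubring E) {x : E} (hx : x ≠ 0) :
    O.valuation x = 1 ↔ x ∈ O ∧ x⁻¹ ∈ O := by
  have hv : 0 < O.valuation x := (Valuation.pos_iff _).2 hx
  rw [← O.valuation_le_one_iff, ← O.valuation_le_one_iff, map_inv₀, inv_le_one₀ hv]
  exact ⟨fun h => ⟨h.le, h.ge⟩, fun h => le_antisymm h.1 h.2⟩

open IsDedekindDomain

/-- A nontrivial valuation ring containing a Dedekind domain is given by a prime ideal. -/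
theorem exists_heightOneSpectrum (A : Type*) [CommRing A] [IsDedekindDomain A] [Algebra A E]
    [IsFractionRing A E] (O : ValuationSubring E) (hO : O ≠ ⊤)
    (hA : ∀ a : A, algebraMap A E a ∈ O) :
    ∃ P : HeightOneSpectrum A, (P.valuation E).valuationSubring = O := by
  let f : A →+* O := (algebraMap A E).codRestrict O.toSubring hA
  have hf : ∀ a, ((f a : O) : E) = algebraMap A E a := fun a => rfl
  let I : Ideal A := (IsLocalRing.maximalIdeal O).comap f
  have hprime : I.IsPrime := Ideal.IsPrime.comap f
  have hunit : ∀ a : A, a ∉ I → (algebraMap A E a)⁻¹ ∈ O := by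
    intro a ha
    have h1 : IsUnit (f a) := by
      by_contra hcon
      exact ha ((IsLocalRing.mem_maximalIdeal _).2 hcon)
    obtain ⟨w, hw⟩ := h1.exists_right_inv
    have h2 : algebraMap A E a * (w : E) = 1 := by
      rw [← hf]
      exact congrArg Subtype.val hw
    rw [inv_eq_of_mul_eq_one_right h2]
    exact w.2
  have hfrac : ∀ a b : A, b ∉ I → algebraMap A E a / algebraMap A E b ∈ O := by
    intro a b hb
    rw [div_eq_mul_inv]
    exact O.mul_mem _ _ (hA a) (hunit b hb)
  have hbot : I ≠ ⊥ := by
    intro hI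
    apply hO
    ext x
    simp only [mem_top, iff_true]
    obtain ⟨a, b, hb, rfl⟩ := IsFractionRing.div_surjective (A := A) x
    refine hfrac a b ?_
    rw [hI]
    simpa using nonZeroDivisors.ne_zero hb
  refine ⟨⟨I, hprime, hbot⟩, ?_⟩
  rw [← HeightOneSpectrum.valuationSubringAtPrime_eq_valuationSubring]
  refine eq_of_le_of_ne_top _ (fun x hx => ?_) hO
  obtain ⟨a, s, hs, rfl⟩ := hx
  have := hfrac a s hs
  rwa [div_eq_mul_inv] at this

end ValuationSubring

namespace IsDedekindDomain.HeightOneSpectrum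

variable {A E : Type*} [CommRing A] [IsDedekindDomain A] [Field E] [Algebra A E]
  [IsFractionRing A E]

theorem valuation_lt_one_iff_of_eq (P : HeightOneSpectrum A) {O : ValuationSubring E}
    (h : (P.valuation E).valuationSubring = O) (x : E) :
    O.valuation x < 1 ↔ P.valuation E x < 1 := by
  subst h
  exact ((Valuation.isEquiv_valuation_valuationSubring (P.valuation E)).lt_one_iff_lt_one).symm

theorem valuation_eq_one_iff_of_eq (P : HeightOneSpectrum A) {O : ValuationSubring E}
    (h : (P.valuation E).valuationSubring = O) (x : E) :
    O.valuation x = 1 ↔ P.valuation E x = 1 := by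
  subst h
  exact ((Valuation.isEquiv_valuation_valuationSubring (P.valuation E)).eq_one_iff_eq_one).symm

/-- A nonzero element has even valuation or becomes a unit times a uniformizer. -/
theorem exists_uniformizer_evenSet (P : HeightOneSpectrum A) :
    ∃ t : E, P.valuation E t = WithZero.exp (-1 : ℤ) ∧ t ∉ evenSet (P.valuation E) ∧
      ∀ x : E, x ≠ 0 → x ∈ evenSet (P.valuation E) ∨ x * t ∈ evenSet (P.valuation E) := by
  obtain ⟨t, ht⟩ := P.valuation_exists_uniformizer E
  have ht0 : t ≠ 0 := by
    rintro rfl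
    rw [map_zero] at ht
    exact WithZero.exp_ne_zero ht.symm
  have htn : ∀ n : ℤ, P.valuation E (t ^ n) = WithZero.exp (-n) := by
    intro n
    rw [map_zpow₀, ht, ← WithZero.exp_zsmul]
    simp
  have hex : ∀ x : E, x ≠ 0 → ∃ n : ℤ, P.valuation E x = WithZero.exp n := by
    intro x hx
    have h0 : P.valuation E x ≠ 0 := (Valuation.ne_zero_iff _).2 hx
    exact ⟨_, (WithZero.exp_log h0).symm⟩
  have heven : ∀ x : E, x ≠ 0 → ∀ n : ℤ, P.valuation E x = WithZero.exp (2 * n) →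
      x ∈ evenSet (P.valuation E) := by
    intro x hx n hn
    refine ⟨x * (t ^ n) ^ 2, t ^ (-n), zpow_ne_zero _ ht0, ?_, ?_⟩
    · rw [map_mul, map_pow, htn, hn, ← WithZero.exp_nsmul, ← WithZero.exp_add]
      simp [two_mul]
    · rw [zpow_neg]
      have := zpow_ne_zero n ht0
      field_simp
  refine ⟨t, ht, ?_, fun x hx => ?_⟩
  · rintro ⟨u, g, hg, hu, h⟩
    obtain ⟨n, hn⟩ := hex g hg
    rw [h, map_mul, hu, map_pow, hn, one_mul, ← WithZero.exp_nsmul] at ht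
    have := WithZero.exp_injective ht
    simp at this
    omega
  · obtain ⟨n, hn⟩ := hex x hx
    rcases Int.even_or_odd' n with ⟨k, rfl | rfl⟩
    · exact Or.inl (heven x hx k hn)
    · refine Or.inr (heven _ (mul_ne_zero hx ht0) k ?_)
      rw [map_mul, hn, ht, ← WithZero.exp_add]
      congr 1
      ring

/-- An even element is, modulo squares, an integral element outside the prime. -/
theorem exists_integral_of_mem_evenSet (P : HeightOneSpectrum A) {x : E}
    (hx : x ∈ evenSet (P.valuation E)) :
    ∃ b : A, b ∉ P.asIdeal ∧ ∃ g : E, g ≠ 0 ∧ x = algebraMap A E b * g ^ 2 := by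
  obtain ⟨u, g, hg, hu, rfl⟩ := hx
  obtain ⟨n, d, h⟩ := P.exists_primeCompl_mul_eq_of_integer u hu.le
  have hd : P.valuation E (algebraMap A E d) = 1 := by
    rw [valuation_eq_one_iff_notMem]
    exact d.2
  have hd0 := ne_zero_of_map_eq_one _ hd
  have hn : n ∉ P.asIdeal := by
    rw [← P.valuation_eq_one_iff_notMem (K := E), ← h, map_mul, hu, hd, one_mul]
  refine ⟨n * d, fun hm => ?_, g / algebraMap A E d, div_ne_zero hg hd0, ?_⟩
  · rcases P.isPrime.mem_or_mem hm with h1 | h1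
    · exact hn h1
    · exact d.2 h1
  · rw [map_mul, ← h]
    field_simp

theorem mem_oneSq_of_sub_mem (P : HeightOneSpectrum A) {b c : A} (hb : b ∉ P.asIdeal)
    (h : b - c ^ 2 ∈ P.asIdeal) : algebraMap A E b ∈ oneSq (P.valuation E) := by
  have hc : c ∉ P.asIdeal := by
    intro hc
    apply hb
    have := P.asIdeal.add_mem h (P.asIdeal.mul_mem_left c hc)
    rwa [show b - c ^ 2 + c * c = b by ring] at this
  have hvc : P.valuation E (algebraMap A E c) = 1 := (P.valuation_eq_one_iff_notMem).2 hc
  have hc0 := ne_zero_of_map_eq_one _ hvc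
  refine ⟨algebraMap A E (b - c ^ 2) / algebraMap A E c ^ 2, algebraMap A E c, hc0, ?_, ?_⟩
  · rw [map_div₀, map_pow, hvc]
    simpa using (P.valuation_lt_one_iff_mem (K := E) _).2 h
  · simp only [map_sub, map_pow]
    field_simp
    ring

variable [∀ P : HeightOneSpectrum A, Finite (A ⧸ P.asIdeal)]

theorem exists_oneSq_coset (P : HeightOneSpectrum A) :
    ∃ u : E, u ≠ 0 ∧ ∀ x ∈ evenSet (P.valuation E),
      x ∈ oneSq (P.valuation E) ∨ x * u ∈ oneSq (P.valuation E) := by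
  classical
  have hmax : P.asIdeal.IsMaximal := P.isMaximal
  let : Field (A ⧸ P.asIdeal) := Ideal.Quotient.field _
  have hG := isSqGroup_oneSq (P.valuation E)
  have key : ∀ b : A, b ∉ P.asIdeal → IsSquare (Ideal.Quotient.mk P.asIdeal b) →
      algebraMap A E b ∈ oneSq (P.valuation E) := by
    rintro b hb ⟨r, hr⟩
    obtain ⟨c, rfl⟩ := Ideal.Quotient.mk_surjective r
    refine P.mem_oneSq_of_sub_mem (c := c) hb ?_
    rw [← Ideal.Quotient.eq_zero_iff_mem, map_sub, map_pow, hr]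
    ring
  by_cases hsq : ∀ z : A ⧸ P.asIdeal, IsSquare z
  · refine ⟨1, one_ne_zero, fun x hx => Or.inl ?_⟩
    obtain ⟨b, hb, g, hg, rfl⟩ := P.exists_integral_of_mem_evenSet hx
    exact hG.mul_sq_mem (key b hb (hsq _)) hg
  · push Not at hsq
    obtain ⟨z, hz⟩ := hsq
    obtain ⟨c, rfl⟩ := Ideal.Quotient.mk_surjective z
    have hc0 : Ideal.Quotient.mk P.asIdeal c ≠ 0 := by
      rintro h
      rw [h] at hz
      exact hz ⟨0, by simp⟩
    have hc : c ∉ P.asIdeal := fun hm => hc0 (Ideal.Quotient.eq_zero_iff_mem.2 hm)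
    have hvc : P.valuation E (algebraMap A E c) = 1 := (P.valuation_eq_one_iff_notMem).2 hc
    refine ⟨algebraMap A E c, ne_zero_of_map_eq_one _ hvc, fun x hx => ?_⟩
    obtain ⟨b, hb, g, hg, rfl⟩ := P.exists_integral_of_mem_evenSet hx
    have hb0 : Ideal.Quotient.mk P.asIdeal b ≠ 0 :=
      fun hm => hb (Ideal.Quotient.eq_zero_iff_mem.1 hm)
    by_cases hbs : IsSquare (Ideal.Quotient.mk P.asIdeal b)
    · exact Or.inl (hG.mul_sq_mem (key b hb hbs) hg)
    · right
      have hbc : b * c ∉ P.asIdeal := fun hm => (P.isPrime.mem_or_mem hm).elim hb hc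
      have h2 : IsSquare (Ideal.Quotient.mk P.asIdeal (b * c)) := by
        let : Fintype (A ⧸ P.asIdeal) := Fintype.ofFinite _
        have hb1 := quadraticChar_neg_one_iff_not_isSquare.2 hbs
        have hc1 := quadraticChar_neg_one_iff_not_isSquare.2 hz
        rw [map_mul, ← quadraticChar_one_iff_isSquare (mul_ne_zero hb0 hc0), map_mul, hb1, hc1]
        norm_num
      have := hG.mul_sq_mem (key _ hbc h2) hg
      rw [map_mul] at this
      convert this using 1
      ring

theorem evenSet_subset_oneSq (P : HeightOneSpectrum A) (h2 : (2 : A) ∈ P.asIdeal) :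
    evenSet (P.valuation E) ⊆ oneSq (P.valuation E) := by
  have hmax : P.asIdeal.IsMaximal := P.isMaximal
  let : Field (A ⧸ P.asIdeal) := Ideal.Quotient.field _
  intro x hx
  obtain ⟨b, hb, g, hg, rfl⟩ := P.exists_integral_of_mem_evenSet hx
  refine (isSqGroup_oneSq _).mul_sq_mem ?_ hg
  have h2' : (2 : A ⧸ P.asIdeal) = 0 := by
    rw [← map_ofNat (Ideal.Quotient.mk P.asIdeal) 2]
    exact Ideal.Quotient.eq_zero_iff_mem.2 h2
  have hchar : ringChar (A ⧸ P.asIdeal) = 2 := by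
    have : CharP (A ⧸ P.asIdeal) 2 := CharTwo.of_one_ne_zero_of_two_eq_zero one_ne_zero h2'
    exact ringChar.eq (A ⧸ P.asIdeal) 2
  obtain ⟨r, hr⟩ := FiniteField.isSquare_of_char_two hchar (Ideal.Quotient.mk P.asIdeal b)
  obtain ⟨c, rfl⟩ := Ideal.Quotient.mk_surjective r
  refine P.mem_oneSq_of_sub_mem (c := c) hb ?_
  rw [← Ideal.Quotient.eq_zero_iff_mem, map_sub, map_pow, hr]
  ring

end IsDedekindDomain.HeightOneSpectrum

/-- `T` has at most four cosets. -/
def AtMostFourCosets {E : Type*} [Field E] (T : Set E) : Prop :=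
  ∃ z : Fin 4 → E, (∀ i, z i ≠ 0) ∧ ∀ x, x ≠ 0 → ∃ i, x * z i ∈ T

theorem AtMostFourCosets.mk {E : Type*} [Field E] {T : Set E} {p q : E} (hp : p ≠ 0)
    (hq : q ≠ 0) (h : ∀ x, x ≠ 0 → (x ∈ T ∨ x * p ∈ T) ∨ (x * q ∈ T ∨ x * q * p ∈ T)) :
    AtMostFourCosets T := by
  refine ⟨![1, p, q, q * p], fun i => ?_, fun x hx => ?_⟩
  · fin_cases i <;> simp [hp, hq]
  · rcases h x hx with (h | h) | (h | h)
    · exact ⟨0, by simpa using h⟩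
    · exact ⟨1, by simpa using h⟩
    · exact ⟨2, by simpa using h⟩
    · exact ⟨3, by simpa [mul_assoc] using h⟩

section NumberField

open NumberField IsDedekindDomain

variable {F : Type*} [Field F]

instance finite_quotient_asIdeal [NumberField F] (P : HeightOneSpectrum (𝓞 F)) :
    Finite (𝓞 F ⧸ P.asIdeal) :=
  Ring.HasFiniteQuotients.finiteQuotient P.ne_bot

theorem ringOfIntegers_mem_valuationSubring (O : ValuationSubring F) (a : 𝓞 F) :
    algebraMap (𝓞 F) F a ∈ O := by
  have h1 : IsIntegral ℤ (algebraMap (𝓞 F) F a) := a.2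
  have h2 : IsIntegral O (algebraMap (𝓞 F) F a) := h1.tower_top
  obtain ⟨y, hy⟩ := IsIntegrallyClosed.isIntegral_iff.1 h2
  rw [← hy]
  exact y.2

/-- A subgroup of a number field containing all one-units of a nontrivial valuation has at most
four cosets. -/
theorem atMostFourCosets_of_valuationSubring [NumberField F] {T : Set F} (hT : IsSqGroup T)
    {O : ValuationSubring F} (hO : O ≠ ⊤) (h : ∀ x, O.valuation x < 1 → 1 + x ∈ T) :
    AtMostFourCosets T := by
  obtain ⟨P, hP⟩ := O.exists_heightOneSpectrum (𝓞 F) hO (ringOfIntegers_mem_valuationSubring O)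
  have hsub : oneSq (P.valuation F) ⊆ T := oneSq_subset hT fun x hx =>
    h x ((P.valuation_lt_one_iff_of_eq hP x).2 hx)
  obtain ⟨t, ht, htn, h1⟩ := P.exists_uniformizer_evenSet (E := F)
  obtain ⟨u, hu, h2⟩ := P.exists_oneSq_coset (E := F)
  have ht0 : t ≠ 0 := by
    rintro rfl
    rw [map_zero] at ht
    exact WithZero.exp_ne_zero ht.symm
  refine .mk hu ht0 fun x hx => ?_
  rcases h1 x hx with h3 | h3
  · exact Or.inl ((h2 x h3).imp (fun h => hsub h) fun h => hsub h)
  · exact Or.inr ((h2 _ h3).imp (fun h => hsub h) fun h => hsub h)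

end NumberField

theorem one_add_mem_of_valuation_lt_one {E : Type*} [Field E] {T : Set E} (hT : IsSqGroup T)
    {O : ValuationSubring E} (h : ∀ x, x ∈ O → x⁻¹ ∉ O → 1 + x ∈ T) (x : E)
    (hx : O.valuation x < 1) : 1 + x ∈ T := by
  by_cases h0 : x = 0
  · simpa [h0] using hT.one_mem
  · obtain ⟨h1, h2⟩ := (O.valuation_lt_one_iff_mem_inv_notMem h0).1 hx
    exact h x h1 h2

theorem RigidPair.atMostFourCosets {F : Type*} [Field F] [NumberField F] {T H : Set F}
    (h : RigidPair T H) {x₀ : F} (hx₀ : x₀ ≠ 0) (hx₀H : x₀ ∉ H) : AtMostFourCosets T := by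
  rcases h.exists_valuationSubring_or hx₀ hx₀H with ⟨O, hO, h1⟩ | ⟨p, hp, h1⟩
  · exact atMostFourCosets_of_valuationSubring h.grpT hO
      (one_add_mem_of_valuation_lt_one h.grpT h1)
  · refine .mk (p := -1) (by simp) hp fun x hx => ?_
    simpa using h1 x hx

open scoped Polynomial

/-- `x, y` are coordinates of the conic `a x² + b y² = 1` generating `K` over `k`. -/
structure ConicGen {k K : Type*} [Field k] [Field K] (ι : k →+* K) (a b : k) (x y : K) :
    Prop where
  eq : ι a * x ^ 2 + ι b * y ^ 2 = 1
  transc : ∀ p : k[X], p.eval₂ ι x = 0 → p = 0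
  gen : ∀ z : K, ∃ p q r : k[X], r ≠ 0 ∧ z * r.eval₂ ι x = p.eval₂ ι x + q.eval₂ ι x * y

theorem Polynomial.eq_zero_of_forall_aeval_eq_zero {k F : Type*} [Field k] [Field F]
    [Infinite F] [Algebra k F] {p : k[X]} (h : ∀ x : F, Polynomial.aeval x p = 0) : p = 0 := by
  have h4 : p.map (algebraMap k F) = 0 := Polynomial.funext fun x => by
    simpa [Polynomial.eval_map_algebraMap] using h x
  exact (Polynomial.map_eq_zero _).1 h4

section ConicRing

variable {k : Type*} [Field k] {a b : k}

theorem conicPoly_zero_on {F : Type*} [Field F] [IsAlgClosed F] [Algebra k F] (hb : b ≠ 0)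
    (x : F) : ∃ y : F, MvPolynomial.aeval ![x, y] (conicPoly k a b) = 0 := by
  have hb' : algebraMap k F b ≠ 0 := by simpa using hb
  obtain ⟨y, hy⟩ := IsAlgClosed.exists_pow_nat_eq
    ((1 - algebraMap k F a * x ^ 2) / algebraMap k F b) (n := 2) (by norm_num)
  refine ⟨y, ?_⟩
  have : algebraMap k F b * y ^ 2 = 1 - algebraMap k F a * x ^ 2 := by
    rw [hy]
    field_simp
  simp [conicPoly, this]

theorem conicRing_eq_zero_of_aeval (hb : b ≠ 0) (p : k[X])
    (h : Polynomial.aeval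
      (Ideal.Quotient.mk (Ideal.span {conicPoly k a b}) (MvPolynomial.X 0)) p = 0) :
    p = 0 := by
  have h1 : Polynomial.aeval (MvPolynomial.X 0 : MvPolynomial (Fin 2) k) p ∈
      Ideal.span {conicPoly k a b} := by
    rw [← Ideal.Quotient.eq_zero_iff_mem, ← h]
    exact (Polynomial.aeval_algHom_apply
      (Ideal.Quotient.mkₐ k (Ideal.span {conicPoly k a b})) _ p).symm
  obtain ⟨q, hq⟩ := Ideal.mem_span_singleton.1 h1
  have : Infinite (AlgebraicClosure k) := IsAlgClosed.instInfinite
  refine Polynomial.eq_zero_of_forall_aeval_eq_zero (F := AlgebraicClosure k) fun x => ?_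
  obtain ⟨y, h3⟩ := conicPoly_zero_on (F := AlgebraicClosure k) (a := a) hb x
  have h2 := congrArg (MvPolynomial.aeval ![x, y]) hq
  rw [map_mul, h3, zero_mul, ← Polynomial.aeval_algHom_apply] at h2
  simpa using h2

theorem conicRing_rel : algebraMap k (ConicRing k a b) a *
      (Ideal.Quotient.mk _ (MvPolynomial.X 0) : ConicRing k a b) ^ 2 +
    algebraMap k (ConicRing k a b) b *
      (Ideal.Quotient.mk _ (MvPolynomial.X 1) : ConicRing k a b) ^ 2 = 1 := by
  have h1 : Ideal.Quotient.mk (Ideal.span {conicPoly k a b}) (conicPoly k a b) = 0 :=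
    Ideal.Quotient.eq_zero_iff_mem.2 (Ideal.mem_span_singleton_self _)
  rw [conicPoly, map_sub, sub_eq_zero, map_add, map_mul, map_mul, map_pow, map_pow,
    map_one] at h1
  exact h1

theorem conicRing_normal_form (hb : b ≠ 0) (z : ConicRing k a b) : ∃ p q : k[X],
    z = Polynomial.aeval (Ideal.Quotient.mk _ (MvPolynomial.X 0)) p +
      Polynomial.aeval (Ideal.Quotient.mk _ (MvPolynomial.X 0)) q *
        Ideal.Quotient.mk _ (MvPolynomial.X 1) := by
  obtain ⟨f, rfl⟩ := Ideal.Quotient.mk_surjective z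
  have hrel := conicRing_rel (a := a) (b := b)
  set x := Ideal.Quotient.mk (Ideal.span {conicPoly k a b}) (MvPolynomial.X 0) with hx
  set y := Ideal.Quotient.mk (Ideal.span {conicPoly k a b}) (MvPolynomial.X 1) with hy
  have hy2 : y ^ 2 = Polynomial.aeval x
      (Polynomial.C b⁻¹ * (1 - Polynomial.C a * Polynomial.X ^ 2)) := by
    have h2 : algebraMap k (ConicRing k a b) b⁻¹ * algebraMap k (ConicRing k a b) b = 1 := by
      rw [← map_mul, inv_mul_cancel₀ hb, map_one]
    simp only [map_mul, map_sub, map_one, map_pow, Polynomial.aeval_X, Polynomial.aeval_C]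
    linear_combination (algebraMap k (ConicRing k a b) b⁻¹) * hrel - y ^ 2 * h2
  induction f using MvPolynomial.induction_on with
  | C r => exact ⟨Polynomial.C r, 0, by simp; rfl⟩
  | add f g hf hg =>
    obtain ⟨p, q, h⟩ := hf
    obtain ⟨p', q', h'⟩ := hg
    exact ⟨p + p', q + q', by rw [map_add, h, h']; simp only [map_add]; ring⟩
  | mul_X f i hf =>
    obtain ⟨p, q, h⟩ := hf
    fin_cases i
    · refine ⟨p * Polynomial.X, q * Polynomial.X, ?_⟩
      rw [map_mul, h]
      simp only [map_mul, Polynomial.aeval_X, Fin.zero_eta, ← hx]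
      ring
    · refine ⟨q * (Polynomial.C b⁻¹ * (1 - Polynomial.C a * Polynomial.X ^ 2)), p, ?_⟩
      rw [map_mul, h, map_mul, ← hy2]
      simp only [Fin.mk_one, ← hy]
      ring

end ConicRing

section Norm

variable {k E : Type*} [Field k] [Field E] {a b : k}

theorem conic_norm_eq {φ : k →+* E} {x y : E}
    (h : φ a * x ^ 2 + φ b * y ^ 2 = 1) (ht : ∀ p : k[X], p.eval₂ φ x = 0 → p = 0)
    {p q : k[X]} (hpq : p.eval₂ φ x + q.eval₂ φ x * y = 0) :
    Polynomial.C b * p ^ 2 = q ^ 2 * (1 - Polynomial.C a * Polynomial.X ^ 2) := by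
  rw [← sub_eq_zero]
  apply ht
  simp only [Polynomial.eval₂_sub, Polynomial.eval₂_mul, Polynomial.eval₂_pow,
    Polynomial.eval₂_C, Polynomial.eval₂_one, Polynomial.eval₂_X]
  linear_combination φ b * (p.eval₂ φ x - q.eval₂ φ x * y) * hpq
    + (q.eval₂ φ x) ^ 2 * h

end Norm

section Function

variable {k K : Type*} [Field k] [Field K] {a b : k} {ι : k →+* K}

theorem exists_conicGen (hb : b ≠ 0) (hK : IsConicFunctionField k a b K ι) :
    ∃ x y : K, ConicGen ι a b x y ∧
      ∀ {E : Type*} [Field E] [CharZero E] (φ : k →+* E) (X Y : E),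
        φ a * X ^ 2 + φ b * Y ^ 2 = 1 → (∀ p : k[X], p.eval₂ φ X = 0 → p = 0) →
        ∃ j : K →+* E, j.comp ι = φ ∧ j x = X ∧ j y = Y := by
  obtain ⟨f, hf, hfι, hfrac⟩ := hK
  set x₀ : ConicRing k a b := Ideal.Quotient.mk _ (MvPolynomial.X 0) with hx₀
  set y₀ : ConicRing k a b := Ideal.Quotient.mk _ (MvPolynomial.X 1) with hy₀
  have hev : ∀ p : k[X], p.eval₂ ι (f x₀) = f (Polynomial.aeval x₀ p) := fun p => by
    rw [Polynomial.aeval_def, Polynomial.hom_eval₂, hfι]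
  have hι : ∀ r, ι r = f (algebraMap k _ r) := fun r => by rw [← hfι]; rfl
  have heq : ι a * f x₀ ^ 2 + ι b * f y₀ ^ 2 = 1 := by
    have h := congrArg f (conicRing_rel (a := a) (b := b))
    rw [map_add, map_mul, map_mul, map_one] at h
    rw [hι, hι, ← h, ← map_pow f x₀, ← map_pow f y₀]
  have htr : ∀ p : k[X], p.eval₂ ι (f x₀) = 0 → p = 0 := fun p hp => by
    rw [hev] at hp
    exact conicRing_eq_zero_of_aeval (a := a) hb p
      ((map_eq_zero_iff f hf).1 hp)
  refine ⟨f x₀, f y₀, ⟨heq, htr, ?_⟩, ?_⟩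
  · intro z
    obtain ⟨P, Q, hQ, rfl⟩ := hfrac z
    obtain ⟨p, q, rfl⟩ := conicRing_normal_form hb P
    obtain ⟨p', q', rfl⟩ := conicRing_normal_form hb Q
    rw [map_add, map_mul, ← hx₀, ← hy₀, ← hev, ← hev] at hQ ⊢
    rw [map_add, map_mul, ← hev, ← hev]
    have hb' : ι b * ι b⁻¹ = 1 := by rw [← map_mul, mul_inv_cancel₀ hb, map_one]
    by_cases hN : Polynomial.C b * p' ^ 2 =
        q' ^ 2 * (1 - Polynomial.C a * Polynomial.X ^ 2)
    · have hN' := congrArg (Polynomial.eval₂ ι (f x₀)) hN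
      simp only [Polynomial.eval₂_sub, Polynomial.eval₂_mul, Polynomial.eval₂_pow,
        Polynomial.eval₂_C, Polynomial.eval₂_one, Polynomial.eval₂_X] at hN'
      have h3 : ι b * ((p'.eval₂ ι (f x₀) - q'.eval₂ ι (f x₀) * f y₀) *
          (p'.eval₂ ι (f x₀) + q'.eval₂ ι (f x₀) * f y₀)) = 0 := by
        linear_combination hN' - (q'.eval₂ ι (f x₀)) ^ 2 * heq
      have hbι : ι b ≠ 0 := by simpa using hb
      have h4 : p'.eval₂ ι (f x₀) - q'.eval₂ ι (f x₀) * f y₀ = 0 := by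
        simpa [hbι, hQ] using h3
      have h5 : p'.eval₂ ι (f x₀) = q'.eval₂ ι (f x₀) * f y₀ := sub_eq_zero.1 h4
      refine ⟨p, q, 2 * p', ?_, ?_⟩
      · rintro h0
        have h6 := congrArg (Polynomial.eval₂ ι (f x₀)) h0
        rw [two_mul, Polynomial.eval₂_add, Polynomial.eval₂_zero] at h6
        apply hQ
        rw [← h5]
        exact h6
      · rw [two_mul, Polynomial.eval₂_add, div_mul_eq_mul_div, div_eq_iff hQ]
        nth_rewrite 2 [h5]
        rfl
    · refine ⟨Polynomial.C b * p * p' - q * q' * (1 - Polynomial.C a * Polynomial.X ^ 2),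
        Polynomial.C b * (q * p' - p * q'),
        Polynomial.C b * p' ^ 2 - q' ^ 2 * (1 - Polynomial.C a * Polynomial.X ^ 2),
        sub_ne_zero.2 hN, ?_⟩
      rw [div_mul_eq_mul_div, div_eq_iff hQ]
      simp only [Polynomial.eval₂_sub, Polynomial.eval₂_mul, Polynomial.eval₂_pow,
        Polynomial.eval₂_C, Polynomial.eval₂_one, Polynomial.eval₂_X]
      set A := p.eval₂ ι (f x₀)
      set B := q.eval₂ ι (f x₀)
      set A' := p'.eval₂ ι (f x₀)
      set B' := q'.eval₂ ι (f x₀)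
      have : 1 - ι a * f x₀ ^ 2 = ι b * f y₀ ^ 2 := by rw [← heq]; ring
      rw [this]
      ring
  · intro E _ _ φ X Y hXY hX
    have hg : ∀ z ∈ Ideal.span {conicPoly k a b},
        MvPolynomial.eval₂Hom φ ![X, Y] z = 0 := by
      intro z hz
      obtain ⟨w, rfl⟩ := Ideal.mem_span_singleton.1 hz
      rw [map_mul]
      have : MvPolynomial.eval₂Hom φ ![X, Y] (conicPoly k a b) = 0 := by
        simp [conicPoly, hXY]
      rw [this, zero_mul]
    let g : ConicRing k a b →+* E := Ideal.Quotient.lift _ _ hg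
    have hgx : g x₀ = X := by simp [g, x₀]
    have hgy : g y₀ = Y := by simp [g, y₀]
    have hgι : g.comp (algebraMap k _) = φ := by
      ext r
      change g (Ideal.Quotient.mk _ (MvPolynomial.C r)) = _
      simp [g]
    have hgev : ∀ p : k[X], g (Polynomial.aeval x₀ p) = p.eval₂ φ X := fun p => by
      rw [Polynomial.aeval_def, Polynomial.hom_eval₂, hgι, hgx]
    have hginj : Function.Injective g := by
      rw [injective_iff_map_eq_zero]
      intro z hz
      obtain ⟨p, q, rfl⟩ := conicRing_normal_form hb z
      rw [map_add, map_mul, ← hx₀, ← hy₀, hgev, hgev, hgy] at hz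
      have hN := conic_norm_eq hXY hX hz
      have hN' := congrArg (Polynomial.eval₂ ι (f x₀)) hN
      simp only [Polynomial.eval₂_sub, Polynomial.eval₂_mul, Polynomial.eval₂_pow,
        Polynomial.eval₂_C, Polynomial.eval₂_one, Polynomial.eval₂_X] at hN'
      have h3 : ι b * ((p.eval₂ ι (f x₀) - q.eval₂ ι (f x₀) * f y₀) *
          (p.eval₂ ι (f x₀) + q.eval₂ ι (f x₀) * f y₀)) = 0 := by
        linear_combination hN' - (q.eval₂ ι (f x₀)) ^ 2 * heq
      have hbι : ι b ≠ 0 := by simpa using hb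
      rcases mul_eq_zero.1 h3 with h | h
      · exact absurd h hbι
      rcases mul_eq_zero.1 h with h | h
      · rw [hev, hev, ← map_mul, ← map_sub, map_eq_zero_iff f hf, sub_eq_zero] at h
        have h5 := congrArg g h
        rw [map_mul, hgev, hgev, hgy] at h5
        have h6 : (2 * p).eval₂ φ X = 0 := by
          rw [two_mul, Polynomial.eval₂_add]
          nth_rewrite 2 [h5]
          exact hz
        have h7 : p = 0 := by
          have h9 : p.eval₂ φ X = 0 := by
            rw [two_mul, Polynomial.eval₂_add, ← two_mul] at h6
            simpa using h6
          exact hX _ h9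
        rw [← h, h7]
        simp
      · rw [hev, hev, ← map_mul, ← map_add, map_eq_zero_iff f hf] at h
        exact h
    let _ : Algebra (ConicRing k a b) K := f.toAlgebra
    have : FaithfulSMul (ConicRing k a b) K := (faithfulSMul_iff_algebraMap_injective _ _).2 hf
    have : IsDomain (ConicRing k a b) := hf.isDomain f
    have : IsFractionRing (ConicRing k a b) K := by
      refine IsFractionRing.of_field _ _ fun z => ?_
      obtain ⟨p, q, hq, rfl⟩ := hfrac z
      exact ⟨p, q, rfl⟩
    refine ⟨IsFractionRing.lift hginj, ?_, ?_, ?_⟩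
    · ext r
      rw [RingHom.comp_apply, hι]
      rw [← hgι]
      exact IsFractionRing.lift_algebraMap hginj _
    · rw [← hgx]
      exact IsFractionRing.lift_algebraMap hginj _
    · rw [← hgy]
      exact IsFractionRing.lift_algebraMap hginj _

end Function

/-- `r` is the reduction modulo a prime element `p` of finite multiplicity. -/
structure Reduction {A κ : Type*} [CommRing A] [Field κ] (p : A) (r : A →+* κ) : Prop where
  ne_zero : p ≠ 0
  ker : ∀ a, r a = 0 ↔ p ∣ a
  fin : ∀ a, a ≠ 0 → ∃ n b, a = p ^ n * b ∧ ¬ p ∣ b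

/-- Elements which are units for the reduction `r`, up to squares. -/
def unitSq {A κ : Type*} (E : Type*) [CommRing A] [Field κ] [Field E] [Algebra A E]
    (r : A →+* κ) : Set E :=
  {z | ∃ (a : A) (g : E), r a ≠ 0 ∧ g ≠ 0 ∧ z = algebraMap A E a * g ^ 2}

/-- Elements whose reduction is a square, up to squares. -/
def resSq {A κ : Type*} (E : Type*) [CommRing A] [Field κ] [Field E] [Algebra A E]
    (r : A →+* κ) : Set E :=
  {z | ∃ (a : A) (g : E), r a ≠ 0 ∧ IsSquare (r a) ∧ g ≠ 0 ∧ z = algebraMap A E a * g ^ 2}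

set_option linter.unusedSectionVars false

namespace Reduction

variable {A κ E : Type*} [CommRing A] [IsDomain A] [Field κ] [Field E] [Algebra A E]
  [IsFractionRing A E] {p : A} {r : A →+* κ}

theorem map_self (h : Reduction p r) : r p = 0 := (h.ker p).2 dvd_rfl

theorem fin' (h : Reduction p r) {a : A} (ha : a ≠ 0) : ∃ n b, a = p ^ n * b ∧ r b ≠ 0 := by
  obtain ⟨n, b, h1, h2⟩ := h.fin a ha
  exact ⟨n, b, h1, fun h3 => h2 ((h.ker b).1 h3)⟩

theorem pow_unique (h : Reduction p r) {i j : ℕ} {a b : A} (ha : r a ≠ 0) (hb : r b ≠ 0)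
    (hab : p ^ i * a = p ^ j * b) : i = j ∧ a = b := by
  wlog hij : i ≤ j generalizing i j a b
  · have := this hb ha hab.symm (by omega)
    exact ⟨this.1.symm, this.2.symm⟩
  obtain ⟨m, rfl⟩ := Nat.exists_eq_add_of_le hij
  rw [pow_add, mul_assoc] at hab
  have h1 := mul_left_cancel₀ (pow_ne_zero i h.ne_zero) hab
  rcases m with _ | m
  · simpa using h1
  · exfalso
    apply ha
    rw [h1, pow_succ]
    simp [h.map_self]

theorem parity (h : Reduction p r) {i j : ℕ} {a b c d : A} (ha : r a ≠ 0) (hb : r b ≠ 0)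
    (hc : c ≠ 0) (hd : d ≠ 0) (hab : p ^ i * a * c ^ 2 = p ^ j * b * d ^ 2) :
    i % 2 = j % 2 ∧ IsSquare (r a * r b) := by
  obtain ⟨s, c, rfl, hc'⟩ := h.fin' hc
  obtain ⟨t, d, rfl, hd'⟩ := h.fin' hd
  have h1 : p ^ (i + 2 * s) * (a * c ^ 2) = p ^ (j + 2 * t) * (b * d ^ 2) := by
    rw [pow_add, pow_add, pow_mul', pow_mul']
    linear_combination hab
  obtain ⟨h2, h3⟩ := h.pow_unique (by simp [ha, hc']) (by simp [hb, hd']) h1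
  refine ⟨by omega, r b * (r d / r c), ?_⟩
  have h4 : r a * r c ^ 2 = r b * r d ^ 2 := by
    rw [← map_pow, ← map_pow, ← map_mul, ← map_mul, h3]
  field_simp
  linear_combination h4

theorem algebraMap_ne_zero' {a : A} (ha : a ≠ 0) : algebraMap A E a ≠ 0 := by
  simpa using (IsFractionRing.injective A E).ne_iff.2 ha

theorem ne_zero_of_map {a : A} (ha : r a ≠ 0) : a ≠ 0 := by
  rintro rfl
  simp at ha

theorem parity' (h : Reduction p r) {i j : ℕ} {a b : A} {g g' : E} (ha : r a ≠ 0)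
    (hb : r b ≠ 0) (hc : g ≠ 0) (hd : g' ≠ 0)
    (hab : algebraMap A E (p ^ i * a) * g ^ 2 = algebraMap A E (p ^ j * b) * g' ^ 2) :
    i % 2 = j % 2 ∧ IsSquare (r a * r b) := by
  obtain ⟨c, d, hd0, rfl⟩ := IsFractionRing.div_surjective (A := A) g
  obtain ⟨c', d', hd0', rfl⟩ := IsFractionRing.div_surjective (A := A) g'
  have hd1 := nonZeroDivisors.ne_zero hd0
  have hd1' := nonZeroDivisors.ne_zero hd0'
  have hc1 : c ≠ 0 := by rintro rfl; simp at hc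
  have hc1' : c' ≠ 0 := by rintro rfl; simp at hd
  refine h.parity ha hb (mul_ne_zero hc1 hd1') (mul_ne_zero hc1' hd1) ?_
  apply IsFractionRing.injective A E
  have e1 := algebraMap_ne_zero' (E := E) hd1
  have e2 := algebraMap_ne_zero' (E := E) hd1'
  field_simp at hab
  simp only [map_mul, map_pow] at hab ⊢
  linear_combination hab

theorem isSqGroup_unitSq : IsSqGroup (unitSq E r) where
  zero_notMem := by
    rintro ⟨a, g, ha, hg, h0⟩
    exact mul_ne_zero (algebraMap_ne_zero' (ne_zero_of_map ha)) (pow_ne_zero 2 hg) h0.symm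
  sq_mem x hx := ⟨1, x, by simp, hx, by simp⟩
  mul_mem := by
    rintro _ _ ⟨a, g, ha, hg, rfl⟩ ⟨b, g', hb, hg', rfl⟩
    exact ⟨a * b, g * g', by simp [ha, hb], mul_ne_zero hg hg', by rw [map_mul]; ring⟩

theorem isSqGroup_resSq : IsSqGroup (resSq E r) where
  zero_notMem := by
    rintro ⟨a, g, ha, -, hg, h0⟩
    exact mul_ne_zero (algebraMap_ne_zero' (ne_zero_of_map ha)) (pow_ne_zero 2 hg) h0.symm
  sq_mem x hx := ⟨1, x, by simp, by simp, hx, by simp⟩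
  mul_mem := by
    rintro _ _ ⟨a, g, ha, hs, hg, rfl⟩ ⟨b, g', hb, hs', hg', rfl⟩
    exact ⟨a * b, g * g', by simp [ha, hb], by rw [map_mul]; exact hs.mul hs',
      mul_ne_zero hg hg', by rw [map_mul]; ring⟩

theorem resSq_subset_unitSq : resSq E r ⊆ unitSq E r := by
  rintro _ ⟨a, g, ha, -, hg, rfl⟩
  exact ⟨a, g, ha, hg, rfl⟩

theorem isSquare_of_mem_resSq (h : Reduction p r) {a : A} {g : E} (ha : r a ≠ 0) (hg : g ≠ 0)
    (hm : algebraMap A E a * g ^ 2 ∈ resSq E r) : IsSquare (r a) := by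
  obtain ⟨b, g', hb, ⟨s, hs⟩, hg', h1⟩ := hm
  obtain ⟨t, ht⟩ := (h.parity' (i := 0) (j := 0) ha hb hg hg' (by simpa using h1)).2
  have hs0 : s ≠ 0 := by rintro rfl; simp [hs] at hb
  refine ⟨t / s, ?_⟩
  field_simp
  rw [hs] at ht
  linear_combination ht

theorem mem_unitSq {a : A} (ha : r a ≠ 0) : algebraMap A E a ∈ unitSq E r :=
  ⟨a, 1, ha, one_ne_zero, by simp⟩

theorem self_notMem_unitSq (h : Reduction p r) : algebraMap A E p ∉ unitSq E r := by
  rintro ⟨a, g, ha, hg, h1⟩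
  have := (h.parity' (i := 1) (j := 0) (a := 1) (g := (1 : E)) (by simp) ha one_ne_zero hg
    (by simpa using h1)).1
  simp at this

/-- Every nonzero element is even, or is of odd order at `p`, in an explicit way. -/
theorem unitSq_or (h : Reduction p r) {z : E} (hz : z ≠ 0) : z ∈ unitSq E r ∨
    ∃ n c d, r c ≠ 0 ∧ r d ≠ 0 ∧
      (z = algebraMap A E (p ^ (2 * n + 1) * c) / algebraMap A E d ∨
        z = algebraMap A E c / algebraMap A E (p ^ (2 * n + 1) * d)) := by
  obtain ⟨c, d, hd0, rfl⟩ := IsFractionRing.div_surjective (A := A) z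
  have hd1 := nonZeroDivisors.ne_zero hd0
  have hc1 : c ≠ 0 := by rintro rfl; simp at hz
  obtain ⟨s, c, rfl, hc'⟩ := h.fin' hc1
  obtain ⟨t, d, rfl, hd'⟩ := h.fin' hd1
  have e0 := algebraMap_ne_zero' (E := E) h.ne_zero
  have e1 := algebraMap_ne_zero' (E := E) (ne_zero_of_map hc')
  have e2 := algebraMap_ne_zero' (E := E) (ne_zero_of_map hd')
  rcases le_total t s with hst | hst
  · obtain ⟨m, rfl⟩ := Nat.exists_eq_add_of_le hst
    rcases Nat.even_or_odd' m with ⟨n, rfl | rfl⟩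
    · refine .inl ⟨c * d, algebraMap A E p ^ n / algebraMap A E d, by simp [hc', hd'],
        by simp [e0, e2], ?_⟩
      simp only [map_mul, map_pow]
      field_simp
      ring
    · refine .inr ⟨n, c, d, hc', hd', .inl ?_⟩
      simp only [map_mul, map_pow]
      field_simp
      ring
  · obtain ⟨m, rfl⟩ := Nat.exists_eq_add_of_le hst
    rcases Nat.even_or_odd' m with ⟨n, rfl | rfl⟩
    · refine .inl ⟨c * d, 1 / (algebraMap A E p ^ n * algebraMap A E d), by simp [hc', hd'],
        by simp [e0, e2], ?_⟩
      simp only [map_mul, map_pow]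
      field_simp
      ring
    · refine .inr ⟨n, c, d, hc', hd', .inr ?_⟩
      simp only [map_mul, map_pow]
      field_simp
      ring

theorem unitSq_or_mul (h : Reduction p r) {z : E} (hz : z ≠ 0) :
    z ∈ unitSq E r ∨ z * algebraMap A E p ∈ unitSq E r := by
  refine (h.unitSq_or hz).imp_right ?_
  have e0 := algebraMap_ne_zero' (E := E) h.ne_zero
  rintro ⟨n, c, d, hc, hd, rfl | rfl⟩
  · have e2 := algebraMap_ne_zero' (E := E) (ne_zero_of_map hd)
    refine ⟨c * d, algebraMap A E p ^ (n + 1) / algebraMap A E d, by simp [hc, hd],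
      by simp [e0, e2], ?_⟩
    simp only [map_mul, map_pow]
    field_simp
    ring
  · have e2 := algebraMap_ne_zero' (E := E) (ne_zero_of_map hd)
    refine ⟨c * d, 1 / (algebraMap A E p ^ n * algebraMap A E d), by simp [hc, hd],
      by simp [e0, e2], ?_⟩
    simp only [map_mul, map_pow]
    field_simp
    ring

theorem rigidOutside (h : Reduction p r) : RigidOutside (resSq E r) (unitSq E r) := by
  intro x hx hxU
  rcases h.unitSq_or hx with h1 | ⟨n, c, d, hc, hd, rfl | rfl⟩
  · exact absurd h1 hxU
  · left
    have e2 := algebraMap_ne_zero' (E := E) (ne_zero_of_map hd)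
    refine ⟨(d + p ^ (2 * n + 1) * c) * d, 1 / algebraMap A E d, ?_, ?_, by simp [e2], ?_⟩
    · simp [h.map_self, hd]
    · simp [h.map_self]
    · simp only [map_mul, map_add, map_pow]
      field_simp
  · right
    have e0 := algebraMap_ne_zero' (E := E) h.ne_zero
    have e2 := algebraMap_ne_zero' (E := E) (ne_zero_of_map hd)
    refine ⟨(c + p ^ (2 * n + 1) * d) * c, 1 / algebraMap A E (p ^ (2 * n + 1) * d), ?_, ?_,
      ?_, ?_⟩
    · simp [h.map_self, hc]
    · simp [h.map_self]
    · simp [e2, e0]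
    · simp only [map_mul, map_add, map_pow]
      field_simp
      ring

/-- A representation over the fraction field reduces to a nontrivial residual zero. -/
theorem isotropic (h : Reduction p r) {ξ η : A} {X Y : E}
    (hXY : algebraMap A E η = X ^ 2 + algebraMap A E ξ * Y ^ 2) :
    ∃ x y z : κ, (x ≠ 0 ∨ y ≠ 0 ∨ z ≠ 0) ∧ r η * z ^ 2 = x ^ 2 + r ξ * y ^ 2 := by
  obtain ⟨a, d, hd0, rfl⟩ := IsFractionRing.div_surjective (A := A) X
  obtain ⟨b, d', hd0', rfl⟩ := IsFractionRing.div_surjective (A := A) Y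
  have hd1 := nonZeroDivisors.ne_zero hd0
  have hd1' := nonZeroDivisors.ne_zero hd0'
  have e1 := algebraMap_ne_zero' (E := E) hd1
  have e2 := algebraMap_ne_zero' (E := E) hd1'
  have h1 : η * (d * d') ^ 2 = (a * d') ^ 2 + ξ * (b * d) ^ 2 := by
    apply IsFractionRing.injective A E
    field_simp at hXY
    simp only [map_mul, map_pow, map_add] at hXY ⊢
    linear_combination hXY
  obtain ⟨n, e, hde, he⟩ := h.fin' (mul_ne_zero hd1 hd1')
  rw [hde] at h1
  generalize a * d' = u at h1
  generalize b * d = w at h1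
  clear hXY hde
  induction n generalizing u w with
  | zero =>
    refine ⟨r u, r w, r e, .inr (.inr he), ?_⟩
    have := congrArg r h1
    simpa using this
  | succ n ih =>
    by_cases hu : r u = 0
    · by_cases hw : r w = 0
      · obtain ⟨u, rfl⟩ := (h.ker _).1 hu
        obtain ⟨w, rfl⟩ := (h.ker _).1 hw
        refine ih u w ?_
        apply mul_left_cancel₀ (pow_ne_zero 2 h.ne_zero)
        linear_combination h1
      · refine ⟨r u, r w, r (p ^ (n + 1) * e), .inr (.inl hw), ?_⟩
        have := congrArg r h1
        simpa using this
    · refine ⟨r u, r w, r (p ^ (n + 1) * e), .inl hu, ?_⟩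
      have := congrArg r h1
      simpa using this

end Reduction

theorem Polynomial.reduction {k : Type*} [Field k] {π : k[X]} [Fact (Irreducible π)] :
    Reduction π (AdjoinRoot.mk π) where
  ne_zero := (Fact.out : Irreducible π).ne_zero
  ker a := AdjoinRoot.mk_eq_zero
  fin a ha := by
    obtain ⟨n, b, h1, h2⟩ := WfDvdMonoid.max_power_factor ha (Fact.out : Irreducible π)
    exact ⟨n, b, h2, h1⟩

theorem Polynomial.eq_zero_of_sq_mul_eq {k : Type*} [Field k] {f p q : k[X]} (hf : Squarefree f)
    (hu : ¬ IsUnit f) {c : k} (hc : c ≠ 0) (h : Polynomial.C c * p ^ 2 = q ^ 2 * f) :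
    q = 0 := by
  by_contra hq
  obtain ⟨π, hπ, f, rfl⟩ := WfDvdMonoid.exists_irreducible_factor hu hf.ne_zero
  have : Fact (Irreducible π) := ⟨hπ⟩
  have hf' : AdjoinRoot.mk π f ≠ 0 := by
    rw [Ne, AdjoinRoot.mk_eq_zero]
    rintro ⟨g, rfl⟩
    exact hπ.not_isUnit (hf π ⟨g, by ring⟩)
  have hp : p ≠ 0 := by
    rintro rfl
    have := hf.ne_zero
    simp_all
  have hcπ : AdjoinRoot.mk π (Polynomial.C c) ≠ 0 := by
    rw [AdjoinRoot.mk_C, AdjoinRoot.coe_injective'.ne_iff' (map_zero _)]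
    exact hc
  have := (Polynomial.reduction (π := π)).parity (i := 0) (j := 1) hcπ hf' hp hq
    (by linear_combination h)
  simp at this

theorem squarefree_one_sub {k : Type*} [Field k] [CharZero k] (a : k) :
    Squarefree (1 - Polynomial.C a * Polynomial.X ^ 2 : k[X]) := by
  apply Polynomial.Separable.squarefree
  refine ⟨1, Polynomial.C 2⁻¹ * (-Polynomial.X), ?_⟩
  have h2 : (Polynomial.C 2⁻¹ : k[X]) * 2 = 1 := by
    rw [← Polynomial.C_ofNat, ← Polynomial.C_mul]
    simp
  simp only [Polynomial.derivative_sub, Polynomial.derivative_one, Polynomial.derivative_C_mul,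
    Polynomial.derivative_X_pow]
  push_cast
  simp only [map_ofNat]
  linear_combination Polynomial.C a * Polynomial.X ^ 2 * h2

theorem not_isUnit_one_sub {k : Type*} [Field k] {a : k} (ha : a ≠ 0) :
    ¬ IsUnit (1 - Polynomial.C a * Polynomial.X ^ 2 : k[X]) := by
  intro h
  have h1 := Polynomial.natDegree_eq_zero_of_isUnit h
  have h2 : (1 - Polynomial.C a * Polynomial.X ^ 2 : k[X]).natDegree = 2 := by
    compute_degree!
  omega

namespace ConicGen

variable {k K : Type*} [Field k] [CharZero k] [Field K] {ι : k →+* K} {a b : k} {x y : K}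

theorem indep (h : ConicGen ι a b x y) (ha : a ≠ 0) (hb : b ≠ 0) {p q : k[X]}
    (hpq : p.eval₂ ι x + q.eval₂ ι x * y = 0) : p = 0 ∧ q = 0 := by
  have h1 := conic_norm_eq h.eq h.transc hpq
  have hq := Polynomial.eq_zero_of_sq_mul_eq (squarefree_one_sub a) (not_isUnit_one_sub ha) hb h1
  subst hq
  exact ⟨h.transc _ (by simpa using hpq), rfl⟩

/-- The field of constants is quadratically closed in the function field. -/
theorem isSquare_of_isSquare_map (h : ConicGen ι a b x y) (ha : a ≠ 0) (hb : b ≠ 0) {c : k}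
    (hc : IsSquare (ι c)) : IsSquare c := by
  rcases eq_or_ne c 0 with rfl | hc0
  · exact ⟨0, by simp⟩
  obtain ⟨z, hz⟩ := hc
  obtain ⟨p, q, r, hr, hzr⟩ := h.gen z
  have key : (Polynomial.C b * p ^ 2 + q ^ 2 * (1 - Polynomial.C a * Polynomial.X ^ 2) -
      Polynomial.C (b * c) * r ^ 2).eval₂ ι x + (2 * Polynomial.C b * p * q).eval₂ ι x * y = 0 := by
    simp only [Polynomial.eval₂_sub, Polynomial.eval₂_mul, Polynomial.eval₂_pow,
      Polynomial.eval₂_C, Polynomial.eval₂_one, Polynomial.eval₂_X, Polynomial.eval₂_add,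
      Polynomial.eval₂_ofNat, map_mul]
    linear_combination (-ι b * (z * r.eval₂ ι x + p.eval₂ ι x + q.eval₂ ι x * y)) * hzr -
      (q.eval₂ ι x) ^ 2 * h.eq - ι b * (r.eval₂ ι x) ^ 2 * hz
  obtain ⟨h1, h2⟩ := h.indep ha hb key
  have h3 : p = 0 ∨ q = 0 := by
    have h2' : (2 : k[X]) * Polynomial.C b ≠ 0 := mul_ne_zero two_ne_zero (by simpa using hb)
    rw [mul_assoc] at h2
    exact mul_eq_zero.1 ((mul_eq_zero.1 h2).resolve_left h2')
  have hq : q = 0 := by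
    rcases h3 with rfl | h3
    · exact Polynomial.eq_zero_of_sq_mul_eq (squarefree_one_sub a) (not_isUnit_one_sub ha)
        (mul_ne_zero hb hc0) (p := r) (by linear_combination -h1)
    · exact h3
  subst hq
  have h4 : p ^ 2 = Polynomial.C c * r ^ 2 := by
    apply mul_left_cancel₀ (Polynomial.C_ne_zero.2 hb)
    rw [Polynomial.C_mul] at h1
    linear_combination h1
  have h5 := congrArg Polynomial.leadingCoeff h4
  simp only [Polynomial.leadingCoeff_mul, Polynomial.leadingCoeff_pow,
    Polynomial.leadingCoeff_C] at h5
  have h6 : r.leadingCoeff ≠ 0 := by simpa using hr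
  refine ⟨p.leadingCoeff / r.leadingCoeff, ?_⟩
  field_simp
  linear_combination -h5

end ConicGen

/-- Elements of a quadratic extension. -/
theorem IntermediateField.exists_add_mul_of_mem_adjoin {F E : Type*} [Field F] [Field E]
    [Algebra F E] {α : E} {a : F} (hα : α ^ 2 = algebraMap F E a) {z : E}
    (hz : z ∈ IntermediateField.adjoin F {α}) :
    ∃ u v : F, z = algebraMap F E u + algebraMap F E v * α := by
  have halg : IsAlgebraic F α := by
    refine ⟨Polynomial.X ^ 2 - Polynomial.C a, Polynomial.X_pow_sub_C_ne_zero two_pos a, ?_⟩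
    simp [hα]
  rw [← IntermediateField.mem_toSubalgebra,
    IntermediateField.adjoin_simple_toSubalgebra_of_isAlgebraic halg,
    Algebra.adjoin_singleton_eq_range_aeval] at hz
  obtain ⟨p, rfl⟩ := hz
  induction p using Polynomial.induction_on' with
  | add p q hp hq =>
    obtain ⟨u, v, h⟩ := hp
    obtain ⟨u', v', h'⟩ := hq
    refine ⟨u + u', v + v', ?_⟩
    simp only [AlgHom.toRingHom_eq_coe, RingHom.coe_coe] at h h' ⊢
    rw [map_add, h, h', map_add, map_add]
    ring
  | monomial n c =>
    simp only [AlgHom.toRingHom_eq_coe, RingHom.coe_coe, Polynomial.aeval_monomial]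
    rcases Nat.even_or_odd' n with ⟨m, rfl | rfl⟩
    · exact ⟨c * a ^ m, 0, by rw [pow_mul, hα]; simp⟩
    · exact ⟨0, c * a ^ m, by rw [pow_succ, pow_mul, hα]; simp; ring⟩

theorem exists_numberField_sqrt.{u} (k : Type u) [Field k] [NumberField k] (a : k) :
    ∃ (k' : Type u) (_ : Field k') (_ : NumberField k') (_ : Algebra k k') (α : k'),
      α ^ 2 = algebraMap k k' a ∧
        ∀ z : k', ∃ u v : k, z = algebraMap k k' u + algebraMap k k' v * α := by
  obtain ⟨α, hα⟩ := IsAlgClosed.exists_pow_nat_eq (algebraMap k (AlgebraicClosure k) a)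
    (n := 2) (by norm_num)
  have halg : IsIntegral k α := by
    refine ⟨Polynomial.X ^ 2 - Polynomial.C a, Polynomial.monic_X_pow_sub_C a two_ne_zero, ?_⟩
    simp [hα]
  have : FiniteDimensional k (IntermediateField.adjoin k {α}) :=
    IntermediateField.adjoin.finiteDimensional halg
  have hchar : CharZero (IntermediateField.adjoin k {α}) :=
    charZero_of_injective_algebraMap (algebraMap k (IntermediateField.adjoin k {α})).injective
  refine ⟨IntermediateField.adjoin k {α}, inferInstance,
    NumberField.of_module_finite k (IntermediateField.adjoin k {α}), inferInstance,
    ⟨α, IntermediateField.mem_adjoin_simple_self k α⟩, Subtype.ext hα, ?_⟩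
  rintro ⟨z, hz⟩
  obtain ⟨u, v, h⟩ := IntermediateField.exists_add_mul_of_mem_adjoin hα hz
  exact ⟨u, v, Subtype.ext h⟩

/-- An embedding of a function field over `k` into a rational function field, of degree at
most two, with descent of constants. -/
structure ConicEmb {k K k' : Type*} [Field k] [Field K] [Field k'] [Algebra k k']
    (ι : k →+* K) (j : K →+* RatFunc k') (α : k') : Prop where
  const : ∀ r, j (ι r) = RatFunc.C (algebraMap k k' r)
  gen : ∀ z, ∃ u v, z = j u + RatFunc.C α * j v
  descent : ∀ (z : K) (c : k') (g : RatFunc k'), z ≠ 0 → j z = RatFunc.C c * g ^ 2 →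
    ∃ r w, z = ι r * w ^ 2

section Descent

variable {k K k' : Type*} [Field k] [CharZero k] [Field K] [Field k'] [Algebra k k']
  {ι : k →+* K} {j : K →+* RatFunc k'} {α : k'} {a b : k} {x y : K}

theorem ConicGen.descent (hK : ConicGen ι a b x y) (ha : a ≠ 0) (hb : b ≠ 0)
    (hα : α ^ 2 = algebraMap k k' a)
    (hgen : ∀ z : k', ∃ u v : k, z = algebraMap k k' u + algebraMap k k' v * α)
    (const : ∀ r, j (ι r) = RatFunc.C (algebraMap k k' r))
    (gen : ∀ z, ∃ u v, z = j u + RatFunc.C α * j v) (z : K) (c : k') (g : RatFunc k')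
    (hz : z ≠ 0) (h : j z = RatFunc.C c * g ^ 2) : ∃ r w, z = ι r * w ^ 2 := by
  have hα' : (RatFunc.C α : RatFunc k') ^ 2 = j (ι a) := by rw [← map_pow, hα, const]
  obtain ⟨c₀, c₁, rfl⟩ := hgen c
  obtain ⟨u, v, rfl⟩ := gen g
  rw [map_add, map_mul, ← const, ← const] at h
  have hC0 : (RatFunc.C α : RatFunc k') ≠ 0 := by
    intro h0
    rw [h0] at hα'
    have : ι a = 0 := by
      apply j.injective
      rw [← hα']
      simp
    exact ha (by simpa using this)
  by_cases hsq : IsSquare a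
  · obtain ⟨s, rfl⟩ := hsq
    obtain ⟨s, hs⟩ : ∃ s, RatFunc.C α = j (ι s) := by
      have h1 : (RatFunc.C α - j (ι s)) * (RatFunc.C α + j (ι s)) = 0 := by
        rw [map_mul, map_mul] at hα'
        linear_combination hα'
      rcases mul_eq_zero.1 h1 with h | h
      · exact ⟨s, sub_eq_zero.1 h⟩
      · exact ⟨-s, by rw [map_neg, map_neg]; exact eq_neg_of_add_eq_zero_left h⟩
    refine ⟨c₀ + c₁ * s, u + ι s * v, j.injective ?_⟩
    rw [h, hs]
    simp only [map_mul, map_add, map_pow]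
  · have hns : ¬ IsSquare (ι a) := fun h => hsq (hK.isSquare_of_isSquare_map ha hb h)
    have indep : ∀ P Q : K, j P + RatFunc.C α * j Q = 0 → P = 0 ∧ Q = 0 := by
      intro P Q hPQ
      have hQ : Q = 0 := by
        by_contra hQ
        apply hns
        refine ⟨P / Q, j.injective ?_⟩
        have hQ' : j Q ≠ 0 := by simpa using hQ
        rw [← hα', map_mul, map_div₀]
        field_simp
        linear_combination (RatFunc.C α * j Q - j P) * hPQ
      refine ⟨?_, hQ⟩
      subst hQ
      simpa using hPQ
    obtain ⟨h1, h2⟩ := indep (ι c₀ * (u ^ 2 + ι a * v ^ 2) + 2 * ι a * ι c₁ * u * v - z)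
      (ι c₁ * (u ^ 2 + ι a * v ^ 2) + 2 * ι c₀ * u * v) (by
        simp only [map_add, map_mul, map_pow, map_sub, map_ofNat] at h ⊢
        rw [h]
        linear_combination (-(j (ι c₁) * 2 * j u * j v + (j (ι c₀) + j (ι c₁) * RatFunc.C α) *
          j v ^ 2)) * hα')
    have aι : ι a ≠ 0 := by simpa using ha
    rcases eq_or_ne c₁ 0 with rfl | hc₁
    · have hc₀ : ι c₀ ≠ 0 := by
        intro h0
        rw [h0] at h1
        apply hz
        simp at h1
        exact h1
      rw [map_zero] at h1 h2
      have h3 : u = 0 ∨ v = 0 := by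
        have h20 : (2 : K) ≠ 0 := by
          rw [← map_ofNat ι 2]
          exact (map_ne_zero ι).2 two_ne_zero
        have : 2 * ι c₀ * (u * v) = 0 := by linear_combination h2
        simpa [h20, hc₀] using this
      rcases h3 with rfl | rfl
      · exact ⟨c₀ * a, v, by rw [map_mul]; linear_combination -h1⟩
      · exact ⟨c₀, u, by linear_combination -h1⟩
    · have hc₁' : ι c₁ ≠ 0 := by simpa using hc₁
      rcases eq_or_ne v 0 with rfl | hv
      · have : u = 0 := by simpa [hc₁'] using h2
        subst this
        exact ⟨0, 1, by rw [map_zero]; linear_combination -h1⟩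
      · have h3 : ι (c₀ ^ 2 - a * c₁ ^ 2) = (ι c₁ * (u / v) + ι c₀) * (ι c₁ * (u / v) + ι c₀) := by
          simp only [map_sub, map_mul, map_pow]
          field_simp
          linear_combination (-ι c₁) * h2
        obtain ⟨e, he⟩ := hK.isSquare_of_isSquare_map ha hb ⟨_, h3⟩
        obtain ⟨e, he⟩ : ∃ e, ι c₁ * (u / v) + ι c₀ = ι e := by
          rw [he] at h3
          have h1 : (ι c₁ * (u / v) + ι c₀ - ι e) * (ι c₁ * (u / v) + ι c₀ + ι e) = 0 := by
            rw [map_mul] at h3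
            linear_combination -h3
          rcases mul_eq_zero.1 h1 with h | h
          · exact ⟨e, sub_eq_zero.1 h⟩
          · exact ⟨-e, by rw [map_neg]; exact eq_neg_of_add_eq_zero_left h⟩
        have hu : u = ι ((e - c₀) / c₁) * v := by
          rw [map_div₀, map_sub]
          field_simp at he ⊢
          linear_combination he
        set t := (e - c₀) / c₁
        refine ⟨c₀ * (t ^ 2 + a) + 2 * a * c₁ * t, v, ?_⟩
        simp only [map_add, map_mul, map_pow, map_ofNat]
        rw [hu] at h1
        linear_combination -h1

end Descent

theorem ConicGen.exists_conicEmb.{u, w} {k : Type u} {K : Type w} [Field k] [NumberField k]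
    [Field K] {ι : k →+* K} {a b : k} {x y : K} (hK : ConicGen ι a b x y) (ha : a ≠ 0) (hb : b ≠ 0)
    (hlift : ∀ {E : Type u} [Field E] [CharZero E] (φ : k →+* E) (X Y : E),
      φ a * X ^ 2 + φ b * Y ^ 2 = 1 → (∀ p : k[X], p.eval₂ φ X = 0 → p = 0) →
      ∃ j : K →+* E, j.comp ι = φ ∧ j x = X ∧ j y = Y) :
    ∃ (k' : Type u) (_ : Field k') (_ : NumberField k') (_ : Algebra k k') (j : K →+* RatFunc k')
      (α : k'), ConicEmb ι j α := by
  obtain ⟨k', i1, i2, i3, α, hα, hgen⟩ := exists_numberField_sqrt k a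
  have hα0 : α ≠ 0 := by
    rintro rfl
    rw [zero_pow two_ne_zero, eq_comm, map_eq_zero] at hα
    exact ha hα
  let T : RatFunc k' := RatFunc.X
  let φ : k →+* RatFunc k' := (RatFunc.C : k' →+* RatFunc k').comp (algebraMap k k')
  let A : RatFunc k' := RatFunc.C α
  have hA0 : A ≠ 0 := by simpa [A] using hα0
  have hA : A ^ 2 = φ a := by simp only [A, φ, ← map_pow, hα]; rfl
  have hTr : Transcendental k' T := RatFunc.transcendental_X
  have hb' : algebraMap k k' b ≠ 0 := by simpa using hb
  have hφb : φ b = algebraMap k' (RatFunc k') (algebraMap k k' b) := by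
    rw [RatFunc.algebraMap_eq_C]; rfl
  have hφb0 : φ b ≠ 0 := by simpa using hb
  have hD : 1 + φ b * T ^ 2 ≠ 0 := by
    intro h
    apply hTr
    refine ⟨1 + Polynomial.C (algebraMap k k' b) * Polynomial.X ^ 2, ?_, ?_⟩
    · intro h0
      have := congrArg (fun p => p.coeff 0) h0
      simp at this
    · simpa [hφb] using h
  set X := (1 - φ b * T ^ 2) / (A * (1 + φ b * T ^ 2)) with hX
  set Y := 2 * T / (1 + φ b * T ^ 2) with hY
  have hXY : φ a * X ^ 2 + φ b * Y ^ 2 = 1 := by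
    rw [hX, hY, ← hA]
    field_simp
    ring
  have h2 : (2 : RatFunc k') ≠ 0 := two_ne_zero
  have hAX : 1 + A * X = 2 / (1 + φ b * T ^ 2) := by
    rw [hX]
    field_simp
    ring
  have hT : T = Y / (1 + A * X) := by
    rw [hAX, hY, div_div_div_cancel_right₀ hD, mul_div_cancel_left₀ _ h2]
  have hXtr : ∀ p : k[X], p.eval₂ φ X = 0 → p = 0 := by
    intro p hp
    by_contra hp0
    have hXalg : IsAlgebraic k' X := by
      refine ⟨p.map (algebraMap k k'),
        (Polynomial.map_ne_zero_iff (algebraMap k k').injective).2 hp0, ?_⟩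
      rw [Polynomial.aeval_def, Polynomial.eval₂_map, RatFunc.algebraMap_eq_C]
      exact hp
    have hAalg : IsAlgebraic k' A := by
      simpa [A, ← RatFunc.algebraMap_eq_C] using isAlgebraic_algebraMap α
    have h3 : φ b * T ^ 2 = 2 / (1 + A * X) - 1 := by
      rw [hAX]
      field_simp
      ring
    have hTalg : IsAlgebraic k' (T ^ 2) := by
      have h4 : T ^ 2 = (2 * (1 + A * X)⁻¹ - 1) * (φ b)⁻¹ := by
        rw [← div_eq_mul_inv, ← div_eq_mul_inv, ← h3, mul_div_cancel_left₀ _ hφb0]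
      rw [h4]
      have one : IsAlgebraic k' (1 : RatFunc k') := isAlgebraic_one
      have two : IsAlgebraic k' (2 : RatFunc k') := by
        rw [← one_add_one_eq_two]; exact one.add one
      have hbalg : IsAlgebraic k' (φ b) := by
        rw [hφb]; exact isAlgebraic_algebraMap _
      exact ((two.mul (one.add (hAalg.mul hXalg)).inv).sub one).mul hbalg.inv
    exact hTr (hTalg.of_pow two_pos)
  obtain ⟨j, hjι, hjx, hjy⟩ := hlift φ X Y hXY hXtr
  have hjι' : ∀ r, j (ι r) = φ r := fun r => by rw [← hjι]; rfl
  have gen : ∀ z, ∃ u v, z = j u + RatFunc.C α * j v := by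
    let _ : Algebra K (RatFunc k') := j.toAlgebra
    have hAlg : ∀ z, algebraMap K (RatFunc k') z = j z := fun z => rfl
    have hmem : ∀ z : RatFunc k', z ∈ IntermediateField.adjoin K {A} := by
      have hAm : A ∈ IntermediateField.adjoin K {A} := IntermediateField.mem_adjoin_simple_self K A
      have hjm : ∀ z, j z ∈ IntermediateField.adjoin K {A} := fun z =>
        (IntermediateField.adjoin K {A}).algebraMap_mem z
      have hTm : T ∈ IntermediateField.adjoin K {A} := by
        rw [hT, ← hjx, ← hjy]
        exact div_mem (hjm _) (add_mem (one_mem _) (mul_mem hAm (hjm _)))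
      have hCm : ∀ c : k', RatFunc.C c ∈ IntermediateField.adjoin K {A} := by
        intro c
        obtain ⟨u, v, rfl⟩ := hgen c
        rw [map_add, map_mul]
        have := hjm (ι u)
        have h3 := hjm (ι v)
        rw [hjι'] at this h3
        exact add_mem this (mul_mem h3 hAm)
      have hpm : ∀ p : k'[X], algebraMap _ (RatFunc k') p ∈ IntermediateField.adjoin K {A} := by
        intro p
        induction p using Polynomial.induction_on' with
        | add p q hp hq => rw [map_add]; exact add_mem hp hq
        | monomial n c =>
          rw [← Polynomial.C_mul_X_pow_eq_monomial, map_mul, map_pow, RatFunc.algebraMap_C,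
            RatFunc.algebraMap_X]
          exact mul_mem (hCm c) (pow_mem hTm n)
      intro z
      rw [← RatFunc.num_div_denom z]
      exact div_mem (hpm _) (hpm _)
    intro z
    obtain ⟨u, v, h⟩ := IntermediateField.exists_add_mul_of_mem_adjoin (F := K) (a := ι a)
      (by rw [hAlg, hjι', hA]) (hmem z)
    exact ⟨u, v, by rw [h, hAlg, hAlg, mul_comm (j v)]⟩
  exact ⟨k', i1, i2, i3, j, α, hjι', gen, hK.descent ha hb hα hgen hjι' gen⟩

section Places

variable {m L : Type*} [Field m] [NumberField m] [Field L] [Algebra m[X] L] [FaithfulSMul m[X] L]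

theorem ValuationSubring.places_of_polynomial (y : L)
    (gen : ∀ w : L, ∃ p q r : m[X], r ≠ 0 ∧
      w * algebraMap m[X] L r = algebraMap m[X] L p + algebraMap m[X] L q * y)
    (O : ValuationSubring L) (hO : O ≠ ⊤) (hA : ∀ p, algebraMap m[X] L p ∈ O) :
    (∃ t, ∀ x, x ≠ 0 → x ∈ evenSet O.valuation ∨ x * t ∈ evenSet O.valuation) ∧
      NumberField (IsLocalRing.ResidueField O) := by
  let _ : Algebra (FractionRing m[X]) L := FractionRing.liftAlgebra m[X] L
  have _ := FractionRing.isScalarTower_liftAlgebra m[X] L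
  have hinj : ∀ r : m[X], r ≠ 0 → algebraMap m[X] L r ≠ 0 := by
    intro r hr h
    exact hr ((FaithfulSMul.algebraMap_injective m[X] L) (by rw [h, map_zero]))
  have hfin : FiniteDimensional (FractionRing m[X]) L := by
    classical
    refine ⟨⟨{1, y}, ?_⟩⟩
    refine Submodule.eq_top_iff'.2 fun w => ?_
    obtain ⟨p, q, r, hr, h⟩ := gen w
    have h1 : w = (algebraMap m[X] (FractionRing m[X]) p / algebraMap m[X] _ r) • (1 : L) +
        (algebraMap m[X] (FractionRing m[X]) q / algebraMap m[X] _ r) • y := by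
      rw [Algebra.smul_def, Algebra.smul_def, map_div₀, map_div₀,
        ← IsScalarTower.algebraMap_apply, ← IsScalarTower.algebraMap_apply,
        ← IsScalarTower.algebraMap_apply]
      have := hinj r hr
      field_simp
      linear_combination h
    rw [h1]
    refine Submodule.add_mem _ (Submodule.smul_mem _ _ (Submodule.subset_span ?_))
      (Submodule.smul_mem _ _ (Submodule.subset_span ?_))
    · simp
    · simp
  have _ : CharZero (FractionRing m[X]) := 
    charZero_of_injective_algebraMap (IsFractionRing.injective m[X] (FractionRing m[X]))
  have _ : IsDedekindDomain (integralClosure m[X] L) :=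
    integralClosure.isDedekindDomain m[X] (FractionRing m[X]) L
  have _ : IsFractionRing (integralClosure m[X] L) L :=
    integralClosure.isFractionRing_of_finite_extension (FractionRing m[X]) L
  have hmf : Module.Finite m[X] (integralClosure m[X] L) :=
    IsIntegralClosure.finite m[X] (FractionRing m[X]) L _
  have hA' : ∀ a : integralClosure m[X] L, algebraMap _ L a ∈ O := by
    intro a
    let _ : Algebra m[X] O := ((algebraMap m[X] L).codRestrict O.toSubring hA).toAlgebra
    have _ : IsScalarTower m[X] O L := IsScalarTower.of_algebraMap_eq fun _ => rfl
    have h1 : IsIntegral O (a : L) := IsIntegral.tower_top (R := m[X]) a.2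
    obtain ⟨b, hb⟩ := (IsIntegrallyClosed.isIntegral_iff (R := O) (K := L)).1 h1
    rw [show algebraMap (integralClosure m[X] L) L a = a from rfl, ← hb]
    exact b.2
  obtain ⟨P, hP⟩ := ValuationSubring.exists_heightOneSpectrum (integralClosure m[X] L) O hO hA'
  refine ⟨?_, ?_⟩
  · obtain ⟨t, -, -, ht⟩ := P.exists_uniformizer_evenSet (E := L)
    refine ⟨t, fun x hx => ?_⟩
    have : evenSet O.valuation = evenSet (P.valuation L) := by
      ext z
      simp only [evenSet, P.valuation_eq_one_iff_of_eq hP]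
    rw [this]
    exact ht x hx
  · let f : integralClosure m[X] L →+* O := (algebraMap _ L).codRestrict O.toSubring hA'
    have hsurj : Function.Surjective ((IsLocalRing.residue O).comp f) := by
      intro s
      obtain ⟨x, rfl⟩ := IsLocalRing.residue_surjective s
      have hx1 : P.valuation L (x : L) ≤ 1 := by
        have : (x : L) ∈ (P.valuation L).valuationSubring := hP ▸ x.2
        exact this
      obtain ⟨n, d, h⟩ := P.exists_primeCompl_mul_eq_of_integer (x : L) hx1
      have hmax := P.isMaximal
      obtain ⟨e, i, hi, he⟩ := hmax.exists_inv d.2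
      refine ⟨n * e, ?_⟩
      rw [← sub_eq_zero, RingHom.comp_apply, ← map_sub, IsLocalRing.residue_eq_zero_iff,
        O.valuation_lt_one_iff,
        P.valuation_lt_one_iff_of_eq hP]
      have h1 : ((f (n * e) - x : O) : L) = - (algebraMap (integralClosure m[X] L) L i * x) := by
        have : algebraMap (integralClosure m[X] L) L i =
          1 - algebraMap (integralClosure m[X] L) L e *
            algebraMap _ L (d : integralClosure m[X] L) := by
          rw [← map_mul, ← map_one (algebraMap (integralClosure m[X] L) L), ← map_sub, ← he]
          congr 1
          ring
        rw [this]
        change algebraMap (integralClosure m[X] L) L (n * e) - x = _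
        rw [map_mul, ← h]
        ring
      rw [h1, Valuation.map_neg, map_mul]
      exact mul_lt_one_of_lt_of_le ((P.valuation_lt_one_iff_mem i).2 hi) hx1
    let g : m →+* IsLocalRing.ResidueField O :=
      ((IsLocalRing.residue O).comp f).comp ((algebraMap m[X] _).comp Polynomial.C)
    let _ : Algebra m (IsLocalRing.ResidueField O) := g.toAlgebra
    have hft : Algebra.FiniteType m (IsLocalRing.ResidueField O) := by
      change g.FiniteType
      refine (RingHom.FiniteType.of_surjective _ hsurj).comp
        ((RingHom.FiniteType.of_finite ?_).comp ?_)
      · exact RingHom.finite_algebraMap.2 hmf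
      · exact (RingHom.finiteType_algebraMap (A := m) (B := m[X])).2 inferInstance
    have := finite_of_finite_type_of_isJacobsonRing m (IsLocalRing.ResidueField O)
    exact NumberField.of_module_finite m _

end Places

theorem ConicGen.places {m L : Type*} [Field m] [NumberField m] [Field L] {ι : m →+* L}
    {a b : m} {x y : L} (h : ConicGen ι a b x y) (O : ValuationSubring L) (hO : O ≠ ⊤)
    (hι : ∀ r, ι r ∈ O) :
    (∃ t, ∀ x, x ≠ 0 → x ∈ evenSet O.valuation ∨ x * t ∈ evenSet O.valuation) ∧
      NumberField (IsLocalRing.ResidueField O) := by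
  have key : ∀ z : L, z ∈ O → (∀ p : m[X], p.eval₂ ι z = 0 → p = 0) →
      (∀ w : L, ∃ p q r : m[X], r ≠ 0 ∧ w * r.eval₂ ι z = p.eval₂ ι z + q.eval₂ ι z * y) →
      (∃ t, ∀ x, x ≠ 0 → x ∈ evenSet O.valuation ∨ x * t ∈ evenSet O.valuation) ∧
      NumberField (IsLocalRing.ResidueField O) := by
    intro z hz htr hgen
    let _ : Algebra m[X] L := (Polynomial.eval₂RingHom ι z).toAlgebra
    have _ : FaithfulSMul m[X] L := (faithfulSMul_iff_algebraMap_injective _ _).2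
      ((injective_iff_map_eq_zero (Polynomial.eval₂RingHom ι z)).2 htr)
    refine ValuationSubring.places_of_polynomial y hgen O hO fun p => ?_
    change p.eval₂ ι z ∈ O
    rw [Polynomial.eval₂_eq_sum_range]
    exact sum_mem fun i _ => O.mul_mem _ _ (hι _) (pow_mem hz i)
  rcases O.mem_or_inv_mem x with hx | hx
  · exact key x hx h.transc h.gen
  · have hx0 : x ≠ 0 := by
      rintro rfl
      have := h.transc Polynomial.X (by simp)
      exact Polynomial.X_ne_zero this
    have hrev : ∀ (p : m[X]) (n : ℕ), p.natDegree ≤ n →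
        (Polynomial.reflect n p).eval₂ ι x⁻¹ = p.eval₂ ι x * x⁻¹ ^ n := by
      intro p n hn
      let _ : Invertible x := invertibleOfNonzero hx0
      have := Polynomial.eval₂_reflect_mul_pow ι x n p hn
      rw [invOf_eq_inv] at this
      rw [← this, inv_pow, mul_inv_cancel_right₀ (pow_ne_zero _ hx0)]
    refine key x⁻¹ hx (fun p hp => ?_) (fun w => ?_)
    · have h1 := hrev (Polynomial.reflect p.natDegree p) p.natDegree
        (by
          refine (Polynomial.natDegree_le_iff_coeff_eq_zero).2 fun N hN => ?_
          rw [Polynomial.coeff_reflect, Polynomial.revAt_eq_self_of_lt hN]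
          exact Polynomial.coeff_eq_zero_of_natDegree_lt hN)
      rw [Polynomial.reflect_reflect, hp] at h1
      have := h.transc _ ((mul_eq_zero.1 h1.symm).resolve_right (pow_ne_zero _ (inv_ne_zero hx0)))
      rwa [Polynomial.reflect_eq_zero_iff] at this
    · obtain ⟨p, q, r, hr, hw⟩ := h.gen w
      let n := max p.natDegree (max q.natDegree r.natDegree)
      refine ⟨Polynomial.reflect n p, Polynomial.reflect n q, Polynomial.reflect n r, ?_, ?_⟩
      · rwa [Ne, Polynomial.reflect_eq_zero_iff]
      · rw [hrev p n (by simp [n]), hrev q n (by simp [n]), hrev r n (by simp [n])]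
        linear_combination hw * x⁻¹ ^ n

/-- Infinitely many primes divide values of a nonconstant integer polynomial. -/
theorem Polynomial.exists_prime_dvd_eval (f : ℤ[X]) (hf : 0 < f.natDegree) {M : ℤ} (hM : M ≠ 0) :
    ∃ ℓ : ℕ, ℓ.Prime ∧ ¬ (ℓ : ℤ) ∣ M ∧ ∃ n : ℤ, (ℓ : ℤ) ∣ f.eval n := by
  rcases eq_or_ne (f.eval 0) 0 with h0 | h0
  · obtain ⟨ℓ, hℓ, hp⟩ := Nat.exists_infinite_primes (M.natAbs + 1)
    refine ⟨ℓ, hp, fun h => ?_, 0, by rw [h0]; exact dvd_zero _⟩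
    have := Nat.le_of_dvd (Int.natAbs_pos.2 hM) (Int.natCast_dvd.1 h)
    omega
  · have hg : ∀ t : ℤ, ∃ s, f.eval (f.eval 0 * M * t) = f.eval 0 * (1 + M * s) := by
      intro t
      obtain ⟨s, hs⟩ := Polynomial.sub_dvd_eval_sub (f.eval 0 * M * t) 0 f
      exact ⟨t * s, by linear_combination hs⟩
    choose s hs using hg
    have hinj : Function.Injective fun t : ℤ => f.eval 0 * M * t :=
      mul_right_injective₀ (mul_ne_zero h0 hM)
    obtain ⟨t, ht⟩ : ∃ t, (1 + M * s t).natAbs ≠ 1 := by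
      by_contra! hcon
      have hcov : Set.univ ⊆ {t : ℤ | f.eval (f.eval 0 * M * t) = f.eval 0} ∪
          {t : ℤ | f.eval (f.eval 0 * M * t) = -f.eval 0} := by
        intro t _
        rcases Int.natAbs_eq (1 + M * s t) with h | h
        · left
          change f.eval (f.eval 0 * M * t) = f.eval 0
          rw [hs, h, hcon]
          simp
        · right
          change f.eval (f.eval 0 * M * t) = -f.eval 0
          rw [hs, h, hcon]
          simp
      have hconst : ∀ c : ℤ, {t : ℤ | f.eval (f.eval 0 * M * t) = c}.Infinite → False := by
        intro c hc
        have hc' : {x : ℤ | f.eval x = (Polynomial.C c).eval x}.Infinite := by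
          refine (hc.image hinj.injOn).mono ?_
          rintro _ ⟨t, ht, rfl⟩
          simpa using ht
        have := Polynomial.eq_of_infinite_eval_eq _ _ hc'
        rw [this] at hf
        simp at hf
      rcases Set.infinite_union.1 (Set.infinite_univ.mono hcov) with h | h
      · exact hconst _ h
      · exact hconst _ h
    obtain ⟨ℓ, hp, hd⟩ := Nat.exists_prime_and_dvd ht
    refine ⟨ℓ, hp, fun h => ?_, f.eval 0 * M * t, ?_⟩
    · have h1 := (Int.natCast_dvd.2 hd)
      have h2 := (dvd_add_left (h.mul_right (s t))).1 h1
      exact hp.one_lt.ne' (by simpa using Int.natAbs_dvd_natAbs.2 h2)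
    · rw [hs]
      exact (Int.natCast_dvd.2 hd).mul_left _

/-- A number field embeds into infinitely many of the fields of `ℓ`-adic numbers. -/
theorem NumberField.exists_padic_embedding (k : Type*) [Field k] [NumberField k] {M : ℤ}
    (hM : M ≠ 0) :
    ∃ (ℓ : ℕ) (_ : Fact ℓ.Prime), ¬ (ℓ : ℤ) ∣ M ∧ Nonempty (k →+* ℚ_[ℓ]) := by
  let pb := Field.powerBasisOfFiniteOfSeparable ℚ k
  have hirr : Irreducible (minpoly ℚ pb.gen) :=
    minpoly.irreducible (Algebra.IsIntegral.isIntegral _)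
  obtain ⟨u, v, huv⟩ : IsCoprime (minpoly ℚ pb.gen) (Polynomial.derivative (minpoly ℚ pb.gen)) :=
    hirr.separable
  have hmemZ : ∀ g : ℚ[X], ∃ (N : ℤ) (G : ℤ[X]), N ≠ 0 ∧ G.map (algebraMap ℤ ℚ) = N • g := by
    intro g
    obtain ⟨N, hN, h⟩ := IsLocalization.integerNormalization_spec (nonZeroDivisors ℤ) g
    exact ⟨N, _, nonZeroDivisors.ne_zero hN, h⟩
  obtain ⟨N₁, f, hN₁, hf⟩ := hmemZ (minpoly ℚ pb.gen)
  obtain ⟨N₂, U, hN₂, hU⟩ := hmemZ u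
  obtain ⟨N₃, V, hN₃, hV⟩ := hmemZ v
  have hbez : N₃ • (U * f) + N₂ • (V * Polynomial.derivative f) = Polynomial.C (N₁ * N₂ * N₃) := by
    apply Polynomial.map_injective (algebraMap ℤ ℚ) (algebraMap ℤ ℚ).injective_int
    rw [Polynomial.map_add, zsmul_eq_mul, zsmul_eq_mul, Polynomial.map_mul, Polynomial.map_mul,
      Polynomial.map_mul, Polynomial.map_mul, ← Polynomial.derivative_map, hf, hU, hV,
      Polynomial.derivative_smul, Polynomial.map_intCast, Polynomial.map_intCast, Polynomial.map_C]
    simp only [zsmul_eq_mul, algebraMap_int_eq, eq_intCast, Int.cast_mul, Polynomial.C_mul,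
      map_intCast]
    linear_combination (N₁ * N₂ * N₃ : ℚ[X]) * huv
  have hdeg : 0 < f.natDegree := by
    have h1 : f.natDegree = (f.map (algebraMap ℤ ℚ)).natDegree :=
      (Polynomial.natDegree_map_eq_of_injective (algebraMap ℤ ℚ).injective_int f).symm
    rw [h1, hf, ← Int.cast_smul_eq_zsmul ℚ, Polynomial.natDegree_smul _ (by exact_mod_cast hN₁)]
    exact hirr.natDegree_pos
  obtain ⟨ℓ, hp, hd, n, hn⟩ := f.exists_prime_dvd_eval hdeg
    (mul_ne_zero hM (mul_ne_zero (mul_ne_zero hN₁ hN₂) hN₃))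
  have hF : Fact ℓ.Prime := ⟨hp⟩
  refine ⟨ℓ, hF, fun h => hd (h.mul_right _), ?_⟩
  have hder : ¬ (ℓ : ℤ) ∣ (Polynomial.derivative f).eval n := by
    intro h
    apply hd
    have h1 := congrArg (Polynomial.eval n) hbez
    simp only [zsmul_eq_mul, Polynomial.eval_add, Polynomial.eval_mul, Polynomial.eval_intCast,
      Polynomial.eval_C] at h1
    refine Dvd.dvd.mul_left ?_ M
    rw [← h1]
    exact dvd_add ((hn.mul_left _).mul_left _) ((h.mul_left _).mul_left _)
  have heval : ∀ g : ℤ[X], Polynomial.aeval (n : ℤ_[ℓ]) g = ((g.eval n : ℤ) : ℤ_[ℓ]) := by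
    intro g
    rw [← eq_intCast (algebraMap ℤ ℤ_[ℓ]) n, Polynomial.aeval_algebraMap_apply]
    simp
  have hone : ‖Polynomial.aeval (n : ℤ_[ℓ]) (Polynomial.derivative f)‖ = 1 := by
    rw [heval]
    refine le_antisymm (PadicInt.norm_le_one _) (not_lt.1 fun h => hder ?_)
    exact (PadicInt.norm_int_lt_one_iff_dvd _).1 h
  obtain ⟨z, hz, -⟩ := hensels_lemma (F := f) (a := (n : ℤ_[ℓ])) (by
    rw [hone, one_pow, heval]
    exact (PadicInt.norm_int_lt_one_iff_dvd _).2 hn)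
  have hz' : Polynomial.aeval (z : ℚ_[ℓ]) (minpoly ℚ pb.gen) = 0 := by
    have h1 : Polynomial.aeval (z : ℚ_[ℓ]) f = 0 := by
      have : (z : ℚ_[ℓ]) = algebraMap ℤ_[ℓ] ℚ_[ℓ] z := rfl
      rw [this, Polynomial.aeval_algebraMap_apply, hz, map_zero]
    rw [← Polynomial.aeval_map_algebraMap ℚ, hf, map_zsmul, zsmul_eq_mul] at h1
    exact (mul_eq_zero.1 h1).resolve_left (by exact_mod_cast hN₁)
  exact ⟨(pb.lift _ hz').toRingHom⟩

/-- Elements of a number field are integral at almost all primes. -/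
theorem NumberField.exists_norm_le_one {k : Type*} [Field k] [NumberField k] (S : Finset k) :
    ∃ M : ℤ, M ≠ 0 ∧ ∀ (ℓ : ℕ) [Fact ℓ.Prime], ¬ (ℓ : ℤ) ∣ M →
      ∀ (φ : k →+* ℚ_[ℓ]), ∀ c ∈ S, ‖φ c‖ ≤ 1 := by
  obtain ⟨M, hM, hmemZ⟩ := exists_integral_multiples ℤ ℚ S
  refine ⟨M, hM, fun ℓ hℓ hd φ c hc => ?_⟩
  have h1 : ‖φ (M • c)‖ ≤ 1 := by
    have h2 : IsIntegral ℤ (φ (M • c)) := map_isIntegral_int φ (hmemZ c hc)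
    have h3 : IsIntegral ℤ_[ℓ] (φ (M • c)) := IsIntegral.tower_top h2
    obtain ⟨z, hz⟩ := (IsIntegrallyClosed.isIntegral_iff (R := ℤ_[ℓ]) (K := ℚ_[ℓ])).1 h3
    rw [← hz]
    exact z.2
  have h2 : ‖((M : ℤ) : ℚ_[ℓ])‖ = 1 :=
    le_antisymm (Padic.norm_int_le_one _) (not_lt.1 fun h => hd (Padic.norm_intCast_lt_one_iff.1 h))
  rwa [map_zsmul, zsmul_eq_mul, norm_mul, h2, one_mul] at h1

/-- The elements divisible by `p ^ n` in the localization at the kernel of `r`. -/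
def resBall {A κ : Type*} (E : Type*) [CommRing A] [Field κ] [Field E] [Algebra A E]
    (p : A) (r : A →+* κ) (n : ℕ) : Set E :=
  {z | ∃ a b : A, r b ≠ 0 ∧ z * algebraMap A E b = algebraMap A E p ^ n * algebraMap A E a}

namespace Reduction

variable {A κ E : Type*} [CommRing A] [IsDomain A] [Field κ] [Field E] [Algebra A E]
  [IsFractionRing A E] {p : A} {r : A →+* κ}

theorem add_mem_resBall {n : ℕ} {y z : E} (hy : y ∈ resBall E p r n) (hz : z ∈ resBall E p r n) :
    y + z ∈ resBall E p r n := by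
  obtain ⟨a, b, hb, h⟩ := hy
  obtain ⟨c, d, hd, h'⟩ := hz
  refine ⟨a * d + c * b, b * d, by simp [hb, hd], ?_⟩
  simp only [map_mul, map_add]
  linear_combination algebraMap A E d * h + algebraMap A E b * h'

theorem mul_mem_resBall {n m : ℕ} {y z : E} (hy : y ∈ resBall E p r n)
    (hz : z ∈ resBall E p r m) : y * z ∈ resBall E p r (n + m) := by
  obtain ⟨a, b, hb, h⟩ := hy
  obtain ⟨c, d, hd, h'⟩ := hz
  refine ⟨a * c, b * d, by simp [hb, hd], ?_⟩
  simp only [map_mul, pow_add]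
  linear_combination z * algebraMap A E d * h + algebraMap A E p ^ n * algebraMap A E a * h'

theorem pow_mem_resBall (n : ℕ) : algebraMap A E p ^ n ∈ resBall E p r n :=
  ⟨1, 1, by simp, by simp⟩

theorem zero_mem_resBall (n : ℕ) : (0 : E) ∈ resBall E p r n := ⟨0, 1, by simp, by simp⟩

theorem neg_mem_resBall {n : ℕ} {y : E} (hy : y ∈ resBall E p r n) : -y ∈ resBall E p r n := by
  obtain ⟨a, b, hb, h⟩ := hy
  refine ⟨-a, b, hb, ?_⟩
  rw [map_neg]
  linear_combination -h

theorem mul_mem_resBall_zero {n : ℕ} {y z : E} (hy : y ∈ resBall E p r 0)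
    (hz : z ∈ resBall E p r n) : y * z ∈ resBall E p r n := by
  simpa using mul_mem_resBall hy hz

theorem resBall_anti {n m : ℕ} (h : n ≤ m) : resBall E p r m ⊆ resBall E p r n := by
  rintro z ⟨a, b, hb, hz⟩
  obtain ⟨d, rfl⟩ := Nat.exists_eq_add_of_le h
  refine ⟨p ^ d * a, b, hb, ?_⟩
  rw [hz, map_mul, map_pow]
  ring

theorem exists_pow_mul_mem_resBall (h : Reduction p r) (z : E) :
    ∃ N, algebraMap A E p ^ N * z ∈ resBall E p r 0 := by
  obtain ⟨a, b, hb, rfl⟩ := IsFractionRing.div_surjective (A := A) z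
  obtain ⟨n, c, rfl, hc⟩ := h.fin' (nonZeroDivisors.ne_zero hb)
  have e2 := algebraMap_ne_zero' (E := E) (ne_zero_of_map hc)
  have e0 := algebraMap_ne_zero' (E := E) h.ne_zero
  refine ⟨n, a, c, hc, ?_⟩
  simp only [map_mul, map_pow]
  field_simp

theorem mem_resBall_of_pow_mul (h : Reduction p r) {N n : ℕ} {z : E}
    (hz : algebraMap A E p ^ N * z ∈ resBall E p r (N + n)) : z ∈ resBall E p r n := by
  obtain ⟨a, b, hb, hab⟩ := hz
  refine ⟨a, b, hb, ?_⟩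
  apply mul_left_cancel₀ (pow_ne_zero N (algebraMap_ne_zero' (E := E) h.ne_zero))
  linear_combination hab

theorem mul_mem_resBall_of_pow_mul (h : Reduction p r) {N n : ℕ} {y z : E}
    (hy : algebraMap A E p ^ N * y ∈ resBall E p r 0) (hz : z ∈ resBall E p r (N + n)) :
    y * z ∈ resBall E p r n := by
  apply h.mem_resBall_of_pow_mul (N := N)
  rw [← mul_assoc]
  exact mul_mem_resBall_zero hy hz

theorem one_add_of_mem_resBall (h : Reduction p r) {μ : E} (hμ : μ ∈ resBall E p r 1) :
    1 + μ ∈ resSq E r ∧ (1 + μ)⁻¹ ∈ resBall E p r 0 := by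
  obtain ⟨a, b, hb, hab⟩ := hμ
  have e1 := algebraMap_ne_zero' (E := E) (ne_zero_of_map hb)
  have hr : r (b + p * a) ≠ 0 := by simp [h.map_self, hb]
  have e2 := algebraMap_ne_zero' (E := E) (ne_zero_of_map hr)
  have e3 : 1 + μ = algebraMap A E (b + p * a) / algebraMap A E b := by
    rw [eq_div_iff e1, map_add, map_mul]
    linear_combination hab
  refine ⟨⟨(b + p * a) * b, 1 / algebraMap A E b, ?_, ?_, by simp [e1], ?_⟩, b, b + p * a, hr, ?_⟩
  · rw [map_mul]
    exact mul_ne_zero hr hb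
  · simp [h.map_self]
  · rw [e3, map_mul]
    field_simp
  · rw [e3]
    field_simp

theorem pow_odd_mul_notMem_unitSq (h : Reduction p r) {c b : A} (hc : r c ≠ 0) (hb : r b ≠ 0)
    {n : ℕ} (hn : Odd n) : algebraMap A E p ^ n * (algebraMap A E c / algebraMap A E b) ∉
      unitSq E r := by
  obtain ⟨k, rfl⟩ := hn
  intro hm
  have hG := isSqGroup_unitSq (E := E) (r := r)
  have e0 := algebraMap_ne_zero' (E := E) h.ne_zero
  have h1 : algebraMap A E c / algebraMap A E b ∈ unitSq E r := by
    rw [div_eq_mul_inv]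
    exact hG.mul_mem (mem_unitSq hc) (hG.inv_mem (mem_unitSq hb))
  have h2 := hG.of_mul_right h1 hm
  rw [pow_succ', mul_comm 2 k, pow_mul] at h2
  exact h.self_notMem_unitSq (hG.of_mul_sq_mem h2)

/-- A small element either has odd order or is `p` times a small element of odd order. -/
theorem odd_or_of_mem_resBall (h : Reduction p r) {μ : E} (hμ : μ ∈ resBall E p r 1)
    (h0 : μ ≠ 0) :
    (μ ∉ unitSq E r ∧ 1 + μ⁻¹ ∉ unitSq E r) ∨
      ∃ ν ∈ resBall E p r 1, μ = algebraMap A E p * ν ∧ ν ∉ unitSq E r := by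
  obtain ⟨a, b, hb, hab⟩ := id hμ
  have e1 := algebraMap_ne_zero' (E := E) (ne_zero_of_map hb)
  have ha : a ≠ 0 := by
    rintro rfl
    rw [map_zero, mul_zero] at hab
    rcases mul_eq_zero.1 hab with h | h
    · exact h0 h
    · exact e1 h
  obtain ⟨n, c, rfl, hc⟩ := h.fin' ha
  have e3 : μ = algebraMap A E p ^ (n + 1) * (algebraMap A E c / algebraMap A E b) := by
    rw [← mul_div_assoc, eq_div_iff e1, hab, map_mul, map_pow]
    ring
  rcases Nat.even_or_odd n with hn | hn
  · have hodd := h.pow_odd_mul_notMem_unitSq (E := E) hc hb hn.add_one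
    rw [← e3] at hodd
    refine .inl ⟨hodd, fun hm => hodd ?_⟩
    have hG := isSqGroup_unitSq (E := E) (r := r)
    have h1 := resSq_subset_unitSq (h.one_add_of_mem_resBall hμ).1
    have h2 : (1 + μ⁻¹) * μ = 1 + μ := by field_simp; ring
    rw [← h2] at h1
    exact hG.of_mul_left hm h1
  · refine .inr ⟨algebraMap A E p ^ n * (algebraMap A E c / algebraMap A E b), ?_, ?_,
      h.pow_odd_mul_notMem_unitSq hc hb hn⟩
    · refine resBall_anti hn.pos ⟨c, b, hb, ?_⟩
      field_simp
    · rw [e3]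
      ring

/-- The closure of a subfield for the topology defined by a reduction. -/
def approxSubfield (h : Reduction p r) {K : Type*} [Field K] (Φ : K →+* E) : Subfield E where
  carrier := {y | ∀ n, ∃ x : K, y - Φ x ∈ resBall E p r n}
  zero_mem' n := ⟨0, by simpa using zero_mem_resBall n⟩
  one_mem' n := ⟨1, by simpa using zero_mem_resBall n⟩
  add_mem' := by
    intro y z hy hz n
    obtain ⟨x, hx⟩ := hy n
    obtain ⟨w, hw⟩ := hz n
    refine ⟨x + w, ?_⟩
    rw [map_add, add_sub_add_comm]
    exact add_mem_resBall hx hw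
  neg_mem' := by
    intro y hy n
    obtain ⟨x, hx⟩ := hy n
    refine ⟨-x, ?_⟩
    rw [map_neg, ← neg_sub']
    exact neg_mem_resBall hx
  mul_mem' := by
    intro y z hy hz n
    obtain ⟨N, hN⟩ := h.exists_pow_mul_mem_resBall y
    obtain ⟨w, hw⟩ := hz (N + n)
    obtain ⟨M, hM⟩ := h.exists_pow_mul_mem_resBall (Φ w)
    obtain ⟨x, hx⟩ := hy (M + n)
    refine ⟨x * w, ?_⟩
    rw [map_mul, show y * z - Φ x * Φ w = y * (z - Φ w) + Φ w * (y - Φ x) by ring]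
    exact add_mem_resBall (h.mul_mem_resBall_of_pow_mul hN hw) (h.mul_mem_resBall_of_pow_mul hM hx)
  inv_mem' := by
    intro y hy n
    rcases eq_or_ne y 0 with rfl | h0
    · exact ⟨0, by simpa using zero_mem_resBall n⟩
    obtain ⟨N, hN⟩ := h.exists_pow_mul_mem_resBall y⁻¹
    obtain ⟨x, hx⟩ := hy (N + (N + n + 1))
    have hμ := h.mul_mem_resBall_of_pow_mul hN (neg_mem_resBall hx)
    have hμ1 := h.one_add_of_mem_resBall (resBall_anti (by omega) hμ)
    have hx' : Φ x = y * (1 + y⁻¹ * -(y - Φ x)) := by field_simp; ring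
    have hne := isSqGroup_resSq.ne_zero hμ1.1
    refine ⟨x⁻¹, ?_⟩
    have h2 : y⁻¹ - Φ x⁻¹ = y⁻¹ * ((1 + y⁻¹ * -(y - Φ x))⁻¹ * (y⁻¹ * -(y - Φ x))) := by
      rw [map_inv₀]
      generalize y⁻¹ * -(y - Φ x) = μ at *
      rw [hx']
      field_simp
      ring
    rw [h2]
    refine h.mul_mem_resBall_of_pow_mul hN (mul_mem_resBall_zero hμ1.2 (resBall_anti ?_ hμ))
    omega

theorem exists_eq_mul_one_add (h : Reduction p r) {K : Type*} [Field K] {Φ : K →+* E} {y : E}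
    (hy : y ∈ h.approxSubfield Φ) (h0 : y ≠ 0) :
    ∃ x : K, ∃ μ ∈ resBall E p r 1, Φ x = y * (1 + μ) := by
  obtain ⟨N, hN⟩ := h.exists_pow_mul_mem_resBall y⁻¹
  obtain ⟨x, hx⟩ := hy (N + 1)
  refine ⟨x, _, h.mul_mem_resBall_of_pow_mul hN (neg_mem_resBall hx), ?_⟩
  field_simp
  ring

end Reduction

theorem Polynomial.isUnit_of_isSquare_algebraMap {F : Type*} [Field F] {f : F[X]}
    (hf : Squarefree f) (h : IsSquare (algebraMap F[X] (RatFunc F) f)) : IsUnit f := by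
  obtain ⟨s, hs⟩ := h
  obtain ⟨g, rfl⟩ := IsIntegrallyClosed.exists_algebraMap_eq_of_isIntegral_pow (R := F[X])
    (x := s) (n := 2) (by norm_num) (by rw [pow_two, ← hs]; exact isIntegral_algebraMap)
  rw [← map_mul] at hs
  have h1 := IsFractionRing.injective F[X] (RatFunc F) hs
  have h2 : IsUnit g := hf g (h1 ▸ dvd_rfl)
  rw [h1]
  exact h2.mul h2

theorem Polynomial.exists_squarefree {F : Type*} [Field F] (P : F[X]) (hP : P ≠ 0) :
    ∃ (c : F) (f g : F[X]), c ≠ 0 ∧ f.Monic ∧ Squarefree f ∧ g ≠ 0 ∧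
      P = Polynomial.C c * f * g ^ 2 := by
  induction hn : P.natDegree using Nat.strong_induction_on generalizing P with
  | _ n ih =>
    subst hn
    by_cases hsq : Squarefree P
    · have hl : P.leadingCoeff ≠ 0 := Polynomial.leadingCoeff_ne_zero.2 hP
      refine ⟨P.leadingCoeff, P * Polynomial.C P.leadingCoeff⁻¹, 1, hl,
        Polynomial.monic_mul_leadingCoeff_inv hP, ?_, one_ne_zero, ?_⟩
      · have : IsUnit (Polynomial.C P.leadingCoeff⁻¹) :=
          Polynomial.isUnit_C.2 (inv_ne_zero hl).isUnit
        exact hsq.squarefree_of_dvd (this.mul_right_dvd.2 dvd_rfl)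
      · rw [one_pow, mul_one, mul_left_comm, ← Polynomial.C_mul, mul_inv_cancel₀ hl]
        simp
    · simp only [Squarefree, not_forall] at hsq
      obtain ⟨q, ⟨Q, rfl⟩, hq⟩ := hsq
      have hQ : Q ≠ 0 := right_ne_zero_of_mul hP
      have hq0 : q ≠ 0 := left_ne_zero_of_mul (left_ne_zero_of_mul hP)
      have hdeg : 0 < q.natDegree := by
        by_contra h0
        have h1 : q.natDegree = 0 := by omega
        rw [Polynomial.eq_C_of_natDegree_eq_zero h1] at hq hq0
        exact hq (Polynomial.isUnit_C.2 (by simpa using hq0))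
      obtain ⟨c, f, g, hc, hf, hf', hg, h⟩ := ih Q.natDegree (by
        rw [Polynomial.natDegree_mul (mul_ne_zero hq0 hq0) hQ, Polynomial.natDegree_mul hq0 hq0]
        omega) Q hQ rfl
      exact ⟨c, f, g * q, hc, hf, hf', mul_ne_zero hg hq0, by rw [h]; ring⟩

theorem RatFunc.exists_squarefree {F : Type*} [Field F] (z : RatFunc F) (hz : z ≠ 0) :
    ∃ (c : F) (f : F[X]) (g : RatFunc F), c ≠ 0 ∧ f.Monic ∧ Squarefree f ∧ g ≠ 0 ∧
      z = RatFunc.C c * algebraMap F[X] (RatFunc F) f * g ^ 2 := by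
  obtain ⟨p, q, hq, rfl⟩ := IsFractionRing.div_surjective (A := F[X]) z
  have hq0 : algebraMap F[X] (RatFunc F) q ≠ 0 := by simpa using nonZeroDivisors.ne_zero hq
  have hp : p ≠ 0 := by
    rintro rfl
    simp at hz
  obtain ⟨c, f, g, hc, hf, hf', hg, h⟩ := (p * q).exists_squarefree
    (mul_ne_zero hp (nonZeroDivisors.ne_zero hq))
  refine ⟨c, f, algebraMap _ _ g / algebraMap _ _ q, hc, hf, hf',
    div_ne_zero (by simpa using hg) hq0, ?_⟩
  have h1 := congrArg (algebraMap F[X] (RatFunc F)) h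
  simp only [map_mul, map_pow, RatFunc.algebraMap_C] at h1
  field_simp
  linear_combination h1

section Gauss

variable (ℓ : ℕ) [Fact ℓ.Prime]

/-- Reduction of `ℓ`-adic polynomials modulo `ℓ`. -/
noncomputable def gaussMap : ℤ_[ℓ][X] →+* RatFunc (ZMod ℓ) :=
  (algebraMap (ZMod ℓ)[X] (RatFunc (ZMod ℓ))).comp (Polynomial.mapRingHom PadicInt.toZMod)

theorem gaussMap_apply (a : ℤ_[ℓ][X]) : gaussMap ℓ a =
    algebraMap (ZMod ℓ)[X] (RatFunc (ZMod ℓ)) (a.map PadicInt.toZMod) := rfl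

theorem PadicInt.toZMod_eq_zero_iff_dvd (x : ℤ_[ℓ]) :
    PadicInt.toZMod x = 0 ↔ (ℓ : ℤ_[ℓ]) ∣ x := by
  rw [← RingHom.mem_ker, PadicInt.ker_toZMod, PadicInt.maximalIdeal_eq_span_p,
    Ideal.mem_span_singleton]

theorem gaussMap_eq_zero_iff (a : ℤ_[ℓ][X]) :
    gaussMap ℓ a = 0 ↔ Polynomial.C (ℓ : ℤ_[ℓ]) ∣ a := by
  rw [gaussMap_apply, Polynomial.C_dvd_iff_dvd_coeff, FaithfulSMul.algebraMap_eq_zero_iff,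
    Polynomial.ext_iff]
  simp only [Polynomial.coeff_map, Polynomial.coeff_zero, PadicInt.toZMod_eq_zero_iff_dvd]

theorem gaussReduction : Reduction (Polynomial.C (ℓ : ℤ_[ℓ])) (gaussMap ℓ) where
  ne_zero := by
    rw [Polynomial.C_ne_zero]
    exact_mod_cast (Fact.out : ℓ.Prime).ne_zero
  ker := gaussMap_eq_zero_iff ℓ
  fin a ha := by
    have hirr : Irreducible (Polynomial.C (ℓ : ℤ_[ℓ])) :=
      (Polynomial.prime_C_iff.2 PadicInt.prime_p).irreducible
    obtain ⟨n, b, hb, h⟩ := WfDvdMonoid.max_power_factor ha hirr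
    exact ⟨n, b, h, hb⟩

theorem gaussMap_frac (s : RatFunc (ZMod ℓ)) :
    ∃ b c, gaussMap ℓ c ≠ 0 ∧ s * gaussMap ℓ c = gaussMap ℓ b := by
  obtain ⟨p, q, hq, rfl⟩ := IsFractionRing.div_surjective (A := (ZMod ℓ)[X]) s
  have hq0 : algebraMap (ZMod ℓ)[X] (RatFunc (ZMod ℓ)) q ≠ 0 := by
    simpa using nonZeroDivisors.ne_zero hq
  have hs := Polynomial.map_surjective (PadicInt.toZMod (p := ℓ)) (ZMod.ringHom_surjective _)
  obtain ⟨b, rfl⟩ := hs p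
  obtain ⟨c, rfl⟩ := hs q
  exact ⟨b, c, hq0, div_mul_cancel₀ _ hq0⟩

/-- The embedding of the `ℓ`-adic numbers in the rational functions. -/
noncomputable def padicToRatFunc : ℚ_[ℓ] →+* RatFunc ℤ_[ℓ] :=
  IsFractionRing.lift (A := ℤ_[ℓ])
    (g := (algebraMap ℤ_[ℓ][X] (RatFunc ℤ_[ℓ])).comp Polynomial.C)
    ((IsFractionRing.injective ℤ_[ℓ][X] (RatFunc ℤ_[ℓ])).comp Polynomial.C_injective)

theorem padicToRatFunc_coe (x : ℤ_[ℓ]) : padicToRatFunc ℓ (x : ℚ_[ℓ]) =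
    algebraMap ℤ_[ℓ][X] (RatFunc ℤ_[ℓ]) (Polynomial.C x) :=
  IsFractionRing.lift_algebraMap (K := ℚ_[ℓ]) _ x

variable {ℓ} {k : Type*} [Field k] (φ : k →+* ℚ_[ℓ])

theorem gaussEmb_aux (p : k[X]) :
    p.eval₂ ((padicToRatFunc ℓ).comp φ) (algebraMap ℤ_[ℓ][X] _ Polynomial.X) = 0 → p = 0 := by
  intro h
  let _ : Algebra ℤ_[ℓ] (RatFunc ℤ_[ℓ]) := ((algebraMap ℤ_[ℓ][X] (RatFunc ℤ_[ℓ])).comp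
    Polynomial.C).toAlgebra
  obtain ⟨b, hb, hG⟩ := IsLocalization.integerNormalization_spec (nonZeroDivisors ℤ_[ℓ]) (p.map φ)
  generalize IsLocalization.integerNormalization (nonZeroDivisors ℤ_[ℓ]) (p.map φ) = G at hG
  have h1 : (p.map φ).eval₂ (padicToRatFunc ℓ) (algebraMap ℤ_[ℓ][X] _ Polynomial.X) = 0 := by
    rw [Polynomial.eval₂_map, h]
  have h2 : (G.map (algebraMap ℤ_[ℓ] ℚ_[ℓ])).eval₂ (padicToRatFunc ℓ)
      (algebraMap ℤ_[ℓ][X] _ Polynomial.X) = algebraMap ℤ_[ℓ][X] (RatFunc ℤ_[ℓ]) G := by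
    rw [Polynomial.eval₂_map, show (padicToRatFunc ℓ).comp (algebraMap ℤ_[ℓ] ℚ_[ℓ]) =
      (algebraMap ℤ_[ℓ][X] (RatFunc ℤ_[ℓ])).comp Polynomial.C from
      RingHom.ext (padicToRatFunc_coe ℓ), ← Polynomial.hom_eval₂]
    congr 1
    exact Polynomial.eval₂_C_X
  rw [← algebraMap_smul ℚ_[ℓ] b, Polynomial.smul_eq_C_mul] at hG
  rw [hG, Polynomial.eval₂_mul, h1, mul_zero] at h2
  have h3 : G = 0 := by
    apply IsFractionRing.injective ℤ_[ℓ][X] (RatFunc ℤ_[ℓ])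
    rw [← h2, map_zero]
  rw [h3, Polynomial.map_zero] at hG
  have hb0 : algebraMap ℤ_[ℓ] ℚ_[ℓ] b ≠ 0 := by
    simpa using nonZeroDivisors.ne_zero hb
  rcases mul_eq_zero.1 hG.symm with h4 | h4
  · exact absurd (Polynomial.C_eq_zero.1 h4) hb0
  · exact (Polynomial.map_eq_zero φ).1 h4

/-- The embedding of rational functions defined by an embedding of constants. -/
noncomputable def gaussEmb : RatFunc k →+* RatFunc ℤ_[ℓ] :=
  IsFractionRing.lift (A := k[X])
    (g := Polynomial.eval₂RingHom ((padicToRatFunc ℓ).comp φ) (algebraMap ℤ_[ℓ][X] _ Polynomial.X))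
    ((injective_iff_map_eq_zero _).2 (gaussEmb_aux φ))

theorem gaussEmb_algebraMap (p : k[X]) : gaussEmb φ (algebraMap k[X] (RatFunc k) p) =
    p.eval₂ ((padicToRatFunc ℓ).comp φ) (algebraMap ℤ_[ℓ][X] _ Polynomial.X) :=
  IsFractionRing.lift_algebraMap (K := RatFunc k) _ p

theorem gaussEmb_C (c : k) : gaussEmb φ (RatFunc.C c) = padicToRatFunc ℓ (φ c) := by
  rw [← RatFunc.algebraMap_C, gaussEmb_algebraMap, Polynomial.eval₂_C, RingHom.comp_apply]

theorem gaussEmb_X : gaussEmb φ RatFunc.X = algebraMap ℤ_[ℓ][X] _ Polynomial.X := by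
  rw [← RatFunc.algebraMap_X, gaussEmb_algebraMap, Polynomial.eval₂_X]

theorem gaussEmb_of_lift {p : k[X]} {P : ℤ_[ℓ][X]} (h : P.map (algebraMap ℤ_[ℓ] ℚ_[ℓ]) = p.map φ) :
    gaussEmb φ (algebraMap k[X] (RatFunc k) p) = algebraMap ℤ_[ℓ][X] _ P := by
  rw [gaussEmb_algebraMap, ← Polynomial.eval₂_map, ← h, Polynomial.eval₂_map,
    show (padicToRatFunc ℓ).comp (algebraMap ℤ_[ℓ] ℚ_[ℓ]) =
      (algebraMap ℤ_[ℓ][X] (RatFunc ℤ_[ℓ])).comp Polynomial.C from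
      RingHom.ext (padicToRatFunc_coe ℓ), ← Polynomial.hom_eval₂]
  congr 1
  exact Polynomial.eval₂_C_X

theorem mem_approxSubfield_gaussEmb {K : Type*} [Field K] (j : K →+* RatFunc k) (α : k)
    (hgen : ∀ z, ∃ u v, z = j u + RatFunc.C α * j v) (y : RatFunc ℤ_[ℓ]) :
    y ∈ (gaussReduction ℓ).approxSubfield (E := RatFunc ℤ_[ℓ]) ((gaussEmb φ).comp j) := by
  set Z := (gaussReduction ℓ).approxSubfield (E := RatFunc ℤ_[ℓ]) ((gaussEmb φ).comp j) with hZ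
  have hmemZ : ∀ x : ℤ_[ℓ], padicToRatFunc ℓ x ∈ Z := by
    intro x n
    refine ⟨(x.appr n : K), ?_⟩
    obtain ⟨d, hd⟩ := Ideal.mem_span_singleton.1 (PadicInt.appr_spec n x)
    refine ⟨Polynomial.C d, 1, by simp, ?_⟩
    rw [map_natCast, padicToRatFunc_coe, ← map_natCast (algebraMap ℤ_[ℓ][X] (RatFunc ℤ_[ℓ])),
      ← map_natCast Polynomial.C, ← map_sub, ← map_sub, hd]
    simp
  have hpadic : ∀ x : ℚ_[ℓ], padicToRatFunc ℓ x ∈ Z := by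
    intro x
    obtain ⟨a, b, hb, rfl⟩ := IsFractionRing.div_surjective (A := ℤ_[ℓ]) x
    rw [map_div₀]
    exact Z.div_mem (hmemZ a) (hmemZ b)
  have hj : ∀ u : K, gaussEmb φ (j u) ∈ Z := by
    intro u n
    exact ⟨u, by simpa using Reduction.zero_mem_resBall n⟩
  have hX : algebraMap ℤ_[ℓ][X] (RatFunc ℤ_[ℓ]) Polynomial.X ∈ Z := by
    obtain ⟨u, v, h⟩ := hgen RatFunc.X
    rw [← gaussEmb_X φ, h, map_add, map_mul, gaussEmb_C]
    exact Z.add_mem (hj u) (Z.mul_mem (hpadic _) (hj v))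
  have hpoly : ∀ p : ℤ_[ℓ][X], algebraMap ℤ_[ℓ][X] (RatFunc ℤ_[ℓ]) p ∈ Z := by
    intro p
    rw [← Polynomial.eval₂_C_X (p := p), Polynomial.hom_eval₂, Polynomial.eval₂_eq_sum_range]
    refine sum_mem fun i _ => Z.mul_mem ?_ (pow_mem hX i)
    rw [RingHom.comp_apply, ← padicToRatFunc_coe]
    exact hmemZ _
  obtain ⟨a, b, hb, rfl⟩ := IsFractionRing.div_surjective (A := ℤ_[ℓ][X]) y
  exact Z.div_mem (hpoly a) (hpoly b)

theorem padicToRatFunc_eq (c : ℚ_[ℓ]) (hc : c ≠ 0) : ∃ (u : ℤ_[ℓ]ˣ) (n : ℕ) (g : RatFunc ℤ_[ℓ]),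
    g ≠ 0 ∧ padicToRatFunc ℓ c * g ^ 2 = algebraMap ℤ_[ℓ][X] _ (Polynomial.C (u : ℤ_[ℓ])) *
      algebraMap ℤ_[ℓ][X] _ (Polynomial.C (ℓ : ℤ_[ℓ])) ^ n := by
  obtain ⟨a, b, hb, rfl⟩ := IsFractionRing.div_surjective (A := ℤ_[ℓ]) c
  have hb0 := nonZeroDivisors.ne_zero hb
  have ha0 : a ≠ 0 := by
    rintro rfl
    simp at hc
  have hb1 : (algebraMap ℤ_[ℓ] ℚ_[ℓ] b) ≠ 0 := by simpa using hb0
  have hs := PadicInt.unitCoeff_spec (mul_ne_zero ha0 hb0)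
  refine ⟨PadicInt.unitCoeff (mul_ne_zero ha0 hb0), (a * b).valuation,
    padicToRatFunc ℓ (algebraMap ℤ_[ℓ] ℚ_[ℓ] b), by simpa using hb0, ?_⟩
  have hs' : algebraMap ℤ_[ℓ][X] (RatFunc ℤ_[ℓ]) (Polynomial.C (a * b)) =
      algebraMap ℤ_[ℓ][X] _ (Polynomial.C (PadicInt.unitCoeff (mul_ne_zero ha0 hb0) : ℤ_[ℓ])) *
      algebraMap ℤ_[ℓ][X] _ (Polynomial.C (ℓ : ℤ_[ℓ])) ^ (a * b).valuation := by
    rw [← map_pow, ← map_pow, ← map_mul, ← map_mul, ← hs]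
  rw [← hs', ← padicToRatFunc_coe, ← map_pow, ← map_mul]
  congr 1
  change _ = algebraMap ℤ_[ℓ] ℚ_[ℓ] (a * b)
  rw [map_mul]
  field_simp

/-- A rational function with a squarefree part of good reduction is not a residual square. -/
theorem gaussEmb_notMem_resSq (hp : ∀ p : k[X], (∀ n, ‖φ (p.coeff n)‖ ≤ 1) →
      ∃ P : ℤ_[ℓ][X], P.map (algebraMap ℤ_[ℓ] ℚ_[ℓ]) = p.map φ) {c : k} {f u v : k[X]}
    {g : RatFunc k} (hc : c ≠ 0) (hf : f.Monic) (hf1 : f ≠ 1) (hg : g ≠ 0)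
    (huv : u * f + v * Polynomial.derivative f = 1)
    (hfn : ∀ n, ‖φ (f.coeff n)‖ ≤ 1) (hun : ∀ n, ‖φ (u.coeff n)‖ ≤ 1)
    (hvn : ∀ n, ‖φ (v.coeff n)‖ ≤ 1) :
    gaussEmb φ (RatFunc.C c * algebraMap k[X] (RatFunc k) f * g ^ 2) ∉
      resSq (RatFunc ℤ_[ℓ]) (gaussMap ℓ) := by
  intro hm
  obtain ⟨F, hF⟩ := hp f hfn
  obtain ⟨U, hU⟩ := hp u hun
  obtain ⟨V, hV⟩ := hp v hvn
  have hinj := IsFractionRing.injective ℤ_[ℓ] ℚ_[ℓ]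
  have hbez : U * F + V * Polynomial.derivative F = 1 := by
    apply Polynomial.map_injective _ hinj
    rw [Polynomial.map_add, Polynomial.map_mul, Polynomial.map_mul, ← Polynomial.derivative_map,
      hF, hU, hV, Polynomial.derivative_map, ← Polynomial.map_mul, ← Polynomial.map_mul,
      ← Polynomial.map_add, huv, Polynomial.map_one, Polynomial.map_one]
  have hFm : F.Monic := by
    apply Polynomial.monic_of_injective hinj
    rw [hF]
    exact hf.map φ
  have hsep : (F.map (PadicInt.toZMod (p := ℓ))).Separable := by
    refine ⟨U.map PadicInt.toZMod, V.map PadicInt.toZMod, ?_⟩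
    rw [Polynomial.derivative_map, ← Polynomial.map_mul, ← Polynomial.map_mul,
      ← Polynomial.map_add, hbez, Polynomial.map_one]
  have hdeg : F.natDegree = f.natDegree := by
    have := congrArg Polynomial.natDegree hF
    rwa [Polynomial.natDegree_map_eq_of_injective hinj, Polynomial.natDegree_map] at this
  obtain ⟨w, n, h, hh, hw⟩ := padicToRatFunc_eq (φ c) (by simpa using hc)
  have hT := Reduction.isSqGroup_resSq (E := RatFunc ℤ_[ℓ]) (r := gaussMap ℓ)
  have hH := Reduction.isSqGroup_unitSq (E := RatFunc ℤ_[ℓ]) (r := gaussMap ℓ)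
  have hg' : gaussEmb φ g ≠ 0 := by simpa using hg
  have hwZ : PadicInt.toZMod (w : ℤ_[ℓ]) ≠ 0 := (w.isUnit.map PadicInt.toZMod).ne_zero
  have hFZ : (F.map (PadicInt.toZMod (p := ℓ))) ≠ 0 := (hFm.map _).ne_zero
  have hunit : gaussMap ℓ (Polynomial.C (w : ℤ_[ℓ]) * F) ≠ 0 := by
    rw [gaussMap_apply]
    simp only [Polynomial.map_mul, Polynomial.map_C, ne_eq, FaithfulSMul.algebraMap_eq_zero_iff,
      mul_eq_zero, not_or, Polynomial.C_eq_zero]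
    exact ⟨hwZ, hFZ⟩
  have hm2 : algebraMap ℤ_[ℓ][X] (RatFunc ℤ_[ℓ]) (Polynomial.C (w : ℤ_[ℓ]) * F) *
      algebraMap ℤ_[ℓ][X] _ (Polynomial.C (ℓ : ℤ_[ℓ])) ^ n ∈
      resSq (RatFunc ℤ_[ℓ]) (gaussMap ℓ) := by
    refine hT.congr (w := gaussEmb φ g) (z := h) hm hh ?_
    rw [map_mul, map_mul, map_mul, map_pow, gaussEmb_C, gaussEmb_of_lift φ hF]
    linear_combination -(algebraMap ℤ_[ℓ][X] _ F * gaussEmb φ g ^ 2) * hw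
  have hℓ0 : algebraMap ℤ_[ℓ][X] (RatFunc ℤ_[ℓ]) (Polynomial.C (ℓ : ℤ_[ℓ])) ≠ 0 :=
    Reduction.algebraMap_ne_zero' (gaussReduction ℓ).ne_zero
  rcases Nat.even_or_odd' n with ⟨t, rfl | rfl⟩
  · rw [mul_comm 2 t, pow_mul] at hm2
    have h1 := (gaussReduction ℓ).isSquare_of_mem_resSq hunit (pow_ne_zero _ hℓ0) hm2
    rw [gaussMap_apply] at h1
    have h2 := Polynomial.isUnit_of_isSquare_algebraMap ?_ h1
    · rw [Polynomial.map_mul] at h2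
      have h3 := Polynomial.natDegree_eq_zero_of_isUnit (isUnit_of_mul_isUnit_right h2)
      rw [hFm.natDegree_map, hdeg] at h3
      exact hf1 (hf.natDegree_eq_zero.1 h3)
    · rw [Polynomial.map_mul, Polynomial.map_C]
      have hu : IsUnit (Polynomial.C (PadicInt.toZMod (w : ℤ_[ℓ]))) :=
        Polynomial.isUnit_C.2 hwZ.isUnit
      exact hsep.squarefree.squarefree_of_dvd (hu.mul_left_dvd.2 dvd_rfl)
  · rw [pow_succ, ← mul_assoc, mul_right_comm] at hm2
    have h1 := Reduction.resSq_subset_unitSq hm2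
    rw [mul_comm 2 t, pow_mul] at h1
    have h2 := hH.of_mul_sq_mem h1
    exact (gaussReduction ℓ).self_notMem_unitSq (hH.of_mul_left (Reduction.mem_unitSq hunit) h2)

end Gauss

section Choice

variable {k K k' : Type*} [Field k] [Field K] [Field k'] [NumberField k'] [Algebra k k']
    {ι : k →+* K} {j : K →+* RatFunc k'} {α : k'}

theorem PadicInt.exists_map_eq {ℓ : ℕ} [Fact ℓ.Prime] {k : Type*} [Field k] (φ : k →+* ℚ_[ℓ])
    (p : k[X]) (h : ∀ n, ‖φ (p.coeff n)‖ ≤ 1) :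
    ∃ P : ℤ_[ℓ][X], P.map (algebraMap ℤ_[ℓ] ℚ_[ℓ]) = p.map φ := by
  have : p.map φ ∈ Polynomial.lifts (algebraMap ℤ_[ℓ] ℚ_[ℓ]) := by
    rw [Polynomial.lifts_iff_coeff_lifts]
    intro n
    rw [Polynomial.coeff_map]
    exact ⟨⟨_, h n⟩, rfl⟩
  exact (Polynomial.mem_lifts _).1 this

/-- There are infinitely many Gauss places of good reduction, in which finitely many given
elements are not residual squares. -/
theorem ConicEmb.exists_gaussEmb (hj : ConicEmb ι j α) (S : Finset K)
    (hS : ∀ x ∈ S, x ≠ 0 ∧ ¬ ∃ r w, x = ι r * w ^ 2) :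
    ∃ (ℓ : ℕ) (_ : Fact ℓ.Prime) (φ : k' →+* ℚ_[ℓ]), ℓ ≠ 2 ∧ IsSquare (-1 : ZMod ℓ) ∧
      ∀ x ∈ S, gaussEmb φ (j x) ∉ resSq (RatFunc ℤ_[ℓ]) (gaussMap ℓ) := by
  classical
  have hdata : ∀ x ∈ S, ∃ (c : k') (f u v : k'[X]) (g : RatFunc k'), c ≠ 0 ∧ f.Monic ∧ f ≠ 1 ∧
      g ≠ 0 ∧ u * f + v * Polynomial.derivative f = 1 ∧
      j x = RatFunc.C c * algebraMap k'[X] (RatFunc k') f * g ^ 2 := by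
    intro x hx
    obtain ⟨hx0, hx1⟩ := hS x hx
    obtain ⟨c, f, g, hc, hf, hsq, hg, h⟩ := RatFunc.exists_squarefree (j x) (by simpa using hx0)
    obtain ⟨u, v, huv⟩ := (PerfectField.separable_iff_squarefree.2 hsq : f.Separable)
    refine ⟨c, f, u, v, g, hc, hf, ?_, hg, huv, h⟩
    rintro rfl
    exact hx1 (hj.descent x c g hx0 (by simpa using h))
  choose! c f u v g hc hf hf1 hg huv hjx using hdata
  obtain ⟨M, hM, hmemZ⟩ := NumberField.exists_norm_le_one
    (S.biUnion fun x => (f x).coeffs ∪ (u x).coeffs ∪ (v x).coeffs)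
  obtain ⟨k'', _, _, _, β, hβ, -⟩ := exists_numberField_sqrt k' (-1)
  obtain ⟨ℓ, hℓ, hd, ⟨φ'⟩⟩ := NumberField.exists_padic_embedding k'' (mul_ne_zero two_ne_zero hM)
  refine ⟨ℓ, hℓ, φ'.comp (algebraMap k' k''), ?_, ?_, fun x hx => ?_⟩
  · rintro rfl
    exact hd ⟨M, rfl⟩
  · have h1 : φ' β ^ 2 = -1 := by rw [← map_pow, hβ]; simp
    have h2 : ‖φ' β‖ = 1 := by
      have := congrArg norm h1
      rw [norm_pow, norm_neg, norm_one] at this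
      exact (pow_eq_one_iff_of_nonneg (norm_nonneg _) two_ne_zero).1 this
    let z : ℤ_[ℓ] := ⟨φ' β, h2.le⟩
    have h3 : z ^ 2 = -1 := Subtype.ext h1
    have h4 := congrArg (PadicInt.toZMod (p := ℓ)) h3
    rw [map_pow, map_neg, map_one] at h4
    exact ⟨_, by rw [← h4, pow_two]⟩
  · have hd' : ¬ (ℓ : ℤ) ∣ M := fun h => hd (h.mul_left 2)
    have hco : ∀ p : k'[X], p.coeffs ⊆ (S.biUnion fun x => (f x).coeffs ∪ (u x).coeffs ∪
        (v x).coeffs) → ∀ n, ‖(φ'.comp (algebraMap k' k'')) (p.coeff n)‖ ≤ 1 := by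
      intro p hp n
      rcases eq_or_ne (p.coeff n) 0 with h | h
      · rw [h, map_zero, norm_zero]
        exact zero_le_one
      · exact hmemZ ℓ hd' _ _ (hp (Polynomial.coeff_mem_coeffs h))
    rw [hjx x hx]
    refine gaussEmb_notMem_resSq _ (PadicInt.exists_map_eq _) (hc x hx) (hf x hx) (hf1 x hx)
      (hg x hx) (huv x hx) (hco _ ?_) (hco _ ?_) (hco _ ?_)
    all_goals
      refine fun y hy => Finset.mem_biUnion.2 ⟨x, hx, ?_⟩
      simp [hy]

end Choice

namespace FiniteField

theorem isSquare_norm_iff {F K : Type*} [Field F] [Field K] [Algebra F K] [Finite K]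
    (h2 : ringChar F ≠ 2) {x : K} (hx : x ≠ 0) :
    IsSquare (Algebra.norm F x) ↔ IsSquare x := by
  have hF : Finite F := Finite.of_injective _ (algebraMap F K).injective
  let _ := Fintype.ofFinite F
  let _ := Fintype.ofFinite K
  have h2' : ringChar K ≠ 2 := by
    rwa [← Algebra.ringChar_eq F K]
  have hn : Algebra.norm F x ≠ 0 := Algebra.norm_ne_zero_iff.2 hx
  rw [FiniteField.isSquare_iff h2 hn, FiniteField.isSquare_iff h2' hx,
    ← (algebraMap F K).injective.eq_iff, map_one, map_pow, algebraMap_norm_eq_pow, ← pow_mul,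
    Nat.card_eq_fintype_card, Nat.card_eq_fintype_card]
  have h3 := Nat.odd_iff.2 <| FiniteField.odd_card_of_char_ne_two h2
  have h4 := Nat.odd_iff.2 <| FiniteField.odd_card_of_char_ne_two h2'
  have h5 : Fintype.card F - 1 ∣ Fintype.card K - 1 := by
    rw [Module.card_eq_pow_finrank (K := F) (V := K)]
    simpa using Nat.sub_dvd_pow_sub_pow (Fintype.card F) 1 (Module.finrank F K)
  have h6 : (Fintype.card K - 1) / (Fintype.card F - 1) * (Fintype.card F / 2) =
      Fintype.card K / 2 := by
    have h7 : 1 < Fintype.card F := Fintype.one_lt_card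
    obtain ⟨a, ha⟩ := h3
    obtain ⟨b, hb⟩ := h4
    obtain ⟨c, hc⟩ := h5
    rw [hc, Nat.mul_div_cancel_left _ (by omega)]
    rw [ha, hb] at hc ⊢
    have : (2 * a + 1) / 2 = a := by omega
    rw [this]
    have : (2 * b + 1) / 2 = b := by omega
    rw [this]
    have : 2 * b = 2 * (a * c) := by
      rw [← mul_assoc]; simpa using hc
    linarith [mul_comm a c]
  rw [h6]

end FiniteField

namespace Polynomial

variable {F : Type*} [Field F] [Finite F]

theorem norm_mk_eq_resultant (P : F[X]) {Q : F[X]} [hQ : Fact (Irreducible Q)] (hm : Q.Monic) :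
    Algebra.norm F (AdjoinRoot.mk Q P) = Q.resultant P := by
  have hfd : FiniteDimensional F (AdjoinRoot Q) := (AdjoinRoot.powerBasis hm.ne_zero).finite
  apply (algebraMap F (AlgebraicClosure F)).injective
  have hs : (Q.map (algebraMap F (AlgebraicClosure F))).Splits := IsAlgClosed.splits _
  have hsep : Q.Separable := PerfectField.separable_of_irreducible hQ.out
  rw [Algebra.norm_eq_prod_embeddings, ← resultant_map_map,
    ← natDegree_map (algebraMap F (AlgebraicClosure F)) (p := Q), resultant_eq_prod_eval _ _ _
      natDegree_map_le hs, (hm.map _).leadingCoeff, one_pow, one_mul]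
  classical
  have hnd : (Q.map (algebraMap F (AlgebraicClosure F))).roots.Nodup :=
    nodup_roots hsep.map
  have : ∀ σ : AdjoinRoot Q →ₐ[F] AlgebraicClosure F, σ (AdjoinRoot.mk Q P) =
      (P.map (algebraMap F (AlgebraicClosure F))).eval
        (AdjoinRoot.equiv (AlgebraicClosure F) F Q hm.ne_zero σ : AlgebraicClosure F) := by
    intro σ
    change _ = (P.map (algebraMap F (AlgebraicClosure F))).eval (σ (AdjoinRoot.root Q))
    rw [eval_map_algebraMap, ← AdjoinRoot.aeval_eq, aeval_algHom_apply]
  simp_rw [this]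
  rw [(AdjoinRoot.equiv (AlgebraicClosure F) F Q hm.ne_zero).prod_comp
      (fun i => (P.map (algebraMap F (AlgebraicClosure F))).eval (i : AlgebraicClosure F)),
    ← Finset.prod_subtype (Q.aroots (AlgebraicClosure F)).toFinset (by simp)
      (fun i => (P.map (algebraMap F (AlgebraicClosure F))).eval i), Finset.prod,
    Multiset.toFinset_val, aroots, hnd.dedup]

end Polynomial

namespace Polynomial

theorem mk_ne_zero_of_ne {F : Type*} [Field F] {P Q : F[X]} [hP : Fact (Irreducible P)]
    [hQ : Fact (Irreducible Q)]
    (hPm : P.Monic) (hQm : Q.Monic) (hne : P ≠ Q) : AdjoinRoot.mk Q P ≠ 0 := by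
  rw [ne_eq, AdjoinRoot.mk_eq_zero]
  intro h
  exact hne (eq_of_monic_of_associated hPm hQm
    ((hQ.out.associated_of_dvd hP.out h).symm))

variable {F : Type*} [Field F] [Finite F]

theorem finite_adjoinRoot {Q : F[X]} (hm : Q.Monic) : Finite (AdjoinRoot Q) := by
  have hfd : Module.Finite F (AdjoinRoot Q) := hm.finite_adjoinRoot
  exact Module.finite_of_finite F

theorem isSquare_mk_comm (h2 : ringChar F ≠ 2) (hi : IsSquare (-1 : F)) {P Q : F[X]}
    [hP : Fact (Irreducible P)] [hQ : Fact (Irreducible Q)]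
    (hPm : P.Monic) (hQm : Q.Monic) (hne : P ≠ Q) :
    IsSquare (AdjoinRoot.mk Q P) ↔ IsSquare (AdjoinRoot.mk P Q) := by
  have := finite_adjoinRoot hPm
  have := finite_adjoinRoot hQm
  rw [← FiniteField.isSquare_norm_iff h2 (mk_ne_zero_of_ne hPm hQm hne),
    ← FiniteField.isSquare_norm_iff h2 (mk_ne_zero_of_ne hQm hPm hne.symm),
    norm_mk_eq_resultant P hQm, norm_mk_eq_resultant Q hPm, resultant_comm]
  have h : ∀ n, IsSquare ((-1 : F) ^ n) := fun n => hi.pow n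
  constructor
  · intro h1
    have := (h (Q.natDegree * P.natDegree)).mul h1
    rwa [← mul_assoc, ← mul_pow, neg_one_mul, neg_neg, one_pow, one_mul] at this
  · exact fun h1 => (h _).mul h1

theorem isSquare_mk_C (h2 : ringChar F ≠ 2) {c : F} (hc : c ≠ 0) {Q : F[X]}
    [hQ : Fact (Irreducible Q)] (hm : Q.Monic) :
    IsSquare (AdjoinRoot.mk Q (Polynomial.C c)) ↔ IsSquare (c ^ Q.natDegree) := by
  have := finite_adjoinRoot hm
  rw [← FiniteField.isSquare_norm_iff h2, AdjoinRoot.mk_C, ← AdjoinRoot.algebraMap_eq,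
    Algebra.norm_algebraMap, (AdjoinRoot.powerBasis hm.ne_zero).finrank,
    AdjoinRoot.powerBasis_dim]
  rw [AdjoinRoot.mk_C]
  simpa using hc

end Polynomial

/-- A map on nonzero elements turning multiplication into addition. -/
def MulAdd {E V : Type*} [Field E] [AddCommGroup V] (w : E → V) : Prop :=
  ∀ x y : E, x ≠ 0 → y ≠ 0 → w (x * y) = w x + w y

namespace MulAdd

variable {E : Type*} [Field E]

theorem map_one {V : Type*} [AddCommGroup V] {w : E → V} (hw : MulAdd w) : w 1 = 0 := by
  simpa using hw 1 1 one_ne_zero one_ne_zero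

theorem map_inv {V : Type*} [AddCommGroup V] {w : E → V} (hw : MulAdd w) {x : E} (hx : x ≠ 0) :
    w x⁻¹ = - w x := by
  have := hw x x⁻¹ hx (inv_ne_zero hx)
  rw [mul_inv_cancel₀ hx, hw.map_one] at this
  exact (neg_eq_of_add_eq_zero_right this.symm).symm

theorem map_prod {V ι : Type*} [AddCommGroup V] {w : E → V} (hw : MulAdd w) (s : Finset ι)
    (f : ι → E) (hf : ∀ i, f i ≠ 0) : w (∏ i ∈ s, f i) = ∑ i ∈ s, w (f i) := by
  classical
  induction s using Finset.induction_on with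
  | empty => simpa using hw.map_one
  | insert a s ha ih =>
    rw [Finset.prod_insert ha, Finset.sum_insert ha,
      hw _ _ (hf a) (Finset.prod_ne_zero_iff.2 fun i _ => hf i), ih]

variable {w : E → ZMod 2 × ZMod 2}

theorem map_sq (hw : MulAdd w) {x : E} (hx : x ≠ 0) : w (x ^ 2) = 0 := by
  rw [pow_two, hw x x hx hx]
  exact CharTwo.add_self_eq_zero _

theorem map_isSquare (hw : MulAdd w) {x : E} (hx : x ≠ 0) (h : IsSquare x) : w x = 0 := by
  obtain ⟨y, rfl⟩ := h
  rw [← pow_two]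
  exact hw.map_sq (by rintro rfl; simp at hx)

end MulAdd

/-- The indicator of the complement of a set, with values in `ZMod 2`. -/
noncomputable def coInd {E : Type*} (H : Set E) (x : E) : ZMod 2 :=
  open Classical in if x ∈ H then 0 else 1

theorem coInd_eq_zero {E : Type*} {H : Set E} {x : E} : coInd H x = 0 ↔ x ∈ H := by
  unfold coInd
  split_ifs with h <;> simp [h]

theorem coInd_eq_one {E : Type*} {H : Set E} {x : E} : coInd H x = 1 ↔ x ∉ H := by
  unfold coInd
  split_ifs with h <;> simp [h]

theorem IsSqGroup.mulAdd_coInd {E : Type*} [Field E] {H : Set E} (hH : IsSqGroup H)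
    (h2 : ∀ x y, x ≠ 0 → y ≠ 0 → x ∉ H → y ∉ H → x * y ∈ H) : MulAdd (coInd H) := by
  intro x y hx hy
  by_cases h1 : x ∈ H <;> by_cases h3 : y ∈ H
  · rw [coInd_eq_zero.2 h1, coInd_eq_zero.2 h3, coInd_eq_zero.2 (hH.mul_mem h1 h3), add_zero]
  · rw [coInd_eq_zero.2 h1, coInd_eq_one.2 h3, coInd_eq_one.2 fun h => h3 (hH.of_mul_left h1 h),
      zero_add]
  · rw [coInd_eq_zero.2 h3, coInd_eq_one.2 h1, coInd_eq_one.2 fun h => h1 (hH.of_mul_right h3 h),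
      add_zero]
  · rw [coInd_eq_one.2 h1, coInd_eq_one.2 h3, coInd_eq_zero.2 (h2 x y hx hy h1 h3)]
    decide

theorem FiniteField.isSquare_mul_of_not {κ : Type*} [Field κ] [Finite κ] {x y : κ}
    (hx : ¬IsSquare x) (hy : ¬IsSquare y) : IsSquare (x * y) := by
  classical
  let _ := Fintype.ofFinite κ
  have hx0 : x ≠ 0 := by rintro rfl; simp at hx
  have hy0 : y ≠ 0 := by rintro rfl; simp at hy
  rw [← quadraticChar_one_iff_isSquare (mul_ne_zero hx0 hy0), map_mul,
    quadraticChar_neg_one_iff_not_isSquare.2 hx, quadraticChar_neg_one_iff_not_isSquare.2 hy]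
  norm_num

namespace Reduction

variable {A κ E : Type*} [CommRing A] [IsDomain A] [Field κ] [Field E] [Algebra A E]
  [IsFractionRing A E] {p : A} {r : A →+* κ}

theorem unitSq_index (h : Reduction p r) {x y : E} (hx : x ≠ 0) (hy : y ≠ 0)
    (hxU : x ∉ unitSq E r) (hyU : y ∉ unitSq E r) : x * y ∈ unitSq E r := by
  have h1 := (h.unitSq_or_mul hx).resolve_left hxU
  have h2 := (h.unitSq_or_mul hy).resolve_left hyU
  exact isSqGroup_unitSq.congr (w := algebraMap A E p) (z := 1)
    (isSqGroup_unitSq.mul_mem h1 h2) one_ne_zero (by ring)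

theorem resSq_index [Finite κ] {x y : E} (hx : x ∈ unitSq E r) (hy : y ∈ unitSq E r)
    (hxT : x ∉ resSq E r) (hyT : y ∉ resSq E r) : x * y ∈ resSq E r := by
  obtain ⟨a, g, ha, hg, rfl⟩ := hx
  obtain ⟨b, g', hb, hg', rfl⟩ := hy
  have h1 : ¬IsSquare (r a) := fun h => hxT ⟨a, g, ha, h, hg, rfl⟩
  have h2 : ¬IsSquare (r b) := fun h => hyT ⟨b, g', hb, h, hg', rfl⟩
  refine ⟨a * b, g * g', ?_, ?_, mul_ne_zero hg hg', by rw [map_mul]; ring⟩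
  · rw [map_mul]; exact mul_ne_zero ha hb
  · rw [map_mul]; exact FiniteField.isSquare_mul_of_not h1 h2

/-- Parity of the valuation and quadratic character of the residue. -/
noncomputable def coord (E : Type*) [Field E] [Algebra A E] (p : A) (r : A →+* κ) (x : E) :
    ZMod 2 × ZMod 2 :=
  (coInd (unitSq E r) x, coInd {x | x ∈ resSq E r ∨ x * algebraMap A E p ∈ resSq E r} x)

theorem mulAdd_coord [Finite κ] (h : Reduction p r) : MulAdd (coord E p r) := by
  intro x y hx hy
  have h0 : algebraMap A E p ≠ 0 := algebraMap_ne_zero' h.ne_zero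
  refine Prod.ext (isSqGroup_unitSq.mulAdd_coInd
      (fun x y hx hy hxU hyU => h.unitSq_index hx hy hxU hyU) x y hx hy)
    ((isSqGroup_resSq.adjoin _).mulAdd_coInd (fun x y hx hy hxU hyU => ?_) x y hx hy)
  have key : ∀ z : E, z ≠ 0 → ¬(z ∈ resSq E r ∨ z * algebraMap A E p ∈ resSq E r) →
      ∃ z', z' ∈ unitSq E r ∧ z' ∉ resSq E r ∧ (z' = z ∨ z' = z * algebraMap A E p) := by
    intro z hz hzU
    rw [not_or] at hzU
    rcases h.unitSq_or_mul hz with h1 | h1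
    · exact ⟨z, h1, hzU.1, Or.inl rfl⟩
    · exact ⟨_, h1, hzU.2, Or.inr rfl⟩
  obtain ⟨x', hx1, hx2, hx3⟩ := key x hx hxU
  obtain ⟨y', hy1, hy2, hy3⟩ := key y hy hyU
  have h3 := resSq_index hx1 hy1 hx2 hy2
  rcases hx3 with rfl | rfl <;> rcases hy3 with rfl | rfl
  · exact Or.inl h3
  · exact Or.inr (by rwa [← mul_assoc] at h3)
  · exact Or.inr (by rwa [mul_right_comm] at h3)
  · exact Or.inl (isSqGroup_resSq.congr (w := algebraMap A E p) (z := 1) h3 one_ne_zero (by ring))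

theorem coord_eq_zero (h : Reduction p r) {x : E} : coord E p r x = 0 ↔ x ∈ resSq E r := by
  rw [coord, Prod.mk_eq_zero, coInd_eq_zero, coInd_eq_zero]
  constructor
  · rintro ⟨h1, h2 | h2⟩
    · exact h2
    · exact absurd (isSqGroup_unitSq.of_mul_left h1 (resSq_subset_unitSq h2)) h.self_notMem_unitSq
  · exact fun h1 => ⟨resSq_subset_unitSq h1, Or.inl h1⟩

theorem coord_algebraMap (h : Reduction p r) {a : A} (ha : r a ≠ 0) :
    coord E p r (algebraMap A E a) = (0, open Classical in if IsSquare (r a) then 0 else 1) := by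
  refine Prod.ext (coInd_eq_zero.2 (mem_unitSq ha)) ?_
  have hm : algebraMap A E a ∈ resSq E r ↔ IsSquare (r a) :=
    ⟨fun h1 => h.isSquare_of_mem_resSq ha (one_ne_zero (α := E)) (by simpa using h1),
      fun h1 => ⟨a, 1, ha, h1, one_ne_zero, by simp⟩⟩
  have hn : algebraMap A E a * algebraMap A E p ∉ resSq E r := fun h1 =>
    h.self_notMem_unitSq (isSqGroup_unitSq.of_mul_left (mem_unitSq ha) (resSq_subset_unitSq h1))
  change coInd _ _ = _
  split_ifs with h1
  · exact coInd_eq_zero.2 (Or.inl (hm.2 h1))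
  · exact coInd_eq_one.2 (by rintro (h2 | h2); exacts [h1 (hm.1 h2), hn h2])

theorem coord_self (h : Reduction p r) : coord E p r (algebraMap A E p) = (1, 0) := by
  refine Prod.ext (coInd_eq_one.2 h.self_notMem_unitSq) (coInd_eq_zero.2 (Or.inr ?_))
  rw [← pow_two]
  exact isSqGroup_resSq.sq_mem _ (algebraMap_ne_zero' h.ne_zero)

end Reduction

/-- The alternating pairing on the plane over `ZMod 2`. -/
def planePair (a b : ZMod 2 × ZMod 2) : ZMod 2 := a.1 * b.2 + a.2 * b.1

theorem planePair_add_left (a b c : ZMod 2 × ZMod 2) :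
    planePair (a + b) c = planePair a c + planePair b c := by
  simp only [planePair, Prod.fst_add, Prod.snd_add]
  ring

theorem planePair_comm (a b : ZMod 2 × ZMod 2) : planePair a b = planePair b a := by
  simp only [planePair]
  ring

theorem planePair_self (a : ZMod 2 × ZMod 2) : planePair a a = 0 := by
  simp only [planePair]
  rw [mul_comm a.2]
  exact CharTwo.add_self_eq_zero _

/-- Monic irreducible polynomials. -/
@[ext]
structure MonicIrred (F : Type*) [Field F] where
  /-- the polynomial -/
  poly : F[X]
  monic : poly.Monic
  irreducible : Irreducible poly

namespace MonicIrred

variable {F : Type*} [Field F]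

instance (P : MonicIrred F) : Fact (Irreducible P.poly) := ⟨P.irreducible⟩

/-- Multiplicative induction for nonzero rational functions. -/
theorem ratFunc_induction {p : RatFunc F → Prop} (hC : ∀ c : F, c ≠ 0 → p (RatFunc.C c))
    (hP : ∀ P : MonicIrred F, p (algebraMap F[X] (RatFunc F) P.poly))
    (hmul : ∀ x y, x ≠ 0 → y ≠ 0 → p x → p y → p (x * y))
    (hinv : ∀ x, x ≠ 0 → p x → p x⁻¹) {x : RatFunc F} (hx : x ≠ 0) : p x := by
  have hpol : ∀ f : F[X], f ≠ 0 → p (algebraMap F[X] (RatFunc F) f) := by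
    intro f
    induction f using WfDvdMonoid.induction_on_irreducible with
    | zero => exact fun h => absurd rfl h
    | unit u hu =>
      intro _
      obtain ⟨c, hc, rfl⟩ := Polynomial.isUnit_iff.1 hu
      exact hC c hc.ne_zero
    | mul a i ha hi ih =>
      intro _
      have hl : i.leadingCoeff ≠ 0 := Polynomial.leadingCoeff_ne_zero.2 hi.ne_zero
      have hm : (Polynomial.C i.leadingCoeff⁻¹ * i).Monic := by
        rw [mul_comm]
        exact Polynomial.monic_mul_leadingCoeff_inv hi.ne_zero
      have hu : IsUnit (Polynomial.C i.leadingCoeff⁻¹) :=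
        Polynomial.isUnit_C.2 (inv_ne_zero hl).isUnit
      have h2 := hP ⟨_, hm, (irreducible_isUnit_mul hu).2 hi⟩
      have hinj : ∀ q : F[X], q ≠ 0 → algebraMap F[X] (RatFunc F) q ≠ 0 := fun q hq => by
        simpa using hq
      have h3 := hmul _ _ (by simpa using hl) (hinj _ hm.ne_zero) (hC _ hl) h2
      have e : RatFunc.C i.leadingCoeff * algebraMap F[X] (RatFunc F)
          (Polynomial.C i.leadingCoeff⁻¹ * i) = algebraMap F[X] (RatFunc F) i := by
        rw [map_mul, ← mul_assoc]
        change RatFunc.C _ * RatFunc.C i.leadingCoeff⁻¹ * _ = _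
        rw [← map_mul, mul_inv_cancel₀ hl, map_one, one_mul]
      simp only [e] at h3
      rw [map_mul]
      exact hmul _ _ (hinj _ hi.ne_zero) (hinj _ ha) h3 (ih ha)
  obtain ⟨a, b, hb, rfl⟩ := IsFractionRing.div_surjective (A := F[X]) x
  have hb0 := nonZeroDivisors.ne_zero hb
  have ha0 : a ≠ 0 := by rintro rfl; simp at hx
  rw [div_eq_mul_inv]
  exact hmul _ _ (by simpa using ha0) (by simpa using hb0) (hpol a ha0)
    (hinv _ (by simpa using hb0) (hpol b hb0))

/-- The coordinates of a rational function at a monic irreducible polynomial. -/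
noncomputable def coord (P : MonicIrred F) (x : RatFunc F) : ZMod 2 × ZMod 2 :=
  Reduction.coord (RatFunc F) P.poly (AdjoinRoot.mk P.poly) x

/-- The coordinates of a rational function at infinity. -/
noncomputable def coordInfty (x : RatFunc F) : ZMod 2 × ZMod 2 :=
  (x.intDegree, coInd {c : F | c ≠ 0 ∧ IsSquare c} x.num.leadingCoeff)

variable [Finite F]

theorem mulAdd_coord (P : MonicIrred F) : MulAdd P.coord := by
  have := Polynomial.finite_adjoinRoot P.monic
  exact (Polynomial.reduction (π := P.poly)).mulAdd_coord

theorem mulAdd_coordInfty : MulAdd (coordInfty (F := F)) := by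
  have hsq : MulAdd (coInd {c : F | c ≠ 0 ∧ IsSquare c}) := by
    refine IsSqGroup.mulAdd_coInd ⟨fun h => h.1 rfl, fun x hx => ⟨pow_ne_zero 2 hx, ⟨x, pow_two x⟩⟩,
      fun hx hy => ⟨mul_ne_zero hx.1 hy.1, hx.2.mul hy.2⟩⟩ fun x y hx hy hxs hys =>
        ⟨mul_ne_zero hx hy, FiniteField.isSquare_mul_of_not (fun h => hxs ⟨hx, h⟩)
          fun h => hys ⟨hy, h⟩⟩
  intro x y hx hy
  refine Prod.ext ?_ ?_
  · change (((x * y).intDegree : ℤ) : ZMod 2) = x.intDegree + y.intDegree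
    rw [RatFunc.intDegree_mul hx hy, Int.cast_add]
  · change coInd _ _ = coInd _ _ + coInd _ _
    rw [← hsq _ _ (by simpa using hx) (by simpa using hy)]
    congr 1
    have h := congrArg Polynomial.leadingCoeff (RatFunc.num_denom_mul x y)
    simpa [(RatFunc.monic_denom _).leadingCoeff] using h

theorem coordInfty_C (c : F) (hc : c ≠ 0) : coordInfty (RatFunc.C c) =
    (0, open Classical in if IsSquare c then 0 else 1) := by
  refine Prod.ext ?_ ?_
  · simp [coordInfty]
  · change coInd _ _ = _
    rw [RatFunc.num_C, Polynomial.leadingCoeff_C]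
    split_ifs with h
    · exact coInd_eq_zero.2 ⟨hc, h⟩
    · exact coInd_eq_one.2 fun h1 => h h1.2

theorem coordInfty_algebraMap (P : MonicIrred F) :
    coordInfty (algebraMap F[X] (RatFunc F) P.poly) = ((P.poly.natDegree : ZMod 2), 0) := by
  refine Prod.ext ?_ ?_
  · change ((RatFunc.intDegree _ : ℤ) : ZMod 2) = _
    rw [RatFunc.intDegree_polynomial, Int.cast_natCast]
  · change coInd _ _ = _
    rw [RatFunc.num_algebraMap, P.monic.leadingCoeff]
    exact coInd_eq_zero.2 ⟨one_ne_zero, IsSquare.one⟩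

theorem coord_C (h2 : ringChar F ≠ 2) (P : MonicIrred F) (c : F) (hc : c ≠ 0) :
    P.coord (RatFunc.C c) =
      (0, open Classical in if IsSquare (c ^ P.poly.natDegree) then 0 else 1) := by
  have h := (Polynomial.reduction (π := P.poly)).coord_algebraMap (E := RatFunc F)
    (a := Polynomial.C c) (by rw [AdjoinRoot.mk_C]; simpa using hc)
  classical
  exact h.trans (Prod.ext rfl (if_congr (Polynomial.isSquare_mk_C h2 hc P.monic) rfl rfl))

theorem coord_self (P : MonicIrred F) : P.coord (algebraMap F[X] (RatFunc F) P.poly) = (1, 0) :=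
  (Polynomial.reduction (π := P.poly)).coord_self

theorem coord_algebraMap {P Q : MonicIrred F} (h : P ≠ Q) :
    Q.coord (algebraMap F[X] (RatFunc F) P.poly) =
      (0, open Classical in if IsSquare (AdjoinRoot.mk Q.poly P.poly) then 0 else 1) :=
  (Polynomial.reduction (π := Q.poly)).coord_algebraMap (E := RatFunc F)
    (Polynomial.mk_ne_zero_of_ne P.monic Q.monic fun h1 => h (MonicIrred.ext h1))

theorem finite_support (h2 : ringChar F ≠ 2) {x : RatFunc F} (hx : x ≠ 0) :
    {P : MonicIrred F | (P.coord x).1 ≠ 0}.Finite := by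
  refine ratFunc_induction (p := fun x => {P : MonicIrred F | (P.coord x).1 ≠ 0}.Finite)
    (fun c hc => ?_) (fun Q => ?_) (fun x y hx hy h1 h3 => ?_) (fun x hx h1 => ?_) hx
  · convert Set.finite_empty
    ext P
    simp [coord_C h2 P c hc]
  · refine (Set.finite_singleton Q).subset fun P hP => ?_
    by_contra h
    exact hP (by rw [coord_algebraMap (Ne.symm h)])
  · refine (h1.union h3).subset fun P hP => ?_
    by_contra h
    simp only [Set.mem_union, Set.mem_ofPred_eq, not_or, not_not] at h
    exact hP (by rw [P.mulAdd_coord x y hx hy, Prod.fst_add, h.1, h.2, add_zero])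
  · refine h1.subset fun P hP => ?_
    intro h
    exact hP (by rw [P.mulAdd_coord.map_inv hx, Prod.fst_neg, h, neg_zero])

theorem finite_support_pair (h2 : ringChar F ≠ 2) {x y : RatFunc F} (hx : x ≠ 0) (hy : y ≠ 0) :
    (Function.support fun P : MonicIrred F => planePair (P.coord x) (P.coord y)).Finite := by
  refine ((finite_support h2 hx).union (finite_support h2 hy)).subset fun P hP => ?_
  by_contra h
  simp only [Set.mem_union, Set.mem_ofPred_eq, not_or, not_not] at h
  exact hP (by simp [planePair, h.1, h.2])

/-- Quadratic reciprocity for polynomials over a finite field in which `-1` is a square. -/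
theorem reciprocity (h2 : ringChar F ≠ 2) (hi : IsSquare (-1 : F)) {x y : RatFunc F}
    (hx : x ≠ 0) (hy : y ≠ 0) :
    ∑ᶠ P : MonicIrred F, planePair (P.coord x) (P.coord y) +
      planePair (coordInfty x) (coordInfty y) = 0 := by
  have hadd : ∀ x x' y : RatFunc F, x ≠ 0 → x' ≠ 0 → y ≠ 0 →
      ∑ᶠ P : MonicIrred F, planePair (P.coord (x * x')) (P.coord y) +
      planePair (coordInfty (x * x')) (coordInfty y) =
      (∑ᶠ P : MonicIrred F, planePair (P.coord x) (P.coord y) +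
      planePair (coordInfty x) (coordInfty y)) +
      (∑ᶠ P : MonicIrred F, planePair (P.coord x') (P.coord y) +
      planePair (coordInfty x') (coordInfty y)) := by
    intro x x' y hx hx' hy
    rw [mulAdd_coordInfty x x' hx hx', planePair_add_left, add_add_add_comm,
      ← finsum_add_distrib (finite_support_pair h2 hx hy) (finite_support_pair h2 hx' hy)]
    congr 1
    refine finsum_congr fun P => ?_
    rw [P.mulAdd_coord x x' hx hx', planePair_add_left]
  have hone : ∀ y : RatFunc F,
      ∑ᶠ P : MonicIrred F, planePair (P.coord 1) (P.coord y) +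
      planePair (coordInfty (1 : RatFunc F)) (coordInfty y) = 0 := by
    intro y
    have h1 : ∀ P : MonicIrred F, P.coord 1 = 0 := fun P => P.mulAdd_coord.map_one
    have h3 : coordInfty (1 : RatFunc F) = 0 := (mulAdd_coordInfty (F := F)).map_one
    simp only [h1, h3]
    simp [planePair]
  have hred : ∀ y : RatFunc F, y ≠ 0 →
      (∀ c : F, c ≠ 0 → ∑ᶠ P : MonicIrred F, planePair (P.coord (RatFunc.C c)) (P.coord y) +
        planePair (coordInfty (RatFunc.C c)) (coordInfty y) = 0) →
      (∀ Q : MonicIrred F, ∑ᶠ P : MonicIrred F,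
        planePair (P.coord (algebraMap F[X] (RatFunc F) Q.poly)) (P.coord y) +
        planePair (coordInfty (algebraMap F[X] (RatFunc F) Q.poly)) (coordInfty y) = 0) →
      ∀ x : RatFunc F, x ≠ 0 → ∑ᶠ P : MonicIrred F, planePair (P.coord x) (P.coord y) +
        planePair (coordInfty x) (coordInfty y) = 0 := by
    intro y hy hC hP x hx
    refine ratFunc_induction (p := fun x => ∑ᶠ P : MonicIrred F,
      planePair (P.coord x) (P.coord y) + planePair (coordInfty x) (coordInfty y) = 0) hC hP
      (fun x x' hx hx' h1 h3 => ?_) (fun x hx h1 => ?_) hx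
    · rw [hadd x x' y hx hx' hy, h1, h3, add_zero]
    · have := hadd x x⁻¹ y hx (inv_ne_zero hx) hy
      rwa [mul_inv_cancel₀ hx, hone, h1, zero_add, eq_comm] at this
  have hcomm : ∀ x y : RatFunc F, ∑ᶠ P : MonicIrred F, planePair (P.coord x) (P.coord y) +
      planePair (coordInfty x) (coordInfty y) = ∑ᶠ P : MonicIrred F,
      planePair (P.coord y) (P.coord x) + planePair (coordInfty y) (coordInfty x) := by
    intro x y
    rw [planePair_comm]
    congr 1
    exact finsum_congr fun P => planePair_comm _ _
  have hCP : ∀ c : F, c ≠ 0 → ∀ Q : MonicIrred F, ∑ᶠ P : MonicIrred F,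
      planePair (P.coord (RatFunc.C c)) (P.coord (algebraMap F[X] (RatFunc F) Q.poly)) +
      planePair (coordInfty (RatFunc.C c))
        (coordInfty (algebraMap F[X] (RatFunc F) Q.poly)) = 0 := by
    intro c hc Q
    rw [finsum_eq_single _ Q fun P hP => by
      rw [coord_C h2 P c hc, coord_algebraMap (Ne.symm hP)]; simp [planePair]]
    rw [coord_C h2 Q c hc, coord_self, coordInfty_C c hc, coordInfty_algebraMap]
    simp only [planePair, mul_one, zero_add, mul_zero]
    by_cases hs : IsSquare c
    · simp [hs, hs.pow]
    · rcases Nat.even_or_odd Q.poly.natDegree with he | ho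
      · simp [he.isSquare_pow, (ZMod.natCast_eq_zero_iff_even).2 he]
      · have h1 : ¬IsSquare (c ^ Q.poly.natDegree) := by
          obtain ⟨n, hn⟩ := ho
          rw [hn, pow_succ]
          intro h
          apply hs
          have h3 := h.div (even_two_mul n |>.isSquare_pow c)
          rwa [mul_div_cancel_left₀ _ (pow_ne_zero _ hc)] at h3
        simp only [h1, hs, if_false, (ZMod.natCast_eq_one_iff_odd).2 ho]
        decide
  refine hred y hy (fun c hc => ?_) (fun Q => ?_) x hx
  · rw [hcomm]
    refine hred _ (by simpa using hc) (fun d hd => ?_) (fun Q => ?_) y hy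
    · rw [finsum_eq_zero_of_forall_eq_zero, coordInfty_C c hc, coordInfty_C d hd]
      · simp [planePair]
      · intro P
        rw [coord_C h2 P c hc, coord_C h2 P d hd]
        simp [planePair]
    · rw [hcomm]
      exact hCP c hc Q
  · rw [hcomm]
    refine hred _ (by simpa using Q.monic.ne_zero) (fun d hd => hCP d hd Q) (fun P => ?_) y hy
    rw [coordInfty_algebraMap, coordInfty_algebraMap]
    rcases eq_or_ne P Q with rfl | hne
    · rw [finsum_eq_zero_of_forall_eq_zero fun _ => planePair_self _, planePair_self, add_zero]
    · classical
      rw [finsum_eq_sum_of_support_subset (s := {P, Q})]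
      · rw [Finset.sum_pair hne, coord_self, coord_self, coord_algebraMap hne,
          coord_algebraMap hne.symm]
        simp only [Polynomial.isSquare_mk_comm h2 hi P.monic Q.monic
          fun h => hne (MonicIrred.ext h), planePair]
        split_ifs <;> simp <;> decide
      · intro R hR
        by_contra h
        simp only [Finset.coe_insert, Finset.coe_singleton, Set.mem_insert_iff,
          Set.mem_singleton_iff, not_or] at h
        apply hR
        change planePair _ _ = 0
        rw [coord_algebraMap (Ne.symm h.1), coord_algebraMap (Ne.symm h.2)]
        simp [planePair]

end MonicIrred

namespace Reduction

variable {A κ E : Type*} [CommRing A] [IsDomain A] [Field κ] [Field E] [Algebra A E]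
  [IsFractionRing A E] {p : A} {r : A →+* κ}

theorem one_add_mem_resSq_or [Finite κ] (h : Reduction p r) (hn : (-1 : E) ∈ resSq E r) {x : E}
    (hx0 : x ≠ 0) (hx : x ∉ resSq E r) : 1 + x ∈ resSq E r ∨ x * (1 + x) ∈ resSq E r := by
  by_cases hxU : x ∈ unitSq E r
  swap
  · exact h.rigidOutside x hx0 hxU
  have h1 : 1 + x ≠ 0 := fun h1 => hx (by rwa [← eq_neg_of_add_eq_zero_right h1] at hn)
  by_cases hyU : 1 + x ∈ unitSq E r
  · by_cases hyT : 1 + x ∈ resSq E r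
    · exact Or.inl hyT
    · exact Or.inr (resSq_index hxU hyU hx hyT)
  · exfalso
    have hnU := resSq_subset_unitSq hn
    have hneg : ∀ z, z ∈ resSq E r → -z ∈ resSq E r := fun z hz => by
      simpa using isSqGroup_resSq.mul_mem hn hz
    have h2 : -(1 + x) ∉ unitSq E r := fun h2 =>
      hyU (isSqGroup_unitSq.of_mul_left hnU (by simpa using h2))
    rcases h.rigidOutside _ (neg_ne_zero.2 h1) h2 with h3 | h3
    · exact hx (by simpa using hneg _ h3)
    · refine hyU (isSqGroup_unitSq.of_mul_right hxU (resSq_subset_unitSq ?_))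
      convert h3 using 1
      ring

end Reduction

namespace MonicIrred

variable {F : Type*} [Field F] [Finite F]

theorem coord_eq_zero (P : MonicIrred F) {x : RatFunc F} :
    P.coord x = 0 ↔ x ∈ resSq (RatFunc F) (AdjoinRoot.mk P.poly) :=
  (Polynomial.reduction (π := P.poly)).coord_eq_zero

theorem coord_algebraMap' (P : MonicIrred F) {f : F[X]} (hf : AdjoinRoot.mk P.poly f ≠ 0) :
    P.coord (algebraMap F[X] (RatFunc F) f) =
      (0, open Classical in if IsSquare (AdjoinRoot.mk P.poly f) then 0 else 1) :=
  (Polynomial.reduction (π := P.poly)).coord_algebraMap (E := RatFunc F) hf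

/-- A rational function is a square if all its coordinates vanish. -/
theorem isSquare_of_coord (h2 : ringChar F ≠ 2) {x : RatFunc F} (hx : x ≠ 0)
    (h : ∀ P : MonicIrred F, P.coord x = 0) : IsSquare x := by
  obtain ⟨c, f, g, hc, hm, hf, hg, rfl⟩ := RatFunc.exists_squarefree x hx
  have hC : RatFunc.C c ≠ 0 := by simpa using hc
  have hf0 : algebraMap F[X] (RatFunc F) f ≠ 0 := by simpa using hm.ne_zero
  have h' : ∀ P : MonicIrred F,
      P.coord (RatFunc.C c) + P.coord (algebraMap F[X] (RatFunc F) f) = 0 := fun P => by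
    rw [← P.mulAdd_coord _ _ hC hf0, ← h P, P.mulAdd_coord _ (g ^ 2) (mul_ne_zero hC hf0)
      (pow_ne_zero 2 hg), P.mulAdd_coord.map_sq hg, add_zero]
  by_cases h1 : f = 1
  · subst h1
    let P : MonicIrred F := ⟨Polynomial.X, Polynomial.monic_X, Polynomial.irreducible_X⟩
    have h3 := h' P
    rw [map_one, P.mulAdd_coord.map_one, add_zero, coord_C h2 P c hc] at h3
    have h4 := congrArg Prod.snd h3
    simp only [P, Polynomial.natDegree_X, pow_one, Prod.snd_zero] at h4
    split_ifs at h4 with h5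
    · obtain ⟨s, hs⟩ := h5
      rw [Polynomial.natDegree_X, pow_one] at hs
      subst hs
      exact ⟨RatFunc.C s * g, by rw [map_one, map_mul]; ring⟩
    · exact absurd h4 one_ne_zero
  · exfalso
    obtain ⟨π, hπm, hπ, q, rfl⟩ := Polynomial.exists_monic_irreducible_factor f
      (fun hu => h1 (hm.eq_one_of_isUnit hu))
    let P : MonicIrred F := ⟨π, hπm, hπ⟩
    have hq : AdjoinRoot.mk P.poly q ≠ 0 := fun h3 => by
      obtain ⟨q', rfl⟩ := AdjoinRoot.mk_eq_zero.1 h3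
      exact hπ.not_isUnit (hf π ⟨q', by rw [mul_assoc]⟩)
    have h3 := h' P
    rw [map_mul] at hf0
    rw [map_mul, P.mulAdd_coord _ _ (left_ne_zero_of_mul hf0) (right_ne_zero_of_mul hf0),
      coord_C h2 P c hc, show algebraMap F[X] (RatFunc F) π = algebraMap F[X] (RatFunc F) P.poly
        from rfl, coord_self, coord_algebraMap' P hq] at h3
    have h4 := congrArg Prod.fst h3
    simp at h4

theorem exists_not_isSquare_mk (h2 : ringChar F ≠ 2) (P : MonicIrred F) :
    ∃ f : F[X], AdjoinRoot.mk P.poly f ≠ 0 ∧ ¬IsSquare (AdjoinRoot.mk P.poly f) := by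
  have := Polynomial.finite_adjoinRoot P.monic
  have h3 : ringChar (AdjoinRoot P.poly) ≠ 2 := by rwa [← Algebra.ringChar_eq F]
  obtain ⟨x, hx⟩ := FiniteField.exists_nonsquare h3
  obtain ⟨f, rfl⟩ := AdjoinRoot.mk_surjective x
  exact ⟨f, fun h => hx (by simp [h]), hx⟩

theorem exists_coord (h2 : ringChar F ≠ 2) (P : MonicIrred F) :
    ∃ x : RatFunc F, x ≠ 0 ∧ P.coord x = (0, 1) := by
  obtain ⟨f, hf0, hf⟩ := P.exists_not_isSquare_mk h2
  refine ⟨algebraMap F[X] (RatFunc F) f, ?_, ?_⟩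
  · have : f ≠ 0 := fun h => hf0 (by simp [h])
    simpa using this
  · rw [coord_algebraMap' P hf0, if_neg hf]

theorem exists_separating (h2 : ringChar F ≠ 2) {P Q : MonicIrred F} (h : P ≠ Q) :
    ∃ x : RatFunc F, x ≠ 0 ∧ P.coord x = 0 ∧ Q.coord x ≠ 0 := by
  obtain ⟨f, hf0, hf⟩ := Q.exists_not_isSquare_mk h2
  have hPQ : AdjoinRoot.mk Q.poly P.poly ≠ 0 :=
    Polynomial.mk_ne_zero_of_ne P.monic Q.monic fun h1 => h (MonicIrred.ext h1)
  obtain ⟨g, hg⟩ := AdjoinRoot.mk_surjective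
    ((AdjoinRoot.mk Q.poly f - 1) / AdjoinRoot.mk Q.poly P.poly)
  have h1 : AdjoinRoot.mk Q.poly (1 + P.poly * g) = AdjoinRoot.mk Q.poly f := by
    rw [map_add, map_mul, hg, mul_div_cancel₀ _ hPQ, map_one, add_sub_cancel]
  have h3 : AdjoinRoot.mk P.poly (1 + P.poly * g) = 1 := by
    rw [map_add, map_mul, AdjoinRoot.mk_self, zero_mul, map_one, add_zero]
  refine ⟨algebraMap F[X] (RatFunc F) (1 + P.poly * g), ?_, ?_, ?_⟩
  · intro h4
    rw [(map_eq_zero_iff _ (IsFractionRing.injective F[X] (RatFunc F))).1 h4, map_zero] at h3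
    exact zero_ne_one h3
  · rw [coord_algebraMap' P (by rw [h3]; exact one_ne_zero), h3, if_pos IsSquare.one]
    rfl
  · rw [coord_algebraMap' Q (by rw [h1]; exact hf0), h1, if_neg hf]
    simp

theorem coord_neg_one (hi : IsSquare (-1 : F)) (P : MonicIrred F) : P.coord (-1) = 0 := by
  obtain ⟨s, hs⟩ := hi
  refine P.mulAdd_coord.map_isSquare (neg_ne_zero.2 one_ne_zero) ⟨RatFunc.C s, ?_⟩
  rw [← map_mul, ← hs, map_neg, map_one]

theorem coord_isotropic (hi : IsSquare (-1 : F)) (P : MonicIrred F) {ξ η : RatFunc F}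
    (hξ : ξ ≠ 0) (hη : η ≠ 0)
    (h : ∃ x y z : RatFunc F, (x ≠ 0 ∨ y ≠ 0 ∨ z ≠ 0) ∧ η * z ^ 2 = x ^ 2 + ξ * y ^ 2)
    (hP : P.coord ξ ≠ 0) : P.coord η = 0 ∨ P.coord (ξ * η) = 0 := by
  have := Polynomial.finite_adjoinRoot P.monic
  obtain ⟨x, y, z, hxyz, h⟩ := h
  have hm := P.mulAdd_coord
  have hn := P.coord_neg_one hi
  have hsq : ∀ w : RatFunc F, w ≠ 0 → P.coord (w ^ 2) = 0 := fun w hw => hm.map_sq hw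
  have hC : ∀ {w v : RatFunc F}, w ≠ 0 → v ≠ 0 → P.coord (w * v ^ 2) = P.coord w :=
    fun hw hv => by rw [hm _ _ hw (pow_ne_zero 2 hv), hsq _ hv, add_zero]
  have hz : z ≠ 0 := by
    rintro rfl
    have hy : y ≠ 0 := by
      rintro rfl
      have : x = 0 := by simpa using h.symm
      simp [this] at hxyz
    have hx : x ≠ 0 := by
      rintro rfl
      simp [hξ, hy] at h
    refine hP ?_
    rw [← hC hξ hy, show ξ * y ^ 2 = -1 * x ^ 2 by linear_combination -h, hC (by simp) hx, hn]
  by_cases hx : x = 0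
  · subst hx
    have hy : y ≠ 0 := by rintro rfl; simp [hη, hz] at h
    right
    rw [hm _ _ hξ hη, ← hC hη hz, show η * z ^ 2 = ξ * y ^ 2 by linear_combination h, hC hξ hy]
    exact CharTwo.add_self_eq_zero _
  by_cases hy : y = 0
  · subst hy
    left
    rw [← hC hη hz, show η * z ^ 2 = x ^ 2 by linear_combination h, hsq _ hx]
  have hyx : y / x ≠ 0 := div_ne_zero hy hx
  have h1 : η * z ^ 2 = (1 + ξ * (y / x) ^ 2) * x ^ 2 := by
    rw [h]; field_simp
  have h0 : 1 + ξ * (y / x) ^ 2 ≠ 0 := by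
    intro h0
    rw [h0, zero_mul] at h1
    simp [hη, hz] at h1
  have h3 : P.coord η = P.coord (1 + ξ * (y / x) ^ 2) := by rw [← hC hη hz, h1, hC h0 hx]
  have h4 := (Polynomial.reduction (π := P.poly)).one_add_mem_resSq_or (E := RatFunc F)
    (P.coord_eq_zero.1 hn) (mul_ne_zero hξ (pow_ne_zero 2 hyx))
    (fun h => hP (by rw [← hC hξ hyx]; exact P.coord_eq_zero.2 h))
  rw [← P.coord_eq_zero, ← P.coord_eq_zero] at h4
  rwa [hm _ _ (mul_ne_zero hξ (pow_ne_zero 2 hyx)) h0, hC hξ hyx, ← h3, ← hm _ _ hξ hη] at h4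

end MonicIrred

open NumberField IsDedekindDomain

theorem IsDedekindDomain.HeightOneSpectrum.mul_mem_evenSet_of_notMem {A E : Type*} [CommRing A]
    [IsDedekindDomain A] [Field E] [Algebra A E] [IsFractionRing A E] (P : HeightOneSpectrum A)
    {x y : E} (hx : x ≠ 0) (hy : y ≠ 0) (hxE : x ∉ evenSet (P.valuation E))
    (hyE : y ∉ evenSet (P.valuation E)) : x * y ∈ evenSet (P.valuation E) := by
  obtain ⟨t, ht, -, h⟩ := P.exists_uniformizer_evenSet (E := E)
  have ht0 : t ≠ 0 := by
    rintro rfl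
    rw [map_zero] at ht
    exact WithZero.exp_ne_zero ht.symm
  exact (isSqGroup_evenSet _).congr (w := t) (z := 1) ((isSqGroup_evenSet _).mul_mem
    ((h x hx).resolve_left hxE) ((h y hy).resolve_left hyE)) one_ne_zero (by ring)

/-- A map to the plane over `ZMod 2` which behaves like the square class map to a local field
in which `-1` is a square. -/
structure LocalSymbol {F : Type*} [Field F] (w : F → ZMod 2 × ZMod 2) : Prop where
  mulAdd : MulAdd w
  neg_one : w (-1) = 0
  rigid : ∀ c, c ≠ 0 → w c ≠ 0 → w (1 + c) = 0 ∨ w (c * (1 + c)) = 0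
  exists_fst : ∃ c, c ≠ 0 ∧ w c = (1, 0)
  exists_snd : ∃ c, c ≠ 0 ∧ w c = (0, 1)

namespace LocalSymbol

variable {F : Type*} [Field F] {w : F → ZMod 2 × ZMod 2}

theorem isSqGroup (h : LocalSymbol w) (p : ZMod 2 × ZMod 2) :
    IsSqGroup {c | c ≠ 0 ∧ (w c = 0 ∨ w c = p)} where
  zero_notMem h0 := h0.1 rfl
  sq_mem x hx := ⟨pow_ne_zero 2 hx, Or.inl (h.mulAdd.map_sq hx)⟩
  mul_mem := by
    rintro x y ⟨hx, h1⟩ ⟨hy, h2⟩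
    refine ⟨mul_ne_zero hx hy, ?_⟩
    rw [h.mulAdd x y hx hy]
    rcases h1 with h1 | h1 <;> rcases h2 with h2 | h2 <;> rw [h1, h2]
    · simp
    · simp
    · simp
    · exact Or.inl (CharTwo.add_self_eq_zero p)

theorem rigidPair (h : LocalSymbol w) :
    RigidPair {c | c ≠ 0 ∧ (w c = 0 ∨ w c = 0)}
      {x | x ∈ {c | c ≠ 0 ∧ (w c = 0 ∨ w c = 0)} ∨ -x ∈ {c | c ≠ 0 ∧ (w c = 0 ∨ w c = 0)}} where
  grpT := h.isSqGroup 0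
  grpH := (h.isSqGroup 0).pm
  sub x hx := Or.inl hx
  neg_one_mem := Or.inl ⟨neg_ne_zero.2 one_ne_zero, Or.inl h.neg_one⟩
  rigid x hx hxH := by
    have h1 : 1 + x ≠ 0 := fun h1 => hxH <| Or.inl
      ⟨hx, Or.inl (by rw [eq_neg_of_add_eq_zero_right h1, h.neg_one])⟩
    have h2 : w x ≠ 0 := fun h2 => hxH (Or.inl ⟨hx, Or.inl h2⟩)
    exact (h.rigid x hx h2).imp (fun h => ⟨h1, Or.inl h⟩)
      fun h => ⟨mul_ne_zero hx h1, Or.inl h⟩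

theorem exists_ne (h : LocalSymbol w) (p : ZMod 2 × ZMod 2) :
    ∃ c, c ≠ 0 ∧ w c ≠ 0 ∧ w c ≠ p := by
  obtain ⟨x, hx0, hx⟩ := h.exists_fst
  obtain ⟨y, hy0, hy⟩ := h.exists_snd
  by_cases hp : p = (1, 0)
  · exact ⟨y, hy0, by rw [hy]; decide, by rw [hy, hp]; decide⟩
  · exact ⟨x, hx0, by rw [hx]; decide, by rw [hx]; exact Ne.symm hp⟩

/-- A local symbol on a number field is the square class map at a nondyadic prime. -/
theorem exists_prime [NumberField F] (h : LocalSymbol w) :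
    ∃ Q : HeightOneSpectrum (𝓞 F),
      (∃ p, ∀ x ∈ evenSet (Q.valuation F), w x = 0 ∨ w x = p) ∧
      (∀ x, x ≠ 0 → w x = 0 → x ∈ evenSet (Q.valuation F)) ∧
      (∀ x ∈ oneSq (Q.valuation F), w x = 0) ∧ (2 : 𝓞 F) ∉ Q.asIdeal := by
  obtain ⟨p, hp, O, h1, h2, h3⟩ := h.rigidPair.exists_valuationSubring_of_rigid
  have hneg : ∀ x, x ≠ 0 → w (-x) = w x := fun x hx => by
    rw [← neg_one_mul, h.mulAdd _ _ (neg_ne_zero.2 one_ne_zero) hx, h.neg_one, zero_add]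
  have hT : ∀ x, (x ∈ {c | c ≠ 0 ∧ (w c = 0 ∨ w c = 0)} ∨
      -x ∈ {c | c ≠ 0 ∧ (w c = 0 ∨ w c = 0)}) → x ≠ 0 ∧ w x = 0 := by
    rintro x (⟨hx, h4⟩ | ⟨hx, h4⟩)
    · exact ⟨hx, h4.elim id id⟩
    · rw [neg_ne_zero] at hx
      rw [hneg x hx] at h4
      exact ⟨hx, h4.elim id id⟩
  have hH : ∀ x, ((x ∈ {c | c ≠ 0 ∧ (w c = 0 ∨ w c = 0)} ∨
      -x ∈ {c | c ≠ 0 ∧ (w c = 0 ∨ w c = 0)}) ∨ (x * p ∈ {c | c ≠ 0 ∧ (w c = 0 ∨ w c = 0)} ∨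
      -(x * p) ∈ {c | c ≠ 0 ∧ (w c = 0 ∨ w c = 0)})) → x ≠ 0 ∧ (w x = 0 ∨ w x = w p) := by
    rintro x (h4 | h4)
    · exact ⟨(hT x h4).1, Or.inl (hT x h4).2⟩
    · have h5 := hT _ h4
      have hx := left_ne_zero_of_mul h5.1
      rw [h.mulAdd _ _ hx hp] at h5
      exact ⟨hx, Or.inr ((CharTwo.add_eq_zero).1 h5.2)⟩
  obtain ⟨c, hc, hc0, hcp⟩ := h.exists_ne (w p)
  have hO : O ≠ ⊤ := by
    rintro rfl
    rcases h1 c hc fun h4 => (hH c h4).2.elim hc0 hcp with h4 | h4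
    · exact h4.2 trivial
    · exact h4.2 trivial
  obtain ⟨Q, hQ⟩ := O.exists_heightOneSpectrum (𝓞 F) hO (ringOfIntegers_mem_valuationSubring O)
  have hone : oneSq (Q.valuation F) ⊆ {c | c ≠ 0 ∧ (w c = 0 ∨ w c = 0)} :=
    oneSq_subset (h.isSqGroup 0) fun x hx => one_add_mem_of_valuation_lt_one (h.isSqGroup 0) h3 x
      ((Q.valuation_lt_one_iff_of_eq hQ x).2 hx)
  have heven : evenSet (Q.valuation F) ⊆ {c | c ≠ 0 ∧ (w c = 0 ∨ w c = w p)} :=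
    evenSet_subset (h.isSqGroup (w p)) fun x hx => by
      have hx0 := ne_zero_of_map_eq_one _ hx
      have h4 := (O.valuation_eq_one_iff_mem_inv_mem hx0).1
        ((Q.valuation_eq_one_iff_of_eq hQ x).2 hx)
      exact hH x (h2 x h4.1 h4.2 hx0)
  refine ⟨Q, ⟨w p, fun x hx => (heven hx).2⟩, fun x hx hwx => ?_,
    fun x hx => (hone hx).2.elim id id, fun h5 => ?_⟩
  · by_contra hxE
    have h4 := heven (Q.mul_mem_evenSet_of_notMem hx hc hxE fun h5 => (heven h5).2.elim hc0 hcp)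
    have h5 := h4.2
    rw [h.mulAdd _ _ hx hc, hwx, zero_add] at h5
    exact h5.elim hc0 hcp
  · have h6 : ∀ x ∈ evenSet (Q.valuation F), w x = 0 := fun x hx =>
      (hone (Q.evenSet_subset_oneSq h5 hx)).2.elim id id
    obtain ⟨x, hx0, hx⟩ := h.exists_fst
    obtain ⟨y, hy0, hy⟩ := h.exists_snd
    have h7 := h6 _ (Q.mul_mem_evenSet_of_notMem hx0 hy0
      (fun h7 => by have := h6 _ h7; rw [hx] at this; simp at this)
      (fun h7 => by have := h6 _ h7; rw [hy] at this; simp at this))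
    rw [h.mulAdd _ _ hx0 hy0, hx, hy] at h7
    simp at h7

end LocalSymbol

open scoped nonZeroDivisors

namespace NumberField

variable {F : Type*} [Field F] [NumberField F]

/-- Nonzero elements with trivial valuation outside `Ω`. -/
def UnitOutside (Ω : Set (HeightOneSpectrum (𝓞 F))) (x : F) : Prop :=
  x ≠ 0 ∧ ∀ Q ∉ Ω, Q.valuation F x = 1

namespace UnitOutside

variable {Ω : Set (HeightOneSpectrum (𝓞 F))} {x y : F}

theorem mul (hx : UnitOutside Ω x) (hy : UnitOutside Ω y) : UnitOutside Ω (x * y) :=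
  ⟨mul_ne_zero hx.1 hy.1, fun Q hQ => by rw [map_mul, hx.2 Q hQ, hy.2 Q hQ, mul_one]⟩

theorem prod {J : Type*} {f : J → F} (s : Finset J) (h : ∀ j ∈ s, UnitOutside Ω (f j)) :
    UnitOutside Ω (∏ j ∈ s, f j) :=
  Finset.prod_induction f (UnitOutside Ω) (fun _ _ => mul) ⟨one_ne_zero, by simp⟩ h

theorem mono {Ω' : Set (HeightOneSpectrum (𝓞 F))} (h : Ω ⊆ Ω') (hx : UnitOutside Ω x) :
    UnitOutside Ω' x :=
  ⟨hx.1, fun Q hQ => hx.2 Q fun h' => hQ (h h')⟩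

theorem algebraMap {a : 𝓞 F} (ha : a ≠ 0) (h : ∀ Q ∉ Ω, a ∉ Q.asIdeal) :
    UnitOutside Ω (algebraMap (𝓞 F) F a) := by
  refine ⟨by simpa using ha, fun Q hQ => ?_⟩
  rw [Q.valuation_of_algebraMap]
  exact HeightOneSpectrum.intValuation_eq_one_iff.2 (h Q hQ)

end UnitOutside

theorem exists_unit_not_isSquare :
    ∃ x : F, UnitOutside (∅ : Set (HeightOneSpectrum (𝓞 F))) x ∧ ¬IsSquare x := by
  have hns : ¬Function.Surjective fun ζ : Units.torsion F => ζ ^ 2 := by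
    rw [← Finite.injective_iff_surjective]
    intro hinj
    have hm : (-1 : (𝓞 F)ˣ) ∈ Units.torsion F :=
      (CommGroup.mem_torsion _).2 (isOfFinOrder_iff_pow_eq_one.2 ⟨2, by norm_num, by simp⟩)
    have h1 := hinj (a₁ := ⟨-1, hm⟩) (a₂ := 1) (by ext; simp)
    have h2 := congrArg (fun z : Units.torsion F => ((z : (𝓞 F)ˣ) : 𝓞 F)) h1
    simp only [Units.val_neg, Units.val_one, OneMemClass.coe_one] at h2
    have h3 : (2 : 𝓞 F) = 0 := by linear_combination -h2
    exact two_ne_zero h3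
  rw [Function.Surjective] at hns
  push Not at hns
  obtain ⟨ζ, hζ⟩ := hns
  refine ⟨algebraMap (𝓞 F) F (ζ : (𝓞 F)ˣ), .algebraMap (Units.ne_zero _) fun Q _ h =>
    Q.isPrime.ne_top (Ideal.eq_top_of_isUnit_mem _ h (Units.isUnit _)), ?_⟩
  rintro ⟨y, hy⟩
  have hyi : IsIntegral ℤ y := by
    refine IsIntegral.of_pow (n := 2) (by norm_num) ?_
    rw [pow_two, ← hy]
    exact RingOfIntegers.isIntegral_coe _
  obtain ⟨Y, rfl⟩ : ∃ Y : 𝓞 F, algebraMap (𝓞 F) F Y = y := ⟨⟨y, hyi⟩, rfl⟩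
  have hyy : ((ζ : (𝓞 F)ˣ) : 𝓞 F) = Y * Y := RingOfIntegers.ext (hy.trans (map_mul _ _ _).symm)
  have hu : IsUnit Y := isUnit_of_mul_isUnit_left (hyy ▸ Units.isUnit _)
  obtain ⟨u, hu⟩ := hu
  rw [← hu] at hyy
  have hyy' : (ζ : (𝓞 F)ˣ) = u ^ 2 := by ext; rw [hyy]; simp [pow_two]
  have htors : u ∈ Units.torsion F := by
    rw [Units.torsion, CommGroup.mem_torsion]
    have := (CommGroup.mem_torsion _).1 ζ.2
    rw [hyy'] at this
    exact this.of_pow (by norm_num)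
  exact hζ ⟨u, htors⟩ (Subtype.ext hyy'.symm)

theorem exists_generator (Q : HeightOneSpectrum (𝓞 F)) :
    ∃ x : F, UnitOutside {Q} x ∧ Q.valuation F x < 1 := by
  obtain ⟨n, hn, h1⟩ := isOfFinOrder_iff_pow_eq_one.1 (isOfFinOrder_of_finite
    (ClassGroup.mk0 ⟨Q.asIdeal, mem_nonZeroDivisors_of_ne_zero Q.ne_bot⟩))
  rw [← map_pow] at h1
  have h2 : Q.asIdeal ^ n ≠ 0 := pow_ne_zero n Q.ne_bot
  have h3 : (Q.asIdeal ^ n).IsPrincipal :=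
    (ClassGroup.mk0_eq_one_iff (mem_nonZeroDivisors_of_ne_zero h2)).1 h1
  obtain ⟨a, ha⟩ := h3.principal
  have ha0 : a ≠ 0 := by
    rintro rfl
    exact h2 (by simpa using ha)
  have hmem : a ∈ Q.asIdeal ^ n := ha ▸ Submodule.mem_span_singleton_self a
  refine ⟨algebraMap (𝓞 F) F a, .algebraMap ha0 fun Q' hQ' h => hQ' ?_,
    (Q.valuation_lt_one_iff_mem a).2 (Ideal.pow_le_self hn.ne' hmem)⟩
  have h4 : Q.asIdeal ^ n ≤ Q'.asIdeal := by
    rw [ha]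
    exact (Submodule.span_singleton_le_iff_mem _ _).2 h
  have h5 : Q.asIdeal ≤ Q'.asIdeal := Q'.isPrime.le_of_pow_le h4
  exact (HeightOneSpectrum.ext (Q.isMaximal.eq_of_le Q'.isPrime.ne_top h5)).symm

/-- Independent square classes which are trivial outside a finite set of primes. -/
theorem exists_independent (Ω : Finset (HeightOneSpectrum (𝓞 F))) :
    ∃ s : Finset F, s.card = Ω.card + 1 ∧ (∀ x ∈ s, UnitOutside (Ω : Set _) x) ∧
      ∀ A ⊆ s, IsSquare (∏ x ∈ A, x) → A = ∅ := by
  classical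
  induction Ω using Finset.induction_on with
  | empty =>
    obtain ⟨x, hx, hxs⟩ := exists_unit_not_isSquare (F := F)
    refine ⟨{x}, by simp, by simpa using hx, fun A hA h => ?_⟩
    rcases Finset.subset_singleton_iff.1 hA with rfl | rfl
    · rfl
    · exact absurd (by simpa using h) hxs
  | insert Q Ω hQ ih =>
    obtain ⟨s, hs, hu, hi⟩ := ih
    let o : F → ℤ := fun x => WithZero.log (Q.valuation F x)
    have homul : ∀ x y, x ≠ 0 → y ≠ 0 → o (x * y) = o x + o y := fun x y hx hy => by
      simp only [o, map_mul]
      exact WithZero.log_mul ((Valuation.ne_zero_iff _).2 hx) ((Valuation.ne_zero_iff _).2 hy)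
    have hoinv : ∀ x, o x⁻¹ = -o x := fun x => by
      simp only [o, map_inv₀, WithZero.log_inv]
    have hou : ∀ x, UnitOutside (Ω : Set _) x → o x = 0 := fun x hx => by
      simp only [o, hx.2 Q (by simpa using hQ), WithZero.log_one]
    have hex : ∃ n : ℕ, ∃ x, UnitOutside (insert Q Ω : Finset _) x ∧ 0 < n ∧ o x = -n := by
      obtain ⟨x, hx, h1⟩ := exists_generator Q
      have h0 : Q.valuation F x ≠ 0 := (Valuation.ne_zero_iff _).2 hx.1
      have h2 : o x < 0 := by
        rw [← WithZero.exp_log h0, ← WithZero.exp_zero, WithZero.exp_lt_exp] at h1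
        exact h1
      exact ⟨(-o x).toNat, x, hx.mono (by simp), by omega, by omega⟩
    obtain ⟨x, hx, hn, hox⟩ := Nat.find_spec hex
    have hxs : x ∉ s := fun h => by
      have := hou x (hu x h)
      omega
    refine ⟨insert x s, ?_, ?_, ?_⟩
    · rw [Finset.card_insert_of_notMem hxs, Finset.card_insert_of_notMem hQ, hs]
    · intro y hy
      rcases Finset.mem_insert.1 hy with rfl | hy
      · exact hx
      · exact (hu y hy).mono (by simp)
    · intro A hA hsq
      by_cases hxA : x ∈ A
      · exfalso
        rw [← Finset.mul_prod_erase A (fun x => x) hxA] at hsq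
        obtain ⟨y, hy⟩ := hsq
        have hA' : UnitOutside (Ω : Set _) (∏ x ∈ A.erase x, x) := .prod _ fun z hz => by
          have h3 := Finset.mem_erase.1 hz
          exact hu z ((Finset.mem_insert.1 (hA h3.2)).resolve_left h3.1)
        have hxu := hx.mul (hA'.mono (Ω' := ((insert Q Ω : Finset _) : Set _)) (by simp))
        have hy0 : y ≠ 0 := by
          rintro rfl
          exact hxu.1 (by simpa using hy)
        have hoy : o x = o y + o y := by
          rw [← homul y y hy0 hy0, ← hy, homul _ _ hx.1 hA'.1, hou _ hA', add_zero]
        have hyu : UnitOutside ((insert Q Ω : Finset _) : Set _) y := by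
          refine ⟨hy0, fun Q' hQ' => ?_⟩
          have h4 := hxu.2 Q' hQ'
          rw [hy, map_mul, ← pow_two] at h4
          rw [← WithZero.exp_log ((Valuation.ne_zero_iff (Q'.valuation F)).2 hy0),
            ← WithZero.exp_nsmul, ← WithZero.exp_zero] at h4
          have h5 := WithZero.exp_injective h4
          rw [← WithZero.exp_log ((Valuation.ne_zero_iff (Q'.valuation F)).2 hy0),
            ← WithZero.exp_zero]
          congr 1
          simpa using h5
        have h5 := Nat.find_min' hex ⟨y, hyu, (show 0 < (-o y).toNat by omega), by omega⟩
        omega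
      · exact hi A (fun z hz => (Finset.mem_insert.1 (hA hz)).resolve_left
          (by rintro rfl; exact hxA hz)) hsq

theorem not_isUnit_two : ¬IsUnit (2 : 𝓞 F) := by
  intro h
  obtain ⟨b, hb⟩ := h.exists_right_inv
  have h1 : (b : F) = algebraMap ℚ F (1 / 2) := by
    have h3 := congrArg (algebraMap (𝓞 F) F) hb
    rw [map_mul, map_one, map_ofNat] at h3
    rw [map_div₀, map_one, map_ofNat]
    exact eq_div_of_mul_eq two_ne_zero (by rw [mul_comm]; exact h3)
  have h2 : IsIntegral ℤ (1 / 2 : ℚ) :=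
    (isIntegral_algebraMap_iff (algebraMap ℚ F).injective).1
      (h1 ▸ RingOfIntegers.isIntegral_coe b)
  obtain ⟨n, hn⟩ := IsIntegrallyClosed.isIntegral_iff.1 h2
  have h4 : (2 * n : ℚ) = 1 := by
    rw [eq_intCast] at hn
    rw [hn]
    norm_num
  norm_cast at h4
  omega

/-- Outside a finite set of primes, each prime has a generator up to primes in the set. -/
theorem exists_finset_generators :
    ∃ Ω : Finset (HeightOneSpectrum (𝓞 F)), (∃ Q ∈ Ω, (2 : 𝓞 F) ∈ Q.asIdeal) ∧
      ∀ Q ∉ Ω, ∃ b : F, UnitOutside (insert Q (Ω : Set _)) b ∧ b ∉ evenSet (Q.valuation F) := by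
  classical
  choose J hJ using ClassGroup.mk0_surjective (R := 𝓞 F)
  have hJ0 : ∀ c, (J c : Ideal (𝓞 F)) ≠ 0 := fun c => nonZeroDivisors.ne_zero (J c).2
  have h2 : (Ideal.span {(2 : 𝓞 F)}) ≠ 0 := by simp
  obtain ⟨M, hM, hM2⟩ := Ideal.exists_le_maximal (Ideal.span {(2 : 𝓞 F)}) fun h =>
    not_isUnit_two (Ideal.span_singleton_eq_top.1 h)
  have h2M : (2 : 𝓞 F) ∈ M := hM2 (Ideal.mem_span_singleton_self 2)
  let 𝔭 : HeightOneSpectrum (𝓞 F) := ⟨M, hM.isPrime, fun h => by simp [h] at h2M⟩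
  have hfin : (⋃ c, {v : HeightOneSpectrum (𝓞 F) | v.asIdeal ∣ J c}).Finite :=
    Set.finite_iUnion fun c => Ideal.finite_factors (hJ0 c)
  refine ⟨insert 𝔭 hfin.toFinset, ⟨𝔭, by simp, h2M⟩, fun Q hQ => ?_⟩
  set Ω := insert 𝔭 hfin.toFinset
  let c := (ClassGroup.mk0 ⟨Q.asIdeal, mem_nonZeroDivisors_of_ne_zero Q.ne_bot⟩)⁻¹
  have hdvd : ∀ Q' : HeightOneSpectrum (𝓞 F), Q'.asIdeal ∣ J c → Q' ∈ Ω := fun Q' h =>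
    Finset.mem_insert_of_mem (hfin.mem_toFinset.2 (Set.mem_iUnion.2 ⟨c, h⟩))
  have h3 : Q.asIdeal * (J c : Ideal (𝓞 F)) ≠ 0 := mul_ne_zero Q.ne_bot (hJ0 c)
  have h1 : ClassGroup.mk0 ⟨Q.asIdeal * (J c : Ideal (𝓞 F)),
      mem_nonZeroDivisors_of_ne_zero h3⟩ = 1 := by
    have : (⟨Q.asIdeal * (J c : Ideal (𝓞 F)), mem_nonZeroDivisors_of_ne_zero h3⟩ : (Ideal (𝓞 F))⁰) =
      (⟨Q.asIdeal, mem_nonZeroDivisors_of_ne_zero Q.ne_bot⟩ : (Ideal (𝓞 F))⁰) * J c := rfl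
    rw [this, map_mul, hJ, mul_inv_cancel]
  obtain ⟨a, ha⟩ := ((ClassGroup.mk0_eq_one_iff (mem_nonZeroDivisors_of_ne_zero h3)).1 h1).principal
  have ha' : Q.asIdeal * (J c : Ideal (𝓞 F)) = Ideal.span {a} := ha
  have ha0 : a ≠ 0 := by
    rintro rfl
    exact h3 (by simpa using ha')
  refine ⟨algebraMap (𝓞 F) F a, .algebraMap ha0 fun Q' hQ' h => hQ' ?_, ?_⟩
  · rw [← Ideal.dvd_span_singleton, ← ha', Q'.prime.dvd_mul] at h
    rcases h with h | h
    · have h5 : Q.asIdeal ≤ Q'.asIdeal := Ideal.le_of_dvd h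
      exact Or.inl (HeightOneSpectrum.ext (Q.isMaximal.eq_of_le Q'.isPrime.ne_top h5)).symm
    · exact Or.inr (hdvd Q' h)
  · have hv1 : Q.valuation F (algebraMap (𝓞 F) F a) ≤ WithZero.exp (-((1 : ℕ) : ℤ)) := by
      rw [Q.valuation_of_algebraMap, Q.intValuation_le_pow_iff_dvd, ← ha', pow_one]
      exact dvd_mul_right _ _
    have hv2 : ¬Q.valuation F (algebraMap (𝓞 F) F a) ≤ WithZero.exp (-((2 : ℕ) : ℤ)) := by
      rw [Q.valuation_of_algebraMap, Q.intValuation_le_pow_iff_dvd, ← ha', pow_two]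
      intro h
      exact hQ (hdvd Q ((mul_dvd_mul_iff_left Q.ne_bot).1 h))
    rintro ⟨u, g, hg, hu, h⟩
    rw [h, map_mul, hu, one_mul, map_pow,
      ← WithZero.exp_log ((Valuation.ne_zero_iff (Q.valuation F)).2 hg),
      ← WithZero.exp_nsmul, WithZero.exp_le_exp] at hv1 hv2
    simp at hv1 hv2
    omega

end NumberField

theorem planePair_smul_left (c : ZMod 2) (a b : ZMod 2 × ZMod 2) :
    planePair (c • a) b = c * planePair a b := by
  simp only [planePair, Prod.smul_fst, Prod.smul_snd, smul_eq_mul]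
  ring

/-- The orthogonal sum of copies of the plane over `ZMod 2`. -/
noncomputable def planeForm (T : Type*) [Fintype T] :
    LinearMap.BilinForm (ZMod 2) (T → ZMod 2 × ZMod 2) :=
  LinearMap.mk₂ (ZMod 2) (fun u v => ∑ t, planePair (u t) (v t))
    (fun u v w => by simp [planePair_add_left, Finset.sum_add_distrib])
    (fun c u v => by simp [planePair_smul_left, Finset.mul_sum])
    (fun u v w => by
      simp_rw [planePair_comm (u _)]
      simp [planePair_add_left, Finset.sum_add_distrib])
    (fun c u v => by
      simp_rw [planePair_comm (u _)]
      simp [planePair_smul_left, Finset.mul_sum])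

theorem planeForm_apply {T : Type*} [Fintype T] (u v : T → ZMod 2 × ZMod 2) :
    planeForm T u v = ∑ t, planePair (u t) (v t) := rfl

theorem planeForm_nondegenerate (T : Type*) [Fintype T] : (planeForm T).Nondegenerate := by
  classical
  have hr : (planeForm T).IsRefl := fun u v h => by
    rw [planeForm_apply] at h ⊢
    simpa only [planePair_comm] using h
  refine hr.nondegenerate_iff_separatingLeft.2 ?_
  intro u hu
  ext t : 1
  have key : ∀ a, planePair (u t) a = 0 := fun a => by
    have h := hu (Pi.single t a)
    rw [planeForm_apply, Finset.sum_eq_single t] at h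
    · simpa using h
    · intro b _ hb
      simp [hb, planePair]
    · simp
  have h1 := key (1, 0)
  have h2 := key (0, 1)
  simp only [planePair, mul_one, mul_zero, zero_add, add_zero] at h1 h2
  exact Prod.ext h2 h1

/-- A totally isotropic subspace has at most half the dimension. -/
theorem card_le_of_isotropic {J T : Type*} [Fintype J] [Fintype T]
    {u : J → T → ZMod 2 × ZMod 2} (hu : LinearIndependent (ZMod 2) u)
    (h : ∀ i j, ∑ t, planePair (u i t) (u j t) = 0) : Fintype.card J ≤ Fintype.card T := by
  set U := Submodule.span (ZMod 2) (Set.range u)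
  have h1 : Module.finrank (ZMod 2) U = Fintype.card J := finrank_span_eq_card hu
  have h2 : U ≤ (planeForm T).orthogonal U := by
    refine Submodule.span_le.2 ?_
    rintro _ ⟨j, rfl⟩
    rw [SetLike.mem_coe, LinearMap.BilinForm.mem_orthogonal_iff]
    intro v hv
    induction hv using Submodule.span_induction with
    | mem v hv =>
      obtain ⟨i, rfl⟩ := hv
      exact h i j
    | zero => simp
    | add x y _ _ hx hy =>
      rw [map_add, LinearMap.add_apply, hx, hy, add_zero]
    | smul c x _ hx =>
      rw [map_smul, LinearMap.smul_apply, hx, smul_zero]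
  have h3 := Submodule.finrank_mono h2
  rw [LinearMap.BilinForm.finrank_orthogonal (planeForm_nondegenerate T), h1] at h3
  have h4 : Module.finrank (ZMod 2) (T → ZMod 2 × ZMod 2) = Fintype.card T * 2 := by
    rw [Module.finrank_pi_fintype]
    simp
  omega

/-- Local symbols satisfying a product formula with one exceptional term. -/
structure GlobalSymbol {F I : Type*} [Field F] (w : I → F → ZMod 2 × ZMod 2)
    (wi : F → ZMod 2 × ZMod 2) : Prop where
  localSymbol : ∀ i, LocalSymbol (w i)
  isSquare : ∀ c, c ≠ 0 → (∀ i, w i c = 0) → IsSquare c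
  separating : ∀ i j, i ≠ j → ∃ x, x ≠ 0 ∧ w i x = 0 ∧ w j x ≠ 0
  reciprocity : ∀ x y, x ≠ 0 → y ≠ 0 →
    ∑ᶠ i, planePair (w i x) (w i y) + planePair (wi x) (wi y) = 0

namespace GlobalSymbol

variable {F I : Type*} [Field F] [NumberField F] {w : I → F → ZMod 2 × ZMod 2}
  {wi : F → ZMod 2 × ZMod 2}

theorem exists_primes (h : GlobalSymbol w wi) :
    ∃ Q : I → HeightOneSpectrum (𝓞 F), Function.Injective Q ∧
      (∀ i, ∀ x ∈ evenSet ((Q i).valuation F), ∀ y ∈ evenSet ((Q i).valuation F),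
        planePair (w i x) (w i y) = 0) ∧
      (∀ i x, x ≠ 0 → w i x = 0 → x ∈ evenSet ((Q i).valuation F)) ∧
      ∀ i, (2 : 𝓞 F) ∉ (Q i).asIdeal := by
  choose Q hQ1 hQ2 hQ3 hQ4 using fun i => (h.localSymbol i).exists_prime
  refine ⟨Q, fun i j hij => ?_, fun i x hx y hy => ?_, hQ2, hQ4⟩
  · by_contra hne
    obtain ⟨x, hx0, hxi, hxj⟩ := h.separating i j hne
    obtain ⟨z, hz0, hzi, hzj⟩ := h.separating j i (Ne.symm hne)
    have hxE := hQ2 i x hx0 hxi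
    have hzE := hQ2 j z hz0 hzi
    rw [← hij] at hzE
    have hxn : x ∉ oneSq ((Q i).valuation F) := fun h1 => hxj (hQ3 j x (hij ▸ h1))
    have hzn : z ∉ oneSq ((Q i).valuation F) := fun h1 => hzj (hQ3 i z h1)
    obtain ⟨u, hu, hu2⟩ := (Q i).exists_oneSq_coset (E := F)
    have h1 := (isSqGroup_oneSq _).mul_mem ((hu2 x hxE).resolve_left hxn)
      ((hu2 z hzE).resolve_left hzn)
    have h2 : x * z ∈ oneSq ((Q i).valuation F) :=
      (isSqGroup_oneSq _).congr (w := u) (z := 1) h1 one_ne_zero (by ring)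
    have h3 := hQ3 i _ h2
    rw [(h.localSymbol i).mulAdd _ _ hx0 hz0, hxi, zero_add] at h3
    exact hzj h3
  · obtain ⟨p, hp⟩ := hQ1 i
    rcases hp x hx with h1 | h1 <;> rcases hp y hy with h2 | h2 <;> rw [h1, h2]
    · simp [planePair]
    · simp [planePair]
    · simp [planePair]
    · exact planePair_self p

theorem zmod_two_eq_ite (a : ZMod 2) : a = if a ≠ 0 then 1 else 0 := by
  revert a
  decide

/-- There are no such symbols on a number field. -/
theorem false (h : GlobalSymbol w wi) : False := by
  classical
  obtain ⟨Q, hinj, hpair, heven, htwo⟩ := h.exists_primes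
  obtain ⟨Ω₀, ⟨𝔭, h𝔭, h𝔭2⟩, hgen⟩ := exists_finset_generators (F := F)
  obtain ⟨s, hs, hsu, hsi⟩ := exists_independent Ω₀
  have hdet : ∀ A : s.powerset, ∃ i : Option I, A.1 ≠ ∅ → ∃ i', i = some i' ∧
      w i' (∏ x ∈ A.1, x) ≠ 0 := by
    rintro ⟨A, hA⟩
    rw [Finset.mem_powerset] at hA
    by_cases hA0 : A = ∅
    · exact ⟨none, fun h => absurd hA0 h⟩
    · have h1 : ¬∀ i, w i (∏ x ∈ A, x) = 0 := fun h1 =>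
        hA0 (hsi A hA (h.isSquare _ (UnitOutside.prod _ fun x hx => hsu x (hA hx)).1 h1))
      push Not at h1
      obtain ⟨i, hi⟩ := h1
      exact ⟨some i, fun _ => ⟨i, rfl, hi⟩⟩
  choose det hdet using hdet
  let Ω₁ : Finset (HeightOneSpectrum (𝓞 F)) :=
    (((Finset.univ.image det).eraseNone).image Q) \ Ω₀
  have hΩ₁ : ∀ q : Ω₁, q.1 ∉ Ω₀ := fun q => (Finset.mem_sdiff.1 q.2).2
  choose b hbu hbe using fun q : Ω₁ => hgen q.1 (hΩ₁ q)
  let S : Finset I := (Ω₀ ∪ Ω₁).preimage Q hinj.injOn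
  have hmemS : ∀ i, i ∈ S ↔ Q i ∈ Ω₀ ∪ Ω₁ := fun i => Finset.mem_preimage
  have hScard : S.card < Ω₀.card + Ω₁.card := by
    have h1 : S.card ≤ ((Ω₀ ∪ Ω₁).erase 𝔭).card := by
      refine Finset.card_le_card_of_injOn Q (fun i hi => ?_) hinj.injOn
      refine Finset.mem_coe.2 (Finset.mem_erase.2 ⟨?_, (hmemS i).1 hi⟩)
      intro h2
      exact htwo i (h2 ▸ h𝔭2)
    have h2 : ((Ω₀ ∪ Ω₁).erase 𝔭).card < (Ω₀ ∪ Ω₁).card :=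
      Finset.card_erase_lt_of_mem (Finset.mem_union_left _ h𝔭)
    have h3 := Finset.card_union_le Ω₀ Ω₁
    omega
  let e : s ⊕ Ω₁ → F := Sum.elim (fun x => x.1) b
  have he : ∀ j, UnitOutside ((Ω₀ ∪ Ω₁ : Finset _) : Set _) (e j) := by
    rintro (x | q)
    · exact (hsu x.1 x.2).mono (by simp)
    · refine (hbu q).mono ?_
      rw [Finset.coe_union]
      exact Set.insert_subset (Or.inr q.2) Set.subset_union_left
  let u : s ⊕ Ω₁ → Option S → ZMod 2 × ZMod 2 := fun j t => t.elim (wi (e j)) fun i => w i (e j)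
  have hind : LinearIndependent (ZMod 2) u := by
    rw [Fintype.linearIndependent_iff]
    intro g hg
    let A : Finset (s ⊕ Ω₁) := {j | g j ≠ 0}
    have hz : ∀ i ∈ S, w i (∏ j ∈ A, e j) = 0 := by
      intro i hi
      rw [(h.localSymbol i).mulAdd.map_prod A e fun j => (he j).1, Finset.sum_filter]
      have h1 := congrFun hg (some ⟨i, hi⟩)
      rw [Finset.sum_apply] at h1
      refine Eq.trans ?_ h1
      refine Finset.sum_congr rfl fun j _ => ?_
      rw [Pi.smul_apply]
      have h2 : g j = if g j ≠ 0 then 1 else 0 := zmod_two_eq_ite (g j)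
      split_ifs at h2 ⊢ with h3 <;> simp [h2, u]
    have hinr : ∀ q : Ω₁, Sum.inr q ∉ A := by
      intro q hq
      obtain ⟨i, -, hi⟩ := Finset.mem_image.1 (Finset.mem_sdiff.1 q.2).1
      have hiS : i ∈ S := (hmemS i).2 (Finset.mem_union_right _ (hi ▸ q.2))
      have hA0 : ∏ j ∈ A, e j ≠ 0 := Finset.prod_ne_zero_iff.2 fun j _ => (he j).1
      have h1 := heven i _ hA0 (hz i hiS)
      rw [hi, ← Finset.mul_prod_erase A e hq] at h1
      refine hbe q ((isSqGroup_evenSet _).of_mul_right ?_ h1)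
      refine mem_evenSet_of_map_eq_one _ ?_
      rw [map_prod]
      refine Finset.prod_eq_one fun j hj => ?_
      rcases j with x | q'
      · exact (hsu x.1 x.2).2 _ (hΩ₁ q)
      · refine (hbu q').2 _ ?_
        rintro (h2 | h2)
        · exact (Finset.mem_erase.1 hj).1 (congrArg Sum.inr (Subtype.ext h2.symm))
        · exact hΩ₁ q h2
    have hA : A = ∅ := by
      by_contra hne
      let A' : Finset F := A.image e
      have hA's : A' ⊆ s := by
        intro x hx
        obtain ⟨j, hj, rfl⟩ := Finset.mem_image.1 hx
        rcases j with x | q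
        · exact x.2
        · exact absurd hj (hinr q)
      have hprod : ∏ x ∈ A', x = ∏ j ∈ A, e j := by
        refine Finset.prod_image (f := fun x => x) ?_
        intro j hj j' hj' hjj
        rcases j with x | q
        · rcases j' with x' | q'
          · exact congrArg Sum.inl (Subtype.ext hjj)
          · exact absurd hj' (hinr q')
        · exact absurd hj (hinr q)
      obtain ⟨i, hi, hi2⟩ := hdet ⟨A', Finset.mem_powerset.2 hA's⟩ fun h1 =>
        hne (Finset.image_eq_empty.1 h1)
      refine hi2 (hprod ▸ hz i ((hmemS i).2 ?_))
      by_cases h2 : Q i ∈ Ω₀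
      · exact Finset.mem_union_left _ h2
      · refine Finset.mem_union_right _ (Finset.mem_sdiff.2 ⟨Finset.mem_image_of_mem Q ?_, h2⟩)
        rw [Finset.mem_eraseNone, ← hi]
        exact Finset.mem_image_of_mem _ (Finset.mem_univ _)
    intro j
    by_contra hj
    have : j ∈ A := Finset.mem_filter.2 ⟨Finset.mem_univ _, hj⟩
    simp [hA] at this
  have hort : ∀ i j, ∑ t, planePair (u i t) (u j t) = 0 := by
    intro j j'
    rw [Fintype.sum_option, ← h.reciprocity (e j) (e j') (he j).1 (he j').1, add_comm]
    congr 1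
    rw [finsum_eq_sum_of_support_subset (s := S)]
    · exact Finset.sum_coe_sort S fun i => planePair (w i (e j)) (w i (e j'))
    · intro i hi
      by_contra hiS
      rw [Finset.mem_coe, hmemS] at hiS
      exact hi (hpair i _ (mem_evenSet_of_map_eq_one _ ((he j).2 _ hiS)) _
        (mem_evenSet_of_map_eq_one _ ((he j').2 _ hiS)))
  have hcard := card_le_of_isotropic hind hort
  simp only [Fintype.card_sum, Fintype.card_coe, Fintype.card_option] at hcard
  omega

end GlobalSymbol

/-- A correspondence of square classes from a field to a rational function field, under which
representations of `1 + c` by the form `1, c` become isotropic ternary forms. -/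
structure RatFuncRel {F κ : Type*} [Field F] [Field κ] (Ψ : F → RatFunc κ → Prop) : Prop where
  ne_zero : ∀ c ξ, Ψ c ξ → ξ ≠ 0
  left_total : ∀ c, c ≠ 0 → ∃ ξ, Ψ c ξ
  right_total : ∀ ξ, ξ ≠ 0 → ∃ c, c ≠ 0 ∧ Ψ c ξ
  mul : ∀ c ξ c' ξ', Ψ c ξ → Ψ c' ξ' → Ψ (c * c') (ξ * ξ')
  isSquare : ∀ c ξ, Ψ c ξ → IsSquare ξ → IsSquare c
  unique : ∀ c ξ ξ', Ψ c ξ → Ψ c ξ' → IsSquare (ξ * ξ')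
  neg_one : Ψ (-1) 1
  isotropic : ∀ c ξ η, Ψ c ξ → Ψ (1 + c) η →
    ∃ x y z : RatFunc κ, (x ≠ 0 ∨ y ≠ 0 ∨ z ≠ 0) ∧ η * z ^ 2 = x ^ 2 + ξ * y ^ 2

namespace RatFuncRel

variable {F κ : Type*} [Field F] [Field κ] {Ψ : F → RatFunc κ → Prop}

theorem eq_of_rel (h : RatFuncRel Ψ) {w : RatFunc κ → ZMod 2 × ZMod 2} (hw : MulAdd w) {c : F}
    {ξ ξ' : RatFunc κ} (h1 : Ψ c ξ) (h2 : Ψ c ξ') : w ξ = w ξ' := by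
  have hξ := h.ne_zero _ _ h1
  have hξ' := h.ne_zero _ _ h2
  have := hw.map_isSquare (mul_ne_zero hξ hξ') (h.unique _ _ _ h1 h2)
  rw [hw _ _ hξ hξ'] at this
  exact CharTwo.add_eq_zero.1 this

open Classical in
/-- A choice of a corresponding rational function. -/
noncomputable def lift (Ψ : F → RatFunc κ → Prop) (c : F) : RatFunc κ :=
  if h : ∃ ξ, Ψ c ξ then h.choose else 0

theorem lift_spec (h : RatFuncRel Ψ) {c : F} (hc : c ≠ 0) : Ψ c (lift Ψ c) := by
  have h1 := h.left_total c hc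
  rw [lift, dif_pos h1]
  exact h1.choose_spec

theorem map_lift (h : RatFuncRel Ψ) {w : RatFunc κ → ZMod 2 × ZMod 2} (hw : MulAdd w) {c : F}
    {ξ : RatFunc κ} (hc : c ≠ 0) (h1 : Ψ c ξ) : w (lift Ψ c) = w ξ :=
  h.eq_of_rel hw (h.lift_spec hc) h1

theorem mulAdd_lift (h : RatFuncRel Ψ) {w : RatFunc κ → ZMod 2 × ZMod 2} (hw : MulAdd w) :
    MulAdd fun c => w (lift Ψ c) := by
  intro x y hx hy
  have h1 := h.lift_spec hx
  have h2 := h.lift_spec hy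
  change w (lift Ψ (x * y)) = w (lift Ψ x) + w (lift Ψ y)
  rw [h.map_lift hw (mul_ne_zero hx hy) (h.mul _ _ _ _ h1 h2),
    hw _ _ (h.ne_zero _ _ h1) (h.ne_zero _ _ h2)]

theorem globalSymbol [Finite κ] (h2 : ringChar κ ≠ 2) (hi : IsSquare (-1 : κ))
    (h : RatFuncRel Ψ) :
    GlobalSymbol (fun (P : MonicIrred κ) c => P.coord (lift Ψ c))
      (fun c => MonicIrred.coordInfty (lift Ψ c)) := by
  have h0 : ∀ {c}, c ≠ 0 → lift Ψ c ≠ 0 := fun hc => h.ne_zero _ _ (h.lift_spec hc)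
  refine ⟨fun P => ⟨h.mulAdd_lift P.mulAdd_coord, ?_, ?_, ?_, ?_⟩, ?_, ?_, ?_⟩
  · rw [h.map_lift P.mulAdd_coord (neg_ne_zero.2 one_ne_zero) h.neg_one]
    exact P.mulAdd_coord.map_one
  · intro c hc hw
    have hm := P.mulAdd_coord
    by_cases hc1 : 1 + c = 0
    · rw [eq_neg_of_add_eq_zero_right hc1, h.map_lift hm (neg_ne_zero.2 one_ne_zero) h.neg_one,
        hm.map_one] at hw
      exact absurd rfl hw
    · have e := h.mulAdd_lift hm c (1 + c) hc hc1
      refine (P.coord_isotropic hi (h0 hc) (h0 hc1)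
        (h.isotropic _ _ _ (h.lift_spec hc) (h.lift_spec hc1)) hw).imp id fun h3 => ?_
      rwa [hm _ _ (h0 hc) (h0 hc1), ← e] at h3
  · obtain ⟨c, hc, h3⟩ := h.right_total (algebraMap κ[X] (RatFunc κ) P.poly)
      (by simpa using P.irreducible.ne_zero)
    exact ⟨c, hc, by rw [h.map_lift P.mulAdd_coord hc h3, P.coord_self]⟩
  · obtain ⟨ξ, hξ, h3⟩ := P.exists_coord h2
    obtain ⟨c, hc, h4⟩ := h.right_total ξ hξ
    exact ⟨c, hc, by rw [h.map_lift P.mulAdd_coord hc h4, h3]⟩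
  · intro c hc hw
    exact h.isSquare _ _ (h.lift_spec hc) (MonicIrred.isSquare_of_coord h2 (h0 hc) hw)
  · intro P Q hPQ
    obtain ⟨ξ, hξ, hP, hQ⟩ := MonicIrred.exists_separating h2 hPQ
    obtain ⟨c, hc, h4⟩ := h.right_total ξ hξ
    exact ⟨c, hc, by rw [h.map_lift P.mulAdd_coord hc h4, hP],
      by rwa [h.map_lift Q.mulAdd_coord hc h4]⟩
  · intro x y hx hy
    exact MonicIrred.reciprocity h2 hi (h0 hx) (h0 hy)

theorem false [NumberField F] [Finite κ] (h2 : ringChar κ ≠ 2) (hi : IsSquare (-1 : κ))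
    (h : RatFuncRel Ψ) : False :=
  (h.globalSymbol h2 hi).false

end RatFuncRel

/-- A Witt equivalence, viewed as a relation between nonzero elements. -/
structure WittRel {K L : Type*} [Field K] [Field L] (R : K → L → Prop) : Prop where
  left_ne : ∀ {x y}, R x y → x ≠ 0
  right_ne : ∀ {x y}, R x y → y ≠ 0
  left_total : ∀ {x}, x ≠ 0 → ∃ y, R x y
  right_total : ∀ {y}, y ≠ 0 → ∃ x, R x y
  mul : ∀ {x y x' y'}, R x y → R x' y' → R (x * x') (y * y')
  sq : ∀ {x y}, x ≠ 0 → y ≠ 0 → R (x ^ 2) (y ^ 2)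
  isSquare_left : ∀ {x y}, R x y → IsSquare y → IsSquare x
  isSquare_right : ∀ {x y}, R x y → IsSquare x → IsSquare y
  neg_one : R (-1) (-1)
  repr_left : ∀ {a b c a' b' c'}, R a a' → R b b' → R c c' →
    (∃ x y, c' = a' * x ^ 2 + b' * y ^ 2) → ∃ x y, c = a * x ^ 2 + b * y ^ 2
  repr_right : ∀ {a b c a' b' c'}, R a a' → R b b' → R c c' →
    (∃ x y, c = a * x ^ 2 + b * y ^ 2) → ∃ x y, c' = a' * x ^ 2 + b' * y ^ 2

/-- The set of elements corresponding to elements of `T`. -/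
def pushSet {K L : Type*} (R : K → L → Prop) (T : Set K) : Set L := {y | ∃ x ∈ T, R x y}

namespace WittRel

variable {K L : Type*} [Field K] [Field L] {R : K → L → Prop}

theorem flip (h : WittRel R) : WittRel (flip R) where
  left_ne := h.right_ne
  right_ne := h.left_ne
  left_total := h.right_total
  right_total := h.left_total
  mul := h.mul
  sq hx hy := h.sq hy hx
  isSquare_left := h.isSquare_right
  isSquare_right := h.isSquare_left
  neg_one := h.neg_one
  repr_left := h.repr_right
  repr_right := h.repr_left

theorem one (h : WittRel R) : R 1 1 := by
  simpa using h.sq (x := 1) (y := 1) one_ne_zero one_ne_zero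

theorem mul_sq_left (h : WittRel R) {x y} (hxy : R x y) {z : K} (hz : z ≠ 0) :
    R (x * z ^ 2) y := by
  simpa using h.mul hxy (h.sq hz (one_ne_zero (α := L)))

theorem mul_sq_right (h : WittRel R) {x y} (hxy : R x y) {z : L} (hz : z ≠ 0) :
    R x (y * z ^ 2) := by
  simpa using h.mul hxy (h.sq (one_ne_zero (α := K)) hz)

theorem isSquare_mul_left (h : WittRel R) {x x' y} (h1 : R x y) (h2 : R x' y) :
    IsSquare (x * x') :=
  h.isSquare_left (h.mul h1 h2) ⟨y, rfl⟩

theorem mem_of_rel (h : WittRel R) {T : Set K} (hT : IsSqGroup T) {x x' y} (h1 : R x y)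
    (h2 : R x' y) (hx : x ∈ T) : x' ∈ T := by
  obtain ⟨s, hs⟩ := h.isSquare_mul_left h1 h2
  have hs0 : s ≠ 0 := by
    rintro rfl
    exact mul_ne_zero (h.left_ne h1) (h.left_ne h2) (by simpa using hs)
  refine hT.of_mul_left hx ?_
  rw [hs, ← pow_two]
  exact hT.sq_mem s hs0

theorem mem_pushSet (h : WittRel R) {T : Set K} (hT : IsSqGroup T) {x y} (hxy : R x y) :
    y ∈ pushSet R T ↔ x ∈ T :=
  ⟨fun ⟨_, hx', hr⟩ => h.mem_of_rel hT hr hxy hx', fun hx => ⟨x, hx, hxy⟩⟩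

theorem isSqGroup_pushSet (h : WittRel R) {T : Set K} (hT : IsSqGroup T) :
    IsSqGroup (pushSet R T) where
  zero_notMem := fun ⟨_, _, hr⟩ => h.right_ne hr rfl
  sq_mem y hy := ⟨1, hT.one_mem, by simpa using h.sq (one_ne_zero (α := K)) hy⟩
  mul_mem := fun ⟨x, hx, hr⟩ ⟨x', hx', hr'⟩ => ⟨x * x', hT.mul_mem hx hx', h.mul hr hr'⟩

theorem pushSet_mono {S T : Set K} (hST : S ⊆ T) : pushSet R S ⊆ pushSet R T :=
  fun _ ⟨x, hx, hr⟩ => ⟨x, hST hx, hr⟩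

theorem pushSet_flip (h : WittRel R) {T : Set K} (hT : IsSqGroup T) :
    pushSet (_root_.flip R) (pushSet R T) = T := by
  ext x
  constructor
  · rintro ⟨y, hy, hr⟩
    exact (h.mem_pushSet hT hr).1 hy
  · intro hx
    obtain ⟨y, hr⟩ := h.left_total (hT.ne_zero hx)
    exact ⟨y, ⟨x, hx, hr⟩, hr⟩

theorem rigidPair (h : WittRel R) {T H : Set K} (hTH : RigidPair T H) :
    RigidPair (pushSet R T) (pushSet R H) where
  grpT := h.isSqGroup_pushSet hTH.grpT
  grpH := h.isSqGroup_pushSet hTH.grpH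
  sub := pushSet_mono hTH.sub
  neg_one_mem := ⟨-1, hTH.neg_one_mem, h.neg_one⟩
  rigid y hy hyH := by
    have hT := hTH.grpT
    obtain ⟨x, hxy⟩ := h.right_total hy
    have hx := h.left_ne hxy
    rw [h.mem_pushSet hTH.grpH hxy] at hyH
    have hy1 : 1 + y ≠ 0 := by
      intro h0
      rw [eq_neg_of_add_eq_zero_right h0] at hxy
      exact hyH (h.mem_of_rel hTH.grpH h.neg_one hxy hTH.neg_one_mem)
    obtain ⟨c, hc⟩ := h.right_total hy1
    have hc0 := h.left_ne hc
    rw [h.mem_pushSet hT hc, h.mem_pushSet hT (h.mul hxy hc)]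
    obtain ⟨X, Y, hXY⟩ := h.repr_left h.one hxy hc ⟨1, 1, by ring⟩
    by_cases hX : X = 0
    · right
      have hY : Y ≠ 0 := by
        rintro rfl
        simp [hX] at hXY
        exact hc0 hXY
      have e : x * c = (x * Y) ^ 2 := by rw [hXY, hX]; ring
      rw [e]
      exact hT.sq_mem _ (mul_ne_zero hx hY)
    by_cases hY : Y = 0
    · left
      have e : c = X ^ 2 := by rw [hXY, hY]; ring
      rw [e]
      exact hT.sq_mem _ hX
    · have hq : Y / X ≠ 0 := div_ne_zero hY hX
      have hxH : x * (Y / X) ^ 2 ∉ H := fun h1 => hyH (hTH.grpH.of_mul_sq_mem h1)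
      refine (hTH.rigid _ (mul_ne_zero hx (pow_ne_zero 2 hq)) hxH).imp (fun h1 => ?_) fun h1 => ?_
      · refine hT.congr (w := 1) h1 hX ?_
        rw [hXY]
        field_simp
      · refine hT.congr (w := 1) h1 (z := X ^ 2 / Y) (div_ne_zero (pow_ne_zero 2 hX) hY) ?_
        rw [hXY]
        field_simp

end WittRel

section Comap

variable {F E : Type*} [Field F] [Field E] (f : F →+* E)

theorem IsSqGroup.preimage {T : Set E} (hT : IsSqGroup T) : IsSqGroup (f ⁻¹' T) where
  zero_notMem h := hT.zero_notMem (by simpa using h)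
  sq_mem x hx := by
    rw [Set.mem_preimage, map_pow]
    exact hT.sq_mem _ (by simpa using hx)
  mul_mem hx hy := by
    rw [Set.mem_preimage, map_mul]
    exact hT.mul_mem hx hy

theorem RigidPair.preimage {T H : Set E} (h : RigidPair T H) :
    RigidPair (f ⁻¹' T) (f ⁻¹' H) where
  grpT := h.grpT.preimage f
  grpH := h.grpH.preimage f
  sub := Set.preimage_mono h.sub
  neg_one_mem := by
    rw [Set.mem_preimage, map_neg, map_one]
    exact h.neg_one_mem
  rigid x hx hxH := by
    rw [Set.mem_preimage, Set.mem_preimage, map_mul, map_add, map_one]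
    exact h.rigid _ (by simpa using hx) hxH

end Comap

/-- The residue of `z`, up to squares, is `ξ`. -/
def HasRes {A κ : Type*} (E : Type*) [CommRing A] [Field κ] [Field E] [Algebra A E]
    (r : A →+* κ) (z : E) (ξ : κ) : Prop :=
  ∃ (a : A) (g : E) (s : κ), r a ≠ 0 ∧ g ≠ 0 ∧ r a = ξ * s ^ 2 ∧ z = algebraMap A E a * g ^ 2

namespace HasRes

variable {A κ E : Type*} [CommRing A] [IsDomain A] [Field κ] [Field E] [Algebra A E]
  [IsFractionRing A E] {p : A} {r : A →+* κ} {z w : E} {ξ η : κ}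

theorem ne_zero (h : HasRes E r z ξ) : ξ ≠ 0 := by
  obtain ⟨a, g, s, ha, -, h1, -⟩ := h
  rintro rfl
  exact ha (by simp [h1])

theorem mem_unitSq (h : HasRes E r z ξ) : z ∈ unitSq E r := by
  obtain ⟨a, g, s, ha, hg, -, h1⟩ := h
  exact ⟨a, g, ha, hg, h1⟩

theorem mem_resSq (h : HasRes E r z ξ) (hξ : IsSquare ξ) : z ∈ resSq E r := by
  obtain ⟨a, g, s, ha, hg, h2, h1⟩ := h
  refine ⟨a, g, ha, ?_, hg, h1⟩
  rw [h2]
  exact hξ.mul ⟨s, pow_two s⟩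

theorem mul (hz : HasRes E r z ξ) (hw : HasRes E r w η) : HasRes E r (z * w) (ξ * η) := by
  obtain ⟨a, g, s, ha, hg, h1, rfl⟩ := hz
  obtain ⟨b, g', s', hb, hg', h2, rfl⟩ := hw
  refine ⟨a * b, g * g', s * s', by simp [ha, hb], mul_ne_zero hg hg', ?_, ?_⟩
  · rw [map_mul, h1, h2]
    ring
  · rw [map_mul]
    ring

theorem isSquare (h : Reduction p r) (hz : HasRes E r z ξ) (hm : z ∈ resSq E r) :
    IsSquare ξ := by
  obtain ⟨a, g, s, ha, hg, h1, rfl⟩ := hz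
  obtain ⟨t, ht⟩ := h.isSquare_of_mem_resSq ha hg hm
  have hs : s ≠ 0 := by
    rintro rfl
    simp [h1] at ha
  refine ⟨t / s, ?_⟩
  rw [div_mul_div_comm, ← ht, h1, pow_two]
  field_simp

theorem congr (hz : HasRes E r z ξ) (hη : η ≠ 0) (h : IsSquare (ξ * η)) : HasRes E r z η := by
  have hξ := hz.ne_zero
  obtain ⟨a, g, s, ha, hg, h1, rfl⟩ := hz
  obtain ⟨t, ht⟩ := h
  refine ⟨a, g, s * t / η, ha, hg, ?_, rfl⟩
  rw [h1]
  field_simp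
  linear_combination s ^ 2 * ht

theorem of_mem_unitSq (hz : z ∈ unitSq E r) : ∃ ξ, HasRes E r z ξ := by
  obtain ⟨a, g, ha, hg, rfl⟩ := hz
  exact ⟨r a, a, g, 1, ha, hg, by ring, rfl⟩

theorem neg_one (h : IsSquare (-1 : κ)) : HasRes E r (-1) 1 := by
  obtain ⟨s, hs⟩ := h
  exact ⟨-1, 1, s, by simp, one_ne_zero, by rw [map_neg, map_one, hs]; ring, by simp⟩

theorem of_mul_eq {b c : A} (hb : r b ≠ 0) (hc : r c ≠ 0) (h : r b = ξ * r c)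
    (hz : z * algebraMap A E c = algebraMap A E b) : HasRes E r z ξ := by
  have hc0 : algebraMap A E c ≠ 0 := Reduction.algebraMap_ne_zero' (Reduction.ne_zero_of_map hc)
  refine ⟨b * c, (algebraMap A E c)⁻¹, r c, by simp [hb, hc], inv_ne_zero hc0, ?_, ?_⟩
  · rw [map_mul, h]
    ring
  · rw [map_mul, ← hz]
    field_simp

theorem isotropic (h : Reduction p r) (hz : HasRes E r z η) (hw : HasRes E r w ξ)
    (hzw : ∃ X Y : E, z = X ^ 2 + w * Y ^ 2) :
    ∃ x y z : κ, (x ≠ 0 ∨ y ≠ 0 ∨ z ≠ 0) ∧ η * z ^ 2 = x ^ 2 + ξ * y ^ 2 := by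
  obtain ⟨a, g, s, ha, hg, h1, rfl⟩ := hz
  obtain ⟨b, g', s', hb, hg', h2, rfl⟩ := hw
  obtain ⟨X, Y, hXY⟩ := hzw
  obtain ⟨x, y, t, hne, h3⟩ := h.isotropic (E := E) (ξ := b) (η := a) (X := X / g)
    (Y := g' * Y / g) (by field_simp; linear_combination hXY)
  have hs : s ≠ 0 := by
    rintro rfl
    simp [h1] at ha
  have hs' : s' ≠ 0 := by
    rintro rfl
    simp [h2] at hb
  refine ⟨x, s' * y, s * t, ?_, ?_⟩
  · simpa [hs, hs'] using hne
  · rw [h1, h2] at h3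
    linear_combination h3

end HasRes

/-- A field embedded with dense image into a field with a reduction, containing the prime. -/
structure DenseReduction {A κ E K : Type*} [CommRing A] [IsDomain A] [Field κ] [Field E]
    [Algebra A E] [IsFractionRing A E] [Field K] (p : A) (r : A →+* κ) (Φ : K →+* E) : Prop where
  reduction : Reduction p r
  dense : ∀ y, y ∈ reduction.approxSubfield Φ
  frac : ∀ s, ∃ b c, r c ≠ 0 ∧ s * r c = r b
  prime_mem : ∃ x, Φ x = algebraMap A E p
  isSquare_neg_one : IsSquare (-1 : κ)
  nonrigid : ∃ s : κ, s ≠ 0 ∧ ¬IsSquare s ∧ 1 + s ≠ 0 ∧ ¬IsSquare (1 + s) ∧ ¬IsSquare (s * (1 + s))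

namespace DenseReduction

variable {A κ E K : Type*} [CommRing A] [IsDomain A] [Field κ] [Field E]
  [Algebra A E] [IsFractionRing A E] [Field K] {p : A} {r : A →+* κ} {Φ : K →+* E}

theorem neg_one_mem (h : DenseReduction p r Φ) : (-1 : K) ∈ Φ ⁻¹' resSq E r := by
  rw [Set.mem_preimage, map_neg, map_one]
  exact (HasRes.neg_one h.isSquare_neg_one).mem_resSq IsSquare.one

theorem rigidPair (h : DenseReduction p r Φ) :
    RigidPair (Φ ⁻¹' resSq E r) (Φ ⁻¹' unitSq E r) :=
  RigidPair.preimage Φ ⟨Reduction.isSqGroup_resSq, Reduction.isSqGroup_unitSq,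
    Reduction.resSq_subset_unitSq, (HasRes.neg_one h.isSquare_neg_one).mem_unitSq,
    h.reduction.rigidOutside⟩

theorem exists_residue (h : DenseReduction p r Φ) {s : κ} (hs : s ≠ 0) :
    ∃ x b c, r c ≠ 0 ∧ r b = s * r c ∧ Φ x * algebraMap A E c = algebraMap A E b := by
  obtain ⟨b, c, hc, hbc⟩ := h.frac s
  have hb : r b ≠ 0 := by
    rw [← hbc]
    exact mul_ne_zero hs hc
  have hb0 : algebraMap A E b ≠ 0 := Reduction.algebraMap_ne_zero' (Reduction.ne_zero_of_map hb)
  have hc0 : algebraMap A E c ≠ 0 := Reduction.algebraMap_ne_zero' (Reduction.ne_zero_of_map hc)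
  obtain ⟨x, μ, ⟨a, d, hd, had⟩, hx⟩ := h.reduction.exists_eq_mul_one_add
    (h.dense (algebraMap A E b / algebraMap A E c)) (div_ne_zero hb0 hc0)
  refine ⟨x, b * (d + p * a), c * d, by simp [hc, hd], ?_, ?_⟩
  · rw [map_mul, map_mul, map_add, map_mul, h.reduction.map_self, ← hbc]
    ring
  · rw [hx, map_mul, map_mul, map_add, map_mul]
    field_simp
    linear_combination had

theorem exists_hasRes (h : DenseReduction p r Φ) {s : κ} (hs : s ≠ 0) :
    ∃ x, HasRes E r (Φ x) s := by
  obtain ⟨x, b, c, hc, hb, hx⟩ := h.exists_residue hs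
  exact ⟨x, .of_mul_eq (by rw [hb]; exact mul_ne_zero hs hc) hc hb hx⟩

theorem exists_nonrigid (h : DenseReduction p r Φ) : ∃ g ∈ Φ ⁻¹' unitSq E r,
    g ∉ Φ ⁻¹' resSq E r ∧ -g ∉ Φ ⁻¹' resSq E r ∧ 1 + g ∉ Φ ⁻¹' resSq E r ∧
      g * (1 + g) ∉ Φ ⁻¹' resSq E r := by
  obtain ⟨s, hs, hs1, h0, hs2, hs3⟩ := h.nonrigid
  obtain ⟨x, b, c, hc, hb, hx⟩ := h.exists_residue hs
  have h1 : HasRes E r (Φ x) s := .of_mul_eq (by rw [hb]; exact mul_ne_zero hs hc) hc hb hx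
  have hb' : r (c + b) = (1 + s) * r c := by
    rw [map_add, hb]
    ring
  have h2 : HasRes E r (Φ (1 + x)) (1 + s) :=
    .of_mul_eq (by rw [hb']; exact mul_ne_zero h0 hc) hc hb'
      (by rw [map_add, map_add, map_one, add_mul, hx, one_mul])
  have hg := h.rigidPair.grpT
  refine ⟨x, h1.mem_unitSq, fun h3 => hs1 (h1.isSquare h.reduction h3), fun h3 => ?_,
    fun h3 => hs2 (h2.isSquare h.reduction h3), fun h3 => ?_⟩
  · refine hs1 (h1.isSquare h.reduction (?_ : x ∈ Φ ⁻¹' resSq E r))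
    simpa using hg.mul_mem h.neg_one_mem h3
  · rw [Set.mem_preimage, map_mul] at h3
    exact hs3 ((h1.mul h2).isSquare h.reduction h3)

variable {T : Set K}

theorem small (h : DenseReduction p r Φ) (hT : RigidPair T (Φ ⁻¹' unitSq E r)) {x : K}
    (hx : Φ x ∈ resBall E p r 1) (hxH : x ∉ Φ ⁻¹' unitSq E r) (hx0 : x ≠ 0) :
    1 + x ∈ T := by
  refine (hT.rigid x hx0 hxH).resolve_right fun h1 => hxH ?_
  refine hT.grpH.of_mul_right ?_ (hT.sub h1)
  rw [Set.mem_preimage, map_add, map_one]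
  exact Reduction.resSq_subset_unitSq (h.reduction.one_add_of_mem_resBall hx).1

theorem mem_smallSet (h : DenseReduction p r Φ) (hT : RigidPair T (Φ ⁻¹' unitSq E r)) {x : K}
    (hx : Φ x ∈ resBall E p r 1) (hxH : x ∉ Φ ⁻¹' unitSq E r) (hx0 : x ≠ 0) :
    x ∈ smallSet T (Φ ⁻¹' unitSq E r) := by
  refine ⟨hx0, hxH, ?_⟩
  rw [sub_eq_add_neg]
  refine h.small hT ?_ (hT.neg_notMem hxH) (neg_ne_zero.2 hx0)
  rw [map_neg]
  exact Reduction.neg_mem_resBall hx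

theorem one_add_mem (h : DenseReduction p r Φ) (hT : RigidPair T (Φ ⁻¹' unitSq E r))
    (hsub : T ⊆ Φ ⁻¹' resSq E r) {x : K} (hx : Φ x ∈ resBall E p r 1) : 1 + x ∈ T := by
  by_cases hx0 : x = 0
  · simpa [hx0] using hT.grpT.one_mem
  have hΦ0 : Φ x ≠ 0 := by simpa using hx0
  rcases h.reduction.odd_or_of_mem_resBall hx hΦ0 with ⟨h1, -⟩ | ⟨ν, hν, h1, hνU⟩
  · exact h.small hT hx h1 hx0
  · obtain ⟨q, hq⟩ := h.prime_mem
    have hp0 : algebraMap A E p ≠ 0 := Reduction.algebraMap_ne_zero' h.reduction.ne_zero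
    have hq0 : q ≠ 0 := by
      rintro rfl
      exact hp0 (by rw [← hq, map_zero])
    have hΦν : Φ (x / q) = ν := by
      rw [map_div₀, hq, h1]
      field_simp
    obtain ⟨g, hg, g1, g2, g3, g4⟩ := h.exists_nonrigid
    obtain ⟨O, hO1, -, hO3⟩ := hT.exists_valuationSubring_of_nonrigid hg (fun h => g1 (hsub h))
      (fun h => g2 (hsub h)) (fun h => g3 (hsub h)) (fun h => g4 (hsub h))
    obtain ⟨hq1, hq2⟩ := hO1 q (h.mem_smallSet hT
      (by rw [hq]; simpa using Reduction.pow_mem_resBall (E := E) (p := p) (r := r) 1)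
      (by rw [Set.mem_preimage, hq]; exact h.reduction.self_notMem_unitSq) hq0)
    obtain ⟨hν1, -⟩ := hO1 (x / q) (h.mem_smallSet hT (by rwa [hΦν])
      (by rwa [Set.mem_preimage, hΦν]) (div_ne_zero hx0 hq0))
    have e : x = q * (x / q) := by field_simp
    refine hO3 x (e ▸ O.mul_mem _ _ hq1 hν1) fun hx' => hq2 ?_
    have e' : q⁻¹ = x / q * x⁻¹ := by field_simp
    rw [e']
    exact O.mul_mem _ _ hν1 hx'

theorem eq_of_subset (h : DenseReduction p r Φ) (hT : RigidPair T (Φ ⁻¹' unitSq E r))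
    (hsub : T ⊆ Φ ⁻¹' resSq E r) : T = Φ ⁻¹' resSq E r := by
  refine hsub.antisymm fun x hx => ?_
  obtain ⟨a, g, ha, ⟨s, hs⟩, hg, hxa⟩ := hx
  obtain ⟨b, c, hc, hbc⟩ := h.frac s
  have hb : r b ≠ 0 := by
    rw [← hbc]
    refine mul_ne_zero ?_ hc
    rintro rfl
    simp [hs] at ha
  have hb0 : algebraMap A E b ≠ 0 := Reduction.algebraMap_ne_zero' (Reduction.ne_zero_of_map hb)
  have hc0 : algebraMap A E c ≠ 0 := Reduction.algebraMap_ne_zero' (Reduction.ne_zero_of_map hc)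
  obtain ⟨x₀, μ, hμ, hx₀⟩ := h.reduction.exists_eq_mul_one_add
    (h.dense (algebraMap A E b / algebraMap A E c * g)) (mul_ne_zero (div_ne_zero hb0 hc0) hg)
  obtain ⟨h1, h2⟩ := h.reduction.one_add_of_mem_resBall hμ
  have hμ0 : 1 + μ ≠ 0 := Reduction.isSqGroup_resSq.ne_zero h1
  have hΦ0 : Φ x₀ ≠ 0 := by
    rw [hx₀]
    exact mul_ne_zero (mul_ne_zero (div_ne_zero hb0 hc0) hg) hμ0
  have hx0 : x₀ ≠ 0 := by
    rintro rfl
    simp at hΦ0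
  obtain ⟨e, he⟩ : p ∣ a * c ^ 2 - b ^ 2 := by
    rw [← h.reduction.ker, map_sub, map_mul, map_pow, map_pow, hs, ← hbc]
    ring
  have key : Φ (x * x₀⁻¹ ^ 2 - 1) ∈ resBall E p r 1 := by
    have h3 : algebraMap A E p * algebraMap A E e / algebraMap A E b ^ 2 ∈ resBall E p r 1 :=
      ⟨e, b ^ 2, by simp [hb], by rw [map_pow]; field_simp⟩
    have h4 := Reduction.add_mem_resBall h3 (Reduction.neg_mem_resBall (Reduction.add_mem_resBall
      (Reduction.add_mem_resBall hμ hμ)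
      (Reduction.resBall_anti one_le_two (Reduction.mul_mem_resBall hμ hμ))))
    have h5 := Reduction.mul_mem_resBall_zero h2 (Reduction.mul_mem_resBall_zero h2 h4)
    convert h5 using 1
    have he' := congrArg (algebraMap A E) he
    simp only [map_sub, map_mul, map_pow] at he'
    rw [map_sub, map_mul, map_pow, map_inv₀, map_one, hxa, hx₀, ← he']
    field_simp
    ring
  have h6 := h.one_add_mem hT hsub key
  rw [add_sub_cancel] at h6
  exact hT.grpT.of_mul_sq_mem h6

end DenseReduction

namespace WittRel

variable {K L : Type*} [Field K] [Field L] {R : K → L → Prop}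

theorem exists_nonrigid (hR : WittRel R) {T H : Set K} (h : RigidPair T H) {g : K} (hg : g ∈ H)
    (h1 : g ∉ T) (h2 : -g ∉ T) (h3 : 1 + g ∉ T) (h4 : g * (1 + g) ∉ T) :
    ∃ g' ∈ pushSet R H, g' ∉ pushSet R T ∧ -g' ∉ pushSet R T ∧ 1 + g' ∉ pushSet R T ∧
      g' * (1 + g') ∉ pushSet R T := by
  have hT := h.grpT
  have hg0 : 1 + g ≠ 0 := by
    intro h0
    refine h2 ?_
    rw [← eq_neg_of_add_eq_zero_left h0]
    exact hT.one_mem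
  obtain ⟨y, hy⟩ := hR.left_total (h.grpH.ne_zero hg)
  obtain ⟨z, hz⟩ := hR.left_total hg0
  have hy0 := hR.right_ne hy
  have hz0 := hR.right_ne hz
  obtain ⟨X, Y, hXY⟩ := hR.repr_right hR.one hy hz ⟨1, 1, by ring⟩
  have hP := hR.isSqGroup_pushSet hT
  have hX : X ≠ 0 := by
    rintro rfl
    have hY : Y ≠ 0 := by
      rintro rfl
      exact hz0 (by simp [hXY])
    refine h4 ((hR.mem_pushSet hT (hR.mul hy hz)).1 ?_)
    have e : y * z = (y * Y) ^ 2 := by rw [hXY]; ring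
    rw [e]
    exact hP.sq_mem _ (mul_ne_zero hy0 hY)
  have hY : Y ≠ 0 := by
    rintro rfl
    refine h3 ((hR.mem_pushSet hT hz).1 ?_)
    have e : z = X ^ 2 := by rw [hXY]; ring
    rw [e]
    exact hP.sq_mem _ hX
  have hq : Y / X ≠ 0 := div_ne_zero hY hX
  have r1 : R g (y * (Y / X) ^ 2) := hR.mul_sq_right hy hq
  have r2 : R (1 + g) (1 + y * (Y / X) ^ 2) := by
    have e : 1 + y * (Y / X) ^ 2 = z * X⁻¹ ^ 2 := by
      rw [hXY]
      field_simp
    rw [e]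
    exact hR.mul_sq_right hz (inv_ne_zero hX)
  have r3 : R (-g) (-(y * (Y / X) ^ 2)) := by simpa using hR.mul hR.neg_one r1
  exact ⟨_, ⟨g, hg, r1⟩, by rwa [hR.mem_pushSet hT r1], by rwa [hR.mem_pushSet hT r3],
    by rwa [hR.mem_pushSet hT r2], by rwa [hR.mem_pushSet hT (hR.mul r1 r2)]⟩

end WittRel

/-- The correspondence between the residue field of a valuation ring on one side and the residues
of a dense reduction on the other side of a Witt equivalence. -/
def residueRel {A κ K L : Type*} (E : Type*) [CommRing A] [Field κ] [Field E]
    [Algebra A E] [Field K] [Field L] (r : A →+* κ) (Φ : K →+* E) (R : K → L → Prop)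
    (O : ValuationSubring L) (c : IsLocalRing.ResidueField O) (ξ : κ) : Prop :=
  c ≠ 0 ∧ ∃ (y : O) (x : K), IsLocalRing.residue O y = c ∧ R x y ∧ HasRes E r (Φ x) ξ

namespace DenseReduction

variable {A κ E K L : Type*} [CommRing A] [IsDomain A] [Field κ] [Field E]
  [Algebra A E] [IsFractionRing A E] [Field K] [Field L] {p : A} {r : A →+* κ} {Φ : K →+* E}
  {R : K → L → Prop} {O : ValuationSubring L}

theorem residue_ne_zero_iff {y : O} :
    IsLocalRing.residue O y ≠ 0 ↔ O.valuation (y : L) = 1 := by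
  rw [IsLocalRing.residue_ne_zero_iff_isUnit, ValuationSubring.valuation_eq_one_iff]

theorem mul_mem_oneSq {y y' : O} (h : IsLocalRing.residue O y = IsLocalRing.residue O y')
    (h0 : IsLocalRing.residue O y ≠ 0) : (y : L) * y' ∈ oneSq O.valuation := by
  have h1 := residue_ne_zero_iff.1 h0
  have hy0 : (y : L) ≠ 0 := by
    intro h2
    simp [h2] at h1
  refine ⟨(y' - y) / y, y, hy0, ?_, by field_simp; ring⟩
  rw [map_div₀, h1, div_one]
  have h2 : IsLocalRing.residue O (y' - y) = 0 := by rw [map_sub, h, sub_self]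
  rw [IsLocalRing.residue_eq_zero_iff, ValuationSubring.valuation_lt_one_iff] at h2
  simpa using h2

theorem isSquare_residue {y : O} (h0 : IsLocalRing.residue O y ≠ 0)
    (hy : (y : L) ∈ oneSq O.valuation) : IsSquare (IsLocalRing.residue O y) := by
  obtain ⟨m, g, hg, hm, hyg⟩ := hy
  have h1 := residue_ne_zero_iff.1 h0
  have hg1 : O.valuation g = 1 := by
    rw [hyg, map_mul, map_one_add_of_lt_one _ hm, one_mul, map_pow] at h1
    exact (pow_eq_one_iff.1 h1).resolve_right two_ne_zero
  have hgO : g ∈ O := (O.valuation_le_one_iff g).1 hg1.le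
  have hmO : m ∈ O := (O.valuation_le_one_iff m).1 hm.le
  have e : y = (1 + ⟨m, hmO⟩) * (⟨g, hgO⟩ * ⟨g, hgO⟩) := by
    ext
    simp [hyg, pow_two]
  have hm0 : IsLocalRing.residue O ⟨m, hmO⟩ = 0 := by
    rw [IsLocalRing.residue_eq_zero_iff, ValuationSubring.valuation_lt_one_iff]
    exact hm
  refine ⟨IsLocalRing.residue O ⟨g, hgO⟩, ?_⟩
  rw [e, map_mul, map_add, hm0, map_one, add_zero, one_mul, map_mul]

theorem ratFuncRel {κ₀ : Type*} [Field κ₀] {r : A →+* RatFunc κ₀} (h : DenseReduction p r Φ)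
    (hR : WittRel R) (hT : oneSq O.valuation = pushSet R (Φ ⁻¹' resSq E r))
    (hH : evenSet O.valuation = pushSet R (Φ ⁻¹' unitSq E r)) :
    RatFuncRel (residueRel E r Φ R O) := by
  have gT := h.rigidPair.grpT
  have gH := h.rigidPair.grpH
  have mT : ∀ {x y}, R x y → y ∈ oneSq O.valuation → x ∈ Φ ⁻¹' resSq E r := fun hxy hy =>
    (hR.mem_pushSet gT hxy).1 (hT ▸ hy)
  have mH : ∀ {x y}, R x y → O.valuation y = 1 → ∃ ξ, HasRes E r (Φ x) ξ := fun hxy hy =>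
    HasRes.of_mem_unitSq
      ((hR.mem_pushSet gH hxy).1 (hH ▸ mem_evenSet_of_map_eq_one O.valuation hy))
  have uniq : ∀ {y y' : O} {x x' ξ ξ'}, IsLocalRing.residue O y = IsLocalRing.residue O y' →
      IsLocalRing.residue O y ≠ 0 → R x y → R x' y' → HasRes E r (Φ x) ξ →
      HasRes E r (Φ x') ξ' → IsSquare (ξ * ξ') := by
    intro y y' x x' ξ ξ' hyy h0 hx hx' hξ hξ'
    have h1 := mT (hR.mul hx hx') (mul_mem_oneSq hyy h0)
    rw [Set.mem_preimage, map_mul] at h1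
    exact (hξ.mul hξ').isSquare h.reduction h1
  refine ⟨?_, ?_, ?_, ?_, ?_, ?_, ?_, ?_⟩
  · rintro c ξ ⟨-, y, x, -, -, h1⟩
    exact h1.ne_zero
  · intro c hc
    obtain ⟨y, rfl⟩ := IsLocalRing.residue_surjective c
    have hy := residue_ne_zero_iff.1 hc
    obtain ⟨x, hx⟩ := hR.right_total (y := (y : L)) (by
      intro h2
      simp [h2] at hy)
    obtain ⟨ξ, hξ⟩ := mH hx hy
    exact ⟨ξ, hc, y, x, rfl, hx, hξ⟩
  · intro ξ hξ
    obtain ⟨x, hx⟩ := h.exists_hasRes hξ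
    obtain ⟨y, hy⟩ := hR.left_total (gH.ne_zero (x := x) hx.mem_unitSq)
    have hyH : y ∈ evenSet O.valuation := hH ▸ ⟨x, hx.mem_unitSq, hy⟩
    obtain ⟨u, g, hg, hu, rfl⟩ := hyH
    have huO : u ∈ O := (O.valuation_le_one_iff u).1 hu.le
    have h0 : IsLocalRing.residue O ⟨u, huO⟩ ≠ 0 := residue_ne_zero_iff.2 hu
    refine ⟨_, h0, h0, ⟨u, huO⟩, x, rfl, ?_, hx⟩
    have := hR.mul_sq_right hy (inv_ne_zero hg)
    have e : u * g ^ 2 * g⁻¹ ^ 2 = u := by field_simp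
    rwa [e] at this
  · rintro _ ξ _ ξ' ⟨hc, y, x, rfl, hx, hξ⟩ ⟨hc', y', x', rfl, hx', hξ'⟩
    exact ⟨mul_ne_zero hc hc', y * y', x * x', map_mul _ _ _, hR.mul hx hx',
      by rw [map_mul]; exact hξ.mul hξ'⟩
  · rintro _ ξ ⟨hc, y, x, rfl, hx, hξ⟩ hsq
    exact isSquare_residue hc (hT ▸ ⟨x, hξ.mem_resSq hsq, hx⟩)
  · rintro _ ξ ξ' ⟨hc, y, x, rfl, hx, hξ⟩ ⟨-, y', x', hyy, hx', hξ'⟩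
    exact uniq hyy.symm hc hx hx' hξ hξ'
  · exact ⟨neg_ne_zero.2 one_ne_zero, -1, -1, by simp, by simpa using hR.neg_one,
      by rw [map_neg, map_one]; exact .neg_one h.isSquare_neg_one⟩
  · rintro _ ξ η ⟨hc, y, x, rfl, hx, hξ⟩ ⟨hc', y', x', hyy, hx', hη⟩
    rw [← map_one (IsLocalRing.residue O), ← map_add] at hyy hc'
    have hv := residue_ne_zero_iff.1 hc'
    have h0 : ((1 + y : O) : L) ≠ 0 := by
      intro h2
      simp only [h2, map_zero] at hv
      exact zero_ne_one hv
    obtain ⟨x₁, hx₁⟩ := hR.right_total h0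
    obtain ⟨η₁, hη₁⟩ := mH hx₁ hv
    have hηη := uniq hyy.symm hc' hx₁ hx' hη₁ hη
    obtain ⟨X, Y, hXY⟩ := hR.repr_left hR.one hx hx₁ ⟨1, 1, by simp⟩
    exact (hη₁.congr hη.ne_zero hηη).isotropic h.reduction hξ
      ⟨Φ X, Φ Y, by rw [hXY]; simp⟩

/-- No valuation ring with number field as residue class field and containing the constants
corresponds to a dense reduction to a rational function field. -/
theorem exists_not_mem {κ₀ : Type*} [Field κ₀] [Finite κ₀] {r : A →+* RatFunc κ₀}
    (h : DenseReduction p r Φ) (hR : WittRel R) (h2 : ringChar κ₀ ≠ 2)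
    (hi : IsSquare (-1 : κ₀)) {m : Type*} [Field m] (ι : m →+* L)
    (hplaces : ∀ O : ValuationSubring L, O ≠ ⊤ → (∀ c, ι c ∈ O) →
      (∃ t, ∀ x, x ≠ 0 → x ∈ evenSet O.valuation ∨ x * t ∈ evenSet O.valuation) ∧
        NumberField (IsLocalRing.ResidueField O)) :
    ∃ O : ValuationSubring L, (∃ c, ι c ∉ O) ∧
      ∀ x, x ∈ O → x⁻¹ ∉ O → 1 + x ∈ pushSet R (Φ ⁻¹' resSq E r) := by
  have hTH := h.rigidPair
  have hTH' := hR.rigidPair hTH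
  obtain ⟨g, hg, g1, g2, g3, g4⟩ := h.exists_nonrigid
  obtain ⟨g', hg', g1', g2', g3', g4'⟩ := hR.exists_nonrigid hTH hg g1 g2 g3 g4
  obtain ⟨O, -, hO2, hO3⟩ := hTH'.exists_valuationSubring_of_nonrigid hg' g1' g2' g3' g4'
  refine ⟨O, ?_, hO3⟩
  by_contra! hc
  obtain ⟨q, hq⟩ := h.prime_mem
  have hqH : q ∉ Φ ⁻¹' unitSq E r := by
    rw [Set.mem_preimage, hq]
    exact h.reduction.self_notMem_unitSq
  have hq0 : q ≠ 0 := by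
    rintro rfl
    rw [map_zero] at hq
    exact Reduction.algebraMap_ne_zero' (E := E) h.reduction.ne_zero hq.symm
  obtain ⟨q', hqq⟩ := hR.left_total hq0
  have hqH' : q' ∉ pushSet R (Φ ⁻¹' unitSq E r) := by rwa [hR.mem_pushSet hTH.grpH hqq]
  have hq0' := hR.right_ne hqq
  have hOtop : O ≠ ⊤ := by
    rintro rfl
    exact hqH' (hO2 q' trivial trivial hq0')
  obtain ⟨⟨t, ht⟩, hF⟩ := hplaces O hOtop hc
  have hsubH : evenSet O.valuation ⊆ pushSet R (Φ ⁻¹' unitSq E r) :=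
    evenSet_subset hTH'.grpH fun x hx => by
      have hx0 : x ≠ 0 := by
        rintro rfl
        simp at hx
      obtain ⟨h3, h4⟩ := (O.valuation_eq_one_iff_mem_inv_mem hx0).1 hx
      exact hO2 x h3 h4 hx0
  have hsubT : oneSq O.valuation ⊆ pushSet R (Φ ⁻¹' resSq E r) :=
    oneSq_subset hTH'.grpT (one_add_mem_of_valuation_lt_one hTH'.grpT hO3)
  have hH : evenSet O.valuation = pushSet R (Φ ⁻¹' unitSq E r) := by
    refine hsubH.antisymm fun y hy => ?_
    rcases ht y (hTH'.grpH.ne_zero hy) with h3 | h3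
    · exact h3
    · have htH := hTH'.grpH.of_mul_left hy (hsubH h3)
      rcases ht q' hq0' with h4 | h4
      · exact absurd (hsubH h4) hqH'
      · exact absurd (hTH'.grpH.of_mul_right htH (hsubH h4)) hqH'
  have hpull := hR.flip.rigidPair (rigidPair_oneSq_evenSet O.valuation)
  rw [hH, hR.pushSet_flip hTH.grpH] at hpull
  have hT1 := h.eq_of_subset hpull ((WittRel.pushSet_mono hsubT).trans
    (hR.pushSet_flip hTH.grpT).subset)
  have hT : oneSq O.valuation = pushSet R (Φ ⁻¹' resSq E r) := by
    rw [← hT1]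
    exact (hR.flip.pushSet_flip (isSqGroup_oneSq O.valuation)).symm
  exact (h.ratFuncRel hR hT hH).false h2 hi

/-- The elements corresponding to squares of the dense reduction have at most four cosets among
the constants. -/
theorem atMostFourCosets {κ₀ : Type*} [Field κ₀] [Finite κ₀] {r : A →+* RatFunc κ₀}
    (h : DenseReduction p r Φ) (hR : WittRel R) (h2 : ringChar κ₀ ≠ 2)
    (hi : IsSquare (-1 : κ₀)) {m : Type*} [Field m] [NumberField m] (ι : m →+* L)
    (hplaces : ∀ O : ValuationSubring L, O ≠ ⊤ → (∀ c, ι c ∈ O) →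
      (∃ t, ∀ x, x ≠ 0 → x ∈ evenSet O.valuation ∨ x * t ∈ evenSet O.valuation) ∧
        NumberField (IsLocalRing.ResidueField O)) :
    AtMostFourCosets (ι ⁻¹' pushSet R (Φ ⁻¹' resSq E r)) := by
  obtain ⟨O, ⟨c, hc⟩, hO⟩ := h.exists_not_mem hR h2 hi ι hplaces
  have hg := (hR.isSqGroup_pushSet h.rigidPair.grpT).preimage ι
  refine atMostFourCosets_of_valuationSubring hg (O := O.comap ι) ?_
    (one_add_mem_of_valuation_lt_one hg fun x hx hx' => ?_)
  · intro htop
    have : c ∈ O.comap ι := htop ▸ trivial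
    exact hc this
  · rw [Set.mem_preimage, map_add, map_one]
    refine hO _ hx ?_
    rw [← map_inv₀]
    exact hx'

end DenseReduction

/-! ### Constants which become squares in a finite extension -/

theorem isSquare_mul_of_adjoin_eq {F E : Type*} [Field F] [CharZero F] [Field E] [Algebra F E]
    {r r' : F} {s s' : E} (hs : s ^ 2 = algebraMap F E r) (hs' : s' ^ 2 = algebraMap F E r')
    (h : IntermediateField.adjoin F {s} = IntermediateField.adjoin F {s'}) :
    IsSquare (r * r') := by
  by_cases hsF : ∃ t, algebraMap F E t = s
  · obtain ⟨t, rfl⟩ := hsF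
    have h1 : s' ∈ (⊥ : IntermediateField F E) := by
      rw [← IntermediateField.adjoin_simple_eq_bot_iff, ← h,
        IntermediateField.adjoin_simple_eq_bot_iff]
      exact IntermediateField.mem_bot.2 ⟨t, rfl⟩
    obtain ⟨t', rfl⟩ := IntermediateField.mem_bot.1 h1
    refine ⟨t * t', (algebraMap F E).injective ?_⟩
    rw [map_mul, ← hs, ← hs']
    simp only [map_mul]
    ring
  · obtain ⟨u, v, huv⟩ := IntermediateField.exists_add_mul_of_mem_adjoin hs
      (h ▸ IntermediateField.mem_adjoin_simple_self F s' : s' ∈ IntermediateField.adjoin F {s})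
    have key : algebraMap F E (2 * u * v) * s = algebraMap F E (r' - u ^ 2 - v ^ 2 * r) := by
      simp only [map_mul, map_sub, map_pow, map_ofNat]
      rw [← hs, ← hs', huv]
      ring
    by_cases huv0 : 2 * u * v = 0
    · have : u = 0 ∨ v = 0 := by simpa using huv0
      rcases this with rfl | rfl
      · refine ⟨v * r, ?_⟩
        have : r' = v ^ 2 * r := by
          rw [huv0, map_zero, zero_mul, eq_comm, map_eq_zero] at key
          linear_combination key
        rw [this]
        ring
      · exfalso
        have h1 : s ∈ (⊥ : IntermediateField F E) := by
          rw [← IntermediateField.adjoin_simple_eq_bot_iff, h,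
            IntermediateField.adjoin_simple_eq_bot_iff]
          exact IntermediateField.mem_bot.2 ⟨u, by simp [huv]⟩
        exact hsF (IntermediateField.mem_bot.1 h1)
    · exfalso
      refine hsF ⟨(r' - u ^ 2 - v ^ 2 * r) / (2 * u * v), ?_⟩
      rw [map_div₀, ← key, mul_div_cancel_left₀]
      simpa using huv0

/-- Among infinitely many elements which become squares in a finite extension, infinitely many
agree up to squares. -/
theorem exists_infinite_isSquare_mul {F E N : Type*} [Field F] [CharZero F] [Field E]
    [Algebra F E] [FiniteDimensional F E] [Infinite N] (r : N → F)
    (h : ∀ n, IsSquare (algebraMap F E (r n))) :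
    ∃ n₁, {n | IsSquare (r n * r n₁)}.Infinite := by
  choose s hs using h
  have : Finite (IntermediateField F E) :=
    Field.finite_intermediateField_of_exists_primitive_element F E
      (Field.exists_primitive_element F E)
  obtain ⟨M, hM⟩ := Finite.exists_infinite_fiber fun n => IntermediateField.adjoin F {s n}
  obtain ⟨n₁, hn₁⟩ := Set.infinite_coe_iff.1 hM |>.nonempty
  refine ⟨n₁, (Set.infinite_coe_iff.1 hM).mono fun n hn => ?_⟩
  exact isSquare_mul_of_adjoin_eq (by rw [hs, pow_two]) (by rw [hs, pow_two])
    ((hn : _ = M).trans (hn₁ : _ = M).symm)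

theorem not_isSquare_prime_mul {p q : ℕ} (hp : p.Prime) (hq : q.Prime) (hpq : p ≠ q) :
    ¬ IsSquare ((p : ℚ) * q) := by
  rintro h
  rw [← Nat.cast_mul, Rat.isSquare_natCast_iff] at h
  obtain ⟨s, hs⟩ := h
  have h1 : p ∣ s := by
    have : p ∣ s * s := hs ▸ dvd_mul_right p q
    exact (hp.dvd_mul.1 this).elim id id
  have h2 : p * p ∣ p * q := hs ▸ mul_dvd_mul h1 h1
  exact hpq ((Nat.prime_dvd_prime_iff_eq hp hq).1 (Nat.dvd_of_mul_dvd_mul_left hp.pos h2))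

theorem finite_of_isSquare_prime_mul {m : Type*} [Field m] [NumberField m] {S : Set Nat.Primes}
    {p₁ : Nat.Primes} (h : ∀ p ∈ S, IsSquare (((p : ℕ) : m) * (p₁ : ℕ))) : S.Finite := by
  by_contra hS
  have : Infinite S := Set.infinite_coe_iff.2 hS
  obtain ⟨p₂, h2⟩ := exists_infinite_isSquare_mul (F := ℚ) (E := m)
    (fun p : S => ((p.1 : ℕ) : ℚ) * (p₁ : ℕ)) fun p => by simpa using h p p.2
  obtain ⟨p₃, h3, hne⟩ := h2.exists_notMem_finset {p₂}
  rw [Set.mem_ofPred_eq] at h3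
  obtain ⟨t, ht⟩ := h3
  have hp : ((p₁ : ℕ) : ℚ) ≠ 0 := by exact_mod_cast p₁.2.ne_zero
  refine not_isSquare_prime_mul (p := (p₃.1 : ℕ)) (q := (p₂.1 : ℕ)) p₃.1.2 p₂.1.2
    (fun e => hne ?_) ⟨t / (p₁ : ℕ), ?_⟩
  · rw [Finset.mem_singleton]
    exact Subtype.ext (Subtype.ext e)
  · field_simp
    linear_combination ht

/-! ### The Gauss places -/

theorem ConicEmb.denseReduction {k K k' : Type*} [Field k] [Field K] [Field k'] [Algebra k k']
    {ι : k →+* K} {j : K →+* RatFunc k'} {α : k'} (hj : ConicEmb ι j α) {ℓ : ℕ} [Fact ℓ.Prime]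
    (φ : k' →+* ℚ_[ℓ]) (hi : IsSquare (-1 : ZMod ℓ)) :
    DenseReduction (Polynomial.C (ℓ : ℤ_[ℓ])) (gaussMap ℓ) ((gaussEmb φ).comp j) where
  reduction := gaussReduction ℓ
  dense := mem_approxSubfield_gaussEmb φ j α hj.gen
  frac := gaussMap_frac ℓ
  prime_mem := ⟨(ℓ : K), by simp⟩
  isSquare_neg_one := by
    obtain ⟨t, ht⟩ := hi
    exact ⟨RatFunc.C t, by rw [← map_mul, ← ht]; simp⟩
  nonrigid := by
    have hirr : Irreducible (1 + Polynomial.X : (ZMod ℓ)[X]) := by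
      rw [add_comm]
      exact Polynomial.irreducible_of_degree_eq_one (Polynomial.degree_X_add_C (1 : ZMod ℓ))
    have hX : Irreducible (Polynomial.X : (ZMod ℓ)[X]) := Polynomial.irreducible_X
    have hco : IsCoprime (Polynomial.X : (ZMod ℓ)[X]) (1 + Polynomial.X) := ⟨-1, 1, by ring⟩
    have key : ∀ f : (ZMod ℓ)[X], Squarefree f → ¬ IsUnit f →
        ¬ IsSquare (algebraMap (ZMod ℓ)[X] (RatFunc (ZMod ℓ)) f) := fun f hf hu h =>
      hu (Polynomial.isUnit_of_isSquare_algebraMap hf h)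
    refine ⟨RatFunc.X, RatFunc.X_ne_zero, ?_, ?_, ?_, ?_⟩
    · simpa using key _ hX.squarefree hX.not_isUnit
    · intro h0
      refine hirr.ne_zero ((IsFractionRing.injective (ZMod ℓ)[X] (RatFunc (ZMod ℓ))) ?_)
      simpa using h0
    · simpa using key _ hirr.squarefree hirr.not_isUnit
    · simpa using key (Polynomial.X * (1 + Polynomial.X))
        ((squarefree_mul_iff).2 ⟨hco.isRelPrime, hX.squarefree, hirr.squarefree⟩)
        fun hu => hX.not_isUnit (isUnit_of_mul_isUnit_left hu)

namespace WittRel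

variable {K L : Type*} [Field K] [Field L] {R : K → L → Prop}

theorem of_mul_sq_left (h : WittRel R) {x w y} (hxy : R (x * w ^ 2) y) : R x y := by
  have hw : w ≠ 0 := by
    rintro rfl
    exact h.left_ne hxy (by simp)
  have := h.mul_sq_left hxy (inv_ne_zero hw)
  rwa [mul_assoc, ← mul_pow, mul_inv_cancel₀ hw, one_pow, mul_one] at this

/-- The constants of `L` corresponding to constants of `K`. -/
theorem isSqGroup_const {k m : Type*} [Field k] [Field m] {ι : k →+* K} {ι' : m →+* L}
    (hR : WittRel R) : IsSqGroup {c : m | ∃ r : k, R (ι r) (ι' c)} where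
  zero_notMem := fun ⟨_, hr⟩ => hR.right_ne hr (map_zero _)
  sq_mem x hx := ⟨1, by
    simpa using hR.sq (one_ne_zero (α := K)) (y := ι' x) (by simpa using hx)⟩
  mul_mem := fun ⟨r, hr⟩ ⟨s, hs⟩ => ⟨r * s, by simpa using hR.mul hr hs⟩

variable {k k' m : Type*} [Field k] [Field k'] [NumberField k'] [Algebra k k']
  [Field m] [NumberField m] {ι : k →+* K} {j : K →+* RatFunc k'} {α : k'} {ι' : m →+* L}

theorem exists_mul_mem_const (hR : WittRel R) (hj : ConicEmb ι j α)
    (hplaces : ∀ O : ValuationSubring L, O ≠ ⊤ → (∀ c, ι' c ∈ O) →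
      (∃ t, ∀ x, x ≠ 0 → x ∈ evenSet O.valuation ∨ x * t ∈ evenSet O.valuation) ∧
        NumberField (IsLocalRing.ResidueField O)) (y : Fin 5 → m) (hy : ∀ i, y i ≠ 0) :
    ∃ i i', i ≠ i' ∧ y i * y i' ∈ {c : m | ∃ r : k, R (ι r) (ι' c)} := by
  classical
  by_contra! hne
  have htot : ∀ i i', ∃ x, R x (ι' (y i * y i')) := fun i i' =>
    hR.right_total (by simpa using ⟨hy i, hy i'⟩)
  choose x hx using htot
  obtain ⟨ℓ, hℓ, φ, h2, hi, hS⟩ := hj.exists_gaussEmb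
    ((Finset.univ : Finset (Fin 5 × Fin 5)).filter (fun p => p.1 ≠ p.2) |>.image
      fun p => x p.1 p.2) (by
    intro z hz
    obtain ⟨p, hp, rfl⟩ := Finset.mem_image.1 hz
    refine ⟨hR.left_ne (hx _ _), ?_⟩
    rintro ⟨r, w, hrw⟩
    exact hne p.1 p.2 (Finset.mem_filter.1 hp).2 ⟨r, hR.of_mul_sq_left (hrw ▸ hx p.1 p.2)⟩)
  have hd := hj.denseReduction φ hi
  have hch : ringChar (ZMod ℓ) ≠ 2 := by rwa [ZMod.ringChar_zmod_n]
  obtain ⟨z, hz0, hz⟩ := hd.atMostFourCosets hR hch hi ι' hplaces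
  choose f hf using fun i => hz (y i) (hy i)
  obtain ⟨i, i', hii, hff⟩ := Fintype.exists_ne_map_eq_of_card_lt f (by simp)
  have hT : IsSqGroup ((gaussEmb φ).comp j ⁻¹' resSq (RatFunc ℤ_[ℓ]) (gaussMap ℓ)) :=
    Reduction.isSqGroup_resSq.preimage _
  have hT' := (hR.isSqGroup_pushSet hT).preimage ι'
  have h1 := hT'.of_mul_sq_mem (x := y i * y i') (z := z (f i)) (by
    have := hT'.mul_mem (hf i) (hff ▸ hf i')
    rwa [show y i * z (f i) * (y i' * z (f i)) = y i * y i' * z (f i) ^ 2 by ring] at this)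
  exact hS (x i i') (Finset.mem_image.2 ⟨(i, i'), by simpa using hii, rfl⟩)
    ((hR.mem_pushSet hT (hx i i')).1 h1)

/-- Infinitely many constants of `L` agree up to constants of `K`. -/
theorem exists_infinite_const (hR : WittRel R) (hj : ConicEmb ι j α)
    (hplaces : ∀ O : ValuationSubring L, O ≠ ⊤ → (∀ c, ι' c ∈ O) →
      (∃ t, ∀ x, x ≠ 0 → x ∈ evenSet O.valuation ∨ x * t ∈ evenSet O.valuation) ∧
        NumberField (IsLocalRing.ResidueField O)) {N : Type*} [Infinite N] (y : N → m)
    (hy : ∀ n, y n ≠ 0) :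
    ∃ n₁, {n | y n * y n₁ ∈ {c : m | ∃ r : k, R (ι r) (ι' c)}}.Infinite := by
  set C := {c : m | ∃ r : k, R (ι r) (ι' c)}
  have hC : IsSqGroup C := hR.isSqGroup_const
  let s : Setoid N :=
    { r := fun n n' => y n * y n' ∈ C
      iseqv :=
        { refl := fun n => by
            rw [← pow_two]
            exact hC.sq_mem _ (hy n)
          symm := fun {n n'} h => by rwa [mul_comm]
          trans := fun {n n' n''} h h' => by
            refine hC.of_mul_sq_mem (z := y n') ?_
            rw [show y n * y n'' * y n' ^ 2 = y n * y n' * (y n' * y n'') by ring]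
            exact hC.mul_mem h h' } }
  have hfin : Finite (Quotient s) := by
    by_contra hinf
    rw [not_finite_iff_infinite] at hinf
    obtain ⟨g⟩ : Nonempty (ℕ ↪ Quotient s) := ⟨Infinite.natEmbedding _⟩
    obtain ⟨i, i', hii, hmem⟩ := hR.exists_mul_mem_const hj hplaces
      (fun i : Fin 5 => y (g i).out) fun i => hy _
    have : g i = g i' := by
      rw [← Quotient.out_eq (g i), ← Quotient.out_eq (g i')]
      exact Quotient.sound hmem
    exact hii (Fin.ext (g.injective this))
  obtain ⟨q, hq⟩ := Finite.exists_infinite_fiber (Quotient.mk s)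
  obtain ⟨n₁, hn₁⟩ := (Set.infinite_coe_iff.1 hq).nonempty
  refine ⟨n₁, (Set.infinite_coe_iff.1 hq).mono fun n hn => ?_⟩
  exact Quotient.exact ((hn : _ = q).trans (hn₁ : _ = q).symm)

end WittRel

/-- A function which is not a constant up to squares has a pole or zero of odd order. -/
theorem RatFunc.exists_notMem_unitSq {F : Type*} [Field F] {z : RatFunc F} (hz : z ≠ 0)
    (h : ¬ ∃ (c : F) (g : RatFunc F), z = RatFunc.C c * g ^ 2) :
    ∃ (π : F[X]) (_ : Fact (Irreducible π)), π.Monic ∧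
      z ∉ unitSq (RatFunc F) (AdjoinRoot.mk π) := by
  obtain ⟨c, f, g, hc, hf, hsq, hg, rfl⟩ := RatFunc.exists_squarefree z hz
  have hf1 : f ≠ 1 := by
    rintro rfl
    exact h ⟨c, g, by simp⟩
  obtain ⟨π, hm, hπ, f', rfl⟩ := Polynomial.exists_monic_irreducible_factor f
    fun hu => hf1 (hf.isUnit_iff.1 hu)
  have hfact : Fact (Irreducible π) := ⟨hπ⟩
  have hndvd : ¬ π ∣ f' := fun hd => hπ.not_isUnit (hsq π (mul_dvd_mul_left π hd))
  refine ⟨π, hfact, hm, fun hmem => ?_⟩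
  have hgrp : IsSqGroup (unitSq (RatFunc F) (AdjoinRoot.mk π)) := Reduction.isSqGroup_unitSq
  have h1 : algebraMap F[X] (RatFunc F) (Polynomial.C c * f') ∈
      unitSq (RatFunc F) (AdjoinRoot.mk π) := by
    refine Reduction.mem_unitSq ?_
    rw [Ne, AdjoinRoot.mk_eq_zero, (Polynomial.isUnit_C.2 hc.isUnit).dvd_mul_left]
    exact hndvd
  have h2 := hgrp.of_mul_sq_mem hmem
  refine Reduction.self_notMem_unitSq (E := RatFunc F) Polynomial.reduction
    (hgrp.of_mul_left h1 ?_)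
  convert h2 using 1
  simp only [map_mul, RatFunc.algebraMap_C]
  ring

theorem Polynomial.rigidPair {F : Type*} [Field F] {π : F[X]} [Fact (Irreducible π)] :
    RigidPair (resSq (RatFunc F) (AdjoinRoot.mk π)) (unitSq (RatFunc F) (AdjoinRoot.mk π)) where
  grpT := Reduction.isSqGroup_resSq
  grpH := Reduction.isSqGroup_unitSq
  sub := Reduction.resSq_subset_unitSq
  neg_one_mem := ⟨-1, 1, by simp, one_ne_zero, by simp⟩
  rigid := Polynomial.reduction.rigidOutside

namespace WittRel

variable {K L : Type*} [Field K] [Field L] {R : K → L → Prop}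
  {k k' m : Type*} [Field k] [NumberField k] [Field k'] [NumberField k'] [Algebra k k']
  [Field m] [NumberField m] {ι : k →+* K} {j : K →+* RatFunc k'} {α : k'} {ι' : m →+* L}

theorem exists_const (hR : WittRel R) (hj : ConicEmb ι j α)
    (hplaces : ∀ O : ValuationSubring L, O ≠ ⊤ → (∀ c, ι' c ∈ O) →
      (∃ t, ∀ x, x ≠ 0 → x ∈ evenSet O.valuation ∨ x * t ∈ evenSet O.valuation) ∧
        NumberField (IsLocalRing.ResidueField O))
    (hm : ∀ r, IsSquare (ι' r) → IsSquare r)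
    {u : K} {s : m} (hus : R u (ι' s)) : ∃ r w, u = ι r * w ^ 2 := by
  by_contra hu
  have hu0 := hR.left_ne hus
  obtain ⟨π, hπ, hmonic, hnot⟩ := RatFunc.exists_notMem_unitSq (z := j u) (by simpa using hu0)
    fun ⟨c, g, h⟩ => hu (hj.descent u c g hu0 h)
  have hpair := Polynomial.rigidPair (π := π)
  have hpairK := hpair.preimage j
  have hpairm := (hR.rigidPair hpairK).preimage ι'
  have hT := hpairm.grpT
  obtain ⟨z, hz0, hz⟩ := hpairm.atMostFourCosets (x₀ := s)
    (fun h0 => hR.right_ne hus (by simp [h0]))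
    fun h => hnot ((hR.mem_pushSet hpairK.grpH hus).1 h)
  have hp0 : ∀ p : Nat.Primes, ((p : ℕ) : m) ≠ 0 := fun p => by exact_mod_cast p.2.ne_zero
  choose f hf using fun p : Nat.Primes => hz ((p : ℕ) : m) (hp0 p)
  obtain ⟨i, hi⟩ := Finite.exists_infinite_fiber f
  obtain ⟨p₁, hp₁⟩ := hR.exists_infinite_const hj hplaces
    (fun p : f ⁻¹' {i} => ((p.1 : ℕ) : m)) fun p => hp0 _
  have hinf : Infinite {p : f ⁻¹' {i} | ((p.1 : ℕ) : m) * ((p₁.1 : ℕ) : m) ∈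
    {c : m | ∃ r : k, R (ι r) (ι' c)}} := Set.infinite_coe_iff.2 hp₁
  have hex : ∀ p : {p : f ⁻¹' {i} | ((p.1 : ℕ) : m) * ((p₁.1 : ℕ) : m) ∈
    {c : m | ∃ r : k, R (ι r) (ι' c)}},
    ∃ r : k, R (ι r) (ι' (((p.1.1 : ℕ) : m) * ((p₁.1 : ℕ) : m))) := fun p => p.2
  choose r hr using hex
  have hsq : ∀ p, IsSquare (algebraMap k (AdjoinRoot π) (r p)) := by
    intro p
    have h1 := hT.of_mul_sq_mem (x := ((p.1.1 : ℕ) : m) * ((p₁.1 : ℕ) : m)) (z := z i) (by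
      have e1 := hf p.1.1
      have e2 := hf p₁.1
      rw [show f p.1.1 = i from p.1.2] at e1
      rw [show f p₁.1 = i from p₁.2] at e2
      rw [mul_comm _ (z i)] at e2
      convert hT.mul_mem e1 e2 using 1
      ring)
    have h2 : j (ι (r p)) ∈ resSq (RatFunc k') (AdjoinRoot.mk π) :=
      (hR.mem_pushSet hpairK.grpT (hr p)).1 h1
    have hr0 : algebraMap k k' (r p) ≠ 0 := by
      rw [Ne, map_eq_zero]
      rintro h0
      exact hR.left_ne (hr p) (by simp [h0])
    rw [hj.const, ← RatFunc.algebraMap_C, ← mul_one (algebraMap _ _ _), ← one_pow 2] at h2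
    have h3 := Polynomial.reduction.isSquare_of_mem_resSq
      (by rw [AdjoinRoot.mk_C]; simpa using hr0) one_ne_zero h2
    rw [AdjoinRoot.mk_C] at h3
    rwa [IsScalarTower.algebraMap_apply k k' (AdjoinRoot π), AdjoinRoot.algebraMap_eq]
  have hfk : Module.Finite k k' := Module.Finite.of_restrictScalars_finite ℚ k k'
  have hfπ : Module.Finite k' (AdjoinRoot π) := hmonic.finite_adjoinRoot
  have hfin : Module.Finite k (AdjoinRoot π) := Module.Finite.trans k' _
  obtain ⟨p₂, hp₂⟩ := exists_infinite_isSquare_mul r hsq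
  refine (hp₂.image (f := fun p => p.1.1) fun a _ b _ hab =>
    Subtype.ext (Subtype.ext hab)) (finite_of_isSquare_prime_mul (m := m) (p₁ := p₂.1.1) ?_)
  rintro _ ⟨p, hp, rfl⟩
  rw [Set.mem_ofPred_eq] at hp
  have h4 : IsSquare (ι (r p) * ι (r p₂)) := by
    rw [← map_mul]
    exact hp.map ι
  have h5 := hm _ (by
    rw [map_mul]
    exact hR.isSquare_right (hR.mul (hr p) (hr p₂)) h4)
  obtain ⟨t, ht⟩ := h5
  have h6 := hp0 p₁.1
  refine ⟨t / ((p₁.1 : ℕ) : m), ?_⟩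
  field_simp
  linear_combination ht

end WittRel

/-! ### The theorem -/

theorem sqCl_eq_iff {K : Type*} [Field K] {u v : Kˣ} :
    sqCl u = sqCl v ↔ ∃ w : K, (u : K) = v * w ^ 2 := by
  rw [eq_comm, sqCl, sqCl, QuotientGroup.eq, sqSubgroup, MonoidHom.mem_range]
  constructor
  · rintro ⟨w, hw⟩
    refine ⟨w, ?_⟩
    rw [powMonoidHom_apply] at hw
    rw [← Units.val_pow_eq_pow_val, hw, ← Units.val_mul, mul_inv_cancel_left]
  · rintro ⟨w, hw⟩
    have hw0 : w ≠ 0 := by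
      rintro rfl
      exact u.ne_zero (by simp [hw])
    refine ⟨Units.mk0 w hw0, ?_⟩
    rw [powMonoidHom_apply, eq_inv_mul_iff_mul_eq]
    ext
    simp [hw]

theorem sqCl_eq_one_iff {K : Type*} [Field K] {u : Kˣ} : sqCl u = 1 ↔ IsSquare (u : K) := by
  rw [show (1 : SqClass K) = sqCl 1 from rfl, sqCl_eq_iff]
  simp [isSquare_iff_exists_sq]

/-- The relation between nonzero elements given by a map of square classes. -/
def sqRel {K L : Type*} [Field K] [Field L] (α : SqClass K ≃* SqClass L) (x : K) (y : L) : Prop :=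
  ∃ (u : Kˣ) (v : Lˣ), (u : K) = x ∧ (v : L) = y ∧ α (sqCl u) = sqCl v

theorem IsWittEquiv.wittRel {K L : Type*} [Field K] [Field L] {α : SqClass K ≃* SqClass L}
    (hα : IsWittEquiv α) : WittRel (sqRel α) where
  left_ne := by
    rintro _ _ ⟨u, v, rfl, rfl, -⟩
    exact u.ne_zero
  right_ne := by
    rintro _ _ ⟨u, v, rfl, rfl, -⟩
    exact v.ne_zero
  left_total {x} hx := by
    obtain ⟨v, hv⟩ := QuotientGroup.mk_surjective (α (sqCl (Units.mk0 x hx)))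
    exact ⟨v, Units.mk0 x hx, v, rfl, rfl, hv.symm⟩
  right_total {y} hy := by
    obtain ⟨u, hu⟩ := QuotientGroup.mk_surjective (α.symm (sqCl (Units.mk0 y hy)))
    exact ⟨u, u, Units.mk0 y hy, rfl, rfl, by rw [sqCl, hu, α.apply_symm_apply]⟩
  mul := by
    rintro _ _ _ _ ⟨u, v, rfl, rfl, h⟩ ⟨u', v', rfl, rfl, h'⟩
    refine ⟨u * u', v * v', by simp, by simp, ?_⟩
    rw [sqCl, QuotientGroup.mk_mul, map_mul]
    exact congrArg₂ (· * ·) h h'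
  sq {x y} hx hy := by
    refine ⟨Units.mk0 x hx ^ 2, Units.mk0 y hy ^ 2, by simp, by simp, ?_⟩
    rw [sqCl_eq_one_iff.2 ⟨x, by simp [pow_two]⟩, sqCl_eq_one_iff.2 ⟨y, by simp [pow_two]⟩,
      map_one]
  isSquare_left := by
    rintro _ _ ⟨u, v, rfl, rfl, h⟩ hv
    rwa [← sqCl_eq_one_iff, ← α.map_eq_one_iff, h, sqCl_eq_one_iff]
  isSquare_right := by
    rintro _ _ ⟨u, v, rfl, rfl, h⟩ hv
    rwa [← sqCl_eq_one_iff, ← h, α.map_eq_one_iff, sqCl_eq_one_iff]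
  neg_one := ⟨-1, -1, by simp, by simp, hα.map_neg_one⟩
  repr_left := by
    rintro _ _ _ _ _ _ ⟨a, a', rfl, rfl, h1⟩ ⟨b, b', rfl, rfl, h2⟩ ⟨c, c', rfl, rfl, h3⟩
    exact (hα.represents a b c a' b' c' h1 h2 h3).2
  repr_right := by
    rintro _ _ _ _ _ _ ⟨a, a', rfl, rfl, h1⟩ ⟨b, b', rfl, rfl, h2⟩ ⟨c, c', rfl, rfl, h3⟩
    exact (hα.represents a b c a' b' c' h1 h2 h3).1

/-- Classes corresponding to constants are classes of constants. -/
theorem WittRel.exists_sqCl_eq {k l K L : Type*} [Field k] [NumberField k] [Field l]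
    [NumberField l] [Field K] [Field L] {a b : k} (ha : a ≠ 0) (hb : b ≠ 0) {c d : l}
    (hc : c ≠ 0) (hd : d ≠ 0) {ι : k →+* K} (hK : IsConicFunctionField k a b K ι)
    {ι' : l →+* L} (hL : IsConicFunctionField l c d L ι') {R : K → L → Prop} (hR : WittRel R)
    {u : Kˣ} {s : l} (hus : R u (ι' s)) :
    ∃ r : kˣ, sqCl u = sqCl (Units.map ι.toMonoidHom r) := by
  obtain ⟨x, y, hx, hlift⟩ := exists_conicGen hb hK
  obtain ⟨x', y', hx', -⟩ := exists_conicGen.{_, _, 0} hd hL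
  obtain ⟨k', _, _, _, j, α, hj⟩ := hx.exists_conicEmb ha hb hlift
  obtain ⟨r, w, h⟩ := hR.exists_const hj hx'.places
    (fun r => hx'.isSquare_of_isSquare_map hc hd) hus
  have hr : r ≠ 0 := by
    rintro rfl
    exact u.ne_zero (by simp [h])
  exact ⟨Units.mk0 r hr, sqCl_eq_iff.2 ⟨w, h⟩⟩

/-- Let `k, ℓ` be number fields, `K = k_{a,b}`, `L = ℓ_{c,d}`, and `α` a Witt equivalence
from `K` to `L`.  Then for every `u ∈ Kˣ`, the square class of `u` comes from `kˣ` if and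
only if `α(ū)` comes from `ℓˣ`. -/
theorem wittEquiv_conic_maps_constants_to_constants
    (k : Type*) [Field k] [NumberField k] (l : Type*) [Field l] [NumberField l]
    (a b : k) (ha : a ≠ 0) (hb : b ≠ 0) (c d : l) (hc : c ≠ 0) (hd : d ≠ 0)
    (K : Type*) [Field K] (ι : k →+* K) (hK : IsConicFunctionField k a b K ι)
    (L : Type*) [Field L] (ι' : l →+* L) (hL : IsConicFunctionField l c d L ι')
    (α : SqClass K ≃* SqClass L) (hα : IsWittEquiv α) :
    ∀ u : Kˣ,
      (∃ r : kˣ, sqCl u = sqCl (Units.map ι.toMonoidHom r)) ↔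
        (∃ s : lˣ, α (sqCl u) = sqCl (Units.map ι'.toMonoidHom s)) := by
  have hR := hα.wittRel
  intro u
  constructor
  · rintro ⟨r, hr⟩
    obtain ⟨v, hv⟩ := QuotientGroup.mk_surjective (α (sqCl u))
    rw [← hv]
    exact hR.flip.exists_sqCl_eq hc hd ha hb hL hK (u := v) (s := r)
      ⟨Units.map ι.toMonoidHom r, v, rfl, rfl, by rw [← hr, ← hv]; rfl⟩
  · rintro ⟨s, hs⟩
    exact hR.exists_sqCl_eq ha hb hc hd hK hL (s := s)
      ⟨u, Units.map ι'.toMonoidHom s, rfl, rfl, hs⟩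

end
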